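/- A fullerene graph is 3-resonant if and only if it is k-resonant for every integer k ≥ 3. -/

import Mathlib

open SimpleGraph

/-- The set of vertices incident with some edge of a face boundary. -/
def faceVerts (f : Finset (Sym2 V)) : Set V := {v | ∃ e ∈ f, v ∈ e}

/-- `G` has a perfect matching. -/
def HasPM (G : SimpleGraph V) : Prop := ∃ M : G.Subgraph, M.IsPerfectMatching

/-- Number of odd connected components of `G`. -/
noncomputable def oddComponents (G : SimpleGraph V) : ℕ :=
  Nat.card {c : G.ConnectedComponent // Odd (Nat.card c.supp)}

/-- `G` is cyclically `k`-edge-connected: no set of fewer than `k` edges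
separates `G` into two parts each containing a cycle. -/
def CycEdgeConn (G : SimpleGraph V) (k : ℕ) : Prop :=
  ∀ D : Finset (Sym2 V), D.card < k →
    ¬ ∃ A : Set V, (∀ a ∈ A, ∀ b ∉ A, ¬ (G.deleteEdges (↑D : Set (Sym2 V))).Adj a b) ∧
      ¬ (G.induce A).IsAcyclic ∧ ¬ (G.induce Aᶜ).IsAcyclic

/-- A combinatorial fullerene: a cubic, 3-connected plane graph presented together with
its face boundaries (as edge sets of boundary cycles), every face a pentagon or a
hexagon, each edge on exactly two faces, Euler's formula, and exactly 12 pentagons. -/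
structure IsFullerene [Fintype V] [DecidableEq V] (G : SimpleGraph V)
    (faces : Finset (Finset (Sym2 V))) : Prop where
  cubic : ∀ v : V, (G.neighborSet v).ncard = 3
  card_ge : 4 ≤ Fintype.card V
  threeConnected : ∀ s : Set V, s.ncard ≤ 2 → (G.induce sᶜ).Connected
  face_cycle : ∀ f ∈ faces, ∃ (v : V) (c : G.Walk v v), c.IsCycle ∧ c.edges.toFinset = f
  face_size : ∀ f ∈ faces, f.card = 5 ∨ f.card = 6
  edge_two_faces : ∀ e ∈ G.edgeSet, (faces.filter (fun f => e ∈ f)).card = 2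
  euler : Fintype.card V + faces.card = G.edgeSet.ncard + 2
  pentagons : (faces.filter (fun f => f.card = 5)).card = 12
/-- The face `f` is `M`-alternating: every vertex of `f` is matched by `M`
along an edge of `f`. -/
def AltFace (G : SimpleGraph V) (M : G.Subgraph) (f : Finset (Sym2 V)) : Prop :=
  ∀ v ∈ faceVerts f, ∃ u, s(v, u) ∈ f ∧ M.Adj v u

/-- A set of (disjoint hexagonal) faces is a resonant pattern if some perfect matching
of `G` is alternating on all of them. -/
def IsResonantPattern (G : SimpleGraph V) (H : Finset (Finset (Sym2 V))) : Prop :=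
  ∃ M : G.Subgraph, M.IsPerfectMatching ∧ ∀ f ∈ H, AltFace G M f

/-- `G` (with face set `faces`) is `k`-resonant. -/
def KResonant [Fintype V] [DecidableEq V] (G : SimpleGraph V)
    (faces : Finset (Finset (Sym2 V))) (k : ℕ) : Prop :=
  ∀ H : Finset (Finset (Sym2 V)), H ⊆ faces → (∀ f ∈ H, f.card = 6) →
    (∀ f ∈ H, ∀ g ∈ H, f ≠ g → Disjoint (faceVerts f) (faceVerts g)) →
    H.card ≤ k → IsResonantPattern G H

/-- A cyclic parametrisation of the boundary of a face of length `n`. -/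
structure FaceParam {V : Type*} (G : SimpleGraph V) (f : Finset (Sym2 V)) (n : ℕ)
    (u : ℕ → V) : Prop where
  inj : ∀ i j, u i = u j ↔ i % n = j % n
  adj : ∀ i, G.Adj (u i) (u (i + 1))
  mem : ∀ e, e ∈ f ↔ ∃ i, e = s(u i, u (i + 1))

section Fullerene

variable {V : Type*} [Fintype V] [DecidableEq V] {G : SimpleGraph V}
  {faces : Finset (Finset (Sym2 V))}

theorem IsFullerene.exists_faceParam (hF : IsFullerene G faces) {f : Finset (Sym2 V)}
    (hf : f ∈ faces) : ∃ u, FaceParam G f f.card u := by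
  obtain ⟨v, c, hc, rfl⟩ := hF.face_cycle f hf
  have hcard : c.edges.toFinset.card = c.length := by
    rw [List.toFinset_card_of_nodup hc.edges_nodup, Walk.length_edges]
  rw [hcard]
  have h3 := hc.three_le_length
  have hstep : ∀ i, c.getVert ((i + 1) % c.length) = c.getVert (i % c.length + 1) := by
    intro i
    have := Nat.mod_lt i (show 0 < c.length by omega)
    rcases Nat.lt_or_ge (i % c.length + 1) c.length with h | h
    · rw [Nat.add_mod, Nat.mod_eq_of_lt (show 1 < c.length by omega), Nat.mod_eq_of_lt h]
    · have h' : i % c.length + 1 = c.length := by omega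
      rw [Nat.add_mod, Nat.mod_eq_of_lt (show 1 < c.length by omega), h']
      simp
  refine ⟨fun i => c.getVert (i % c.length), ?_, ?_, ?_⟩
  · intro i j
    constructor
    · intro h
      have hi := Nat.mod_lt i (show 0 < c.length by omega)
      have hj := Nat.mod_lt j (show 0 < c.length by omega)
      exact hc.getVert_injOn' (by simp; omega) (by simp; omega) h
    · intro h; simp [h]
  · intro i
    simp only [hstep]
    exact c.adj_getVert_succ (Nat.mod_lt i (show 0 < c.length by omega))
  · intro e
    rw [List.mem_toFinset]
    constructor
    · intro he
      obtain ⟨i, hi, rfl⟩ := List.getElem_of_mem he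
      refine ⟨i, ?_⟩
      have hi' : i < c.length := by simpa using hi
      simp only [hstep]
      rw [Nat.mod_eq_of_lt hi', Walk.getElem_edges]
    · rintro ⟨i, rfl⟩
      simp only [hstep]
      have hi := Nat.mod_lt i (show 0 < c.length by omega)
      have : (c.edges)[i % c.length]'(by simpa using hi) ∈ c.edges := List.getElem_mem _
      rwa [Walk.getElem_edges] at this

theorem IsFullerene.exists_faceParam_at (hF : IsFullerene G faces) {f : Finset (Sym2 V)}
    (hf : f ∈ faces) {v w : V} (he : s(v, w) ∈ f) :
    ∃ u, FaceParam G f f.card u ∧ u 0 = v ∧ u 1 = w := by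
  obtain ⟨u, hu⟩ := hF.exists_faceParam hf
  obtain ⟨i, hi⟩ := (hu.mem _).1 he
  have h56 := hF.face_size f hf
  generalize f.card = n at *
  rw [Sym2.eq_iff] at hi
  rcases hi with ⟨h1, h2⟩ | ⟨h1, h2⟩
  · refine ⟨fun k => u (i + k), ⟨?_, ?_, ?_⟩, by simp [h1], by simp [h2]⟩
    · intro a b
      simp only [hu.inj]
      rcases h56 with rfl | rfl <;> omega
    · intro a; exact hu.adj _
    · intro e
      rw [hu.mem]
      constructor
      · rintro ⟨j, rfl⟩
        refine ⟨j + (n - 1) * i, ?_⟩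
        have e1 : u j = u (i + (j + (n - 1) * i)) := by
          rw [hu.inj]; rcases h56 with rfl | rfl <;> omega
        have e2 : u (j + 1) = u (i + (j + (n - 1) * i + 1)) := by
          rw [hu.inj]; rcases h56 with rfl | rfl <;> omega
        rw [e1, e2]
      · rintro ⟨j, rfl⟩; exact ⟨i + j, rfl⟩
  · have hback : ∀ k, u (i + 1 + (n - 1) * k) = u (i + 1 + (n - 1) * (k + 1) + 1) := by
      intro k; rw [hu.inj]; rcases h56 with rfl | rfl <;> omega
    refine ⟨fun k => u (i + 1 + (n - 1) * k), ⟨?_, ?_, ?_⟩, by simp [h1], ?_⟩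
    · intro a b
      simp only [hu.inj]
      rcases h56 with rfl | rfl <;> omega
    · intro a
      rw [hback]
      exact (hu.adj _).symm
    · intro e
      rw [hu.mem]
      constructor
      · rintro ⟨j, rfl⟩
        refine ⟨(i + (n - 1) * j), ?_⟩
        have e1 : u j = u (i + 1 + (n - 1) * (i + (n - 1) * j + 1)) := by
          rw [hu.inj]; rcases h56 with rfl | rfl <;> omega
        have e2 : u (j + 1) = u (i + 1 + (n - 1) * (i + (n - 1) * j)) := by
          rw [hu.inj]; rcases h56 with rfl | rfl <;> omega
        rw [e1, e2, Sym2.eq_swap]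
      · rintro ⟨j, rfl⟩
        refine ⟨i + 1 + (n - 1) * (j + 1), ?_⟩
        rw [hback j, Sym2.eq_swap]
    · simp only [h2]
      rw [hu.inj]; rcases h56 with rfl | rfl <;> omega

theorem IsFullerene.adj_of_mem (hF : IsFullerene G faces) {f : Finset (Sym2 V)}
    (hf : f ∈ faces) {v w : V} (he : s(v, w) ∈ f) : G.Adj v w := by
  obtain ⟨u, hu, rfl, rfl⟩ := hF.exists_faceParam_at hf he
  exact hu.adj 0

/-- Faces are 2-regular. -/
theorem IsFullerene.exists_other (hF : IsFullerene G faces) {f : Finset (Sym2 V)}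
    (hf : f ∈ faces) {v w : V} (he : s(v, w) ∈ f) :
    ∃ t, t ≠ w ∧ s(v, t) ∈ f ∧ ∀ r, s(v, r) ∈ f → r = w ∨ r = t := by
  obtain ⟨u, hu, hv, hw⟩ := hF.exists_faceParam_at hf he
  have h56 := hF.face_size f hf
  generalize f.card = n at *
  have h0 : u (n - 1 + 1) = u 0 := by rw [hu.inj]; rcases h56 with rfl | rfl <;> omega
  refine ⟨u (n - 1), ?_, ?_, ?_⟩
  · rw [← hw, Ne, hu.inj]; rcases h56 with rfl | rfl <;> omega
  · rw [hu.mem]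
    exact ⟨n - 1, by rw [h0, hv, Sym2.eq_swap]⟩
  · intro r hr
    obtain ⟨i, hi⟩ := (hu.mem _).1 hr
    rw [Sym2.eq_iff, ← hv] at hi
    rcases hi with ⟨h1, rfl⟩ | ⟨h1, rfl⟩
    · left; rw [← hw, hu.inj]; rw [hu.inj] at h1; rcases h56 with rfl | rfl <;> omega
    · right; rw [hu.inj]; rw [hu.inj] at h1; rcases h56 with rfl | rfl <;> omega

/-- The other face at an edge. -/
theorem IsFullerene.exists_otherFace (hF : IsFullerene G faces) {f : Finset (Sym2 V)}
    (hf : f ∈ faces) {e : Sym2 V} (he : e ∈ f) :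
    ∃ g ∈ faces, g ≠ f ∧ e ∈ g ∧ ∀ h ∈ faces, e ∈ h → h = f ∨ h = g := by
  have hG : e ∈ G.edgeSet := by
    induction e with | _ v w => exact hF.adj_of_mem hf he
  have h2 := hF.edge_two_faces e hG
  obtain ⟨a, b, hab, h⟩ := Finset.card_eq_two.1 h2
  have hm : ∀ x, (x ∈ faces ∧ e ∈ x) ↔ x = a ∨ x = b := by
    intro x
    have := Finset.ext_iff.1 h x
    simpa using this
  rcases (hm f).1 ⟨hf, he⟩ with rfl | rfl
  · have := (hm b).2 (Or.inr rfl)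
    exact ⟨b, this.1, hab.symm, this.2, fun x h1 h2 => (hm x).1 ⟨h1, h2⟩⟩
  · have := (hm a).2 (Or.inl rfl)
    exact ⟨a, this.1, hab, this.2, fun x h1 h2 => ((hm x).1 ⟨h1, h2⟩).symm⟩

theorem IsFullerene.exists_third (hF : IsFullerene G faces) {v a b : V} (ha : G.Adj v a)
    (hb : G.Adj v b) (hab : a ≠ b) :
    ∃ t, G.Adj v t ∧ t ≠ a ∧ t ≠ b ∧ ∀ r, G.Adj v r → r = a ∨ r = b ∨ r = t := by
  have h3 := hF.cubic v
  obtain ⟨x, y, z, hxy, hxz, hyz, h⟩ := Set.ncard_eq_three.1 h3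
  have hm : ∀ r, G.Adj v r ↔ r = x ∨ r = y ∨ r = z := by
    intro r
    have := Set.ext_iff.1 h r
    simpa using this
  have h1 := (hm a).1 ha
  have h2 := (hm b).1 hb
  have hx := (hm x).2 (by simp)
  have hy := (hm y).2 (by simp)
  have hz := (hm z).2 (by simp)
  rcases h1 with rfl | rfl | rfl <;> rcases h2 with rfl | rfl | rfl
  · exact absurd rfl hab
  · exact ⟨z, hz, hxz.symm, hyz.symm, fun r hr => (hm r).1 hr⟩
  · exact ⟨y, hy, hxy.symm, hyz, fun r hr => by have := (hm r).1 hr; tauto⟩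
  · exact ⟨z, hz, hyz.symm, hxz.symm, fun r hr => by have := (hm r).1 hr; tauto⟩
  · exact absurd rfl hab
  · exact ⟨x, hx, hxy, hxz, fun r hr => by have := (hm r).1 hr; tauto⟩
  · exact ⟨y, hy, hyz, hxy.symm, fun r hr => by have := (hm r).1 hr; tauto⟩
  · exact ⟨x, hx, hxz, hxy, fun r hr => by have := (hm r).1 hr; tauto⟩
  · exact absurd rfl hab

/-- Two edges at a common vertex lie in at most one common face. -/
theorem IsFullerene.face_unique (hF : IsFullerene G faces) {f g : Finset (Sym2 V)}
    (hf : f ∈ faces) (hg : g ∈ faces) {v a b : V} (hab : a ≠ b) (hfa : s(v, a) ∈ f)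
    (hfb : s(v, b) ∈ f) (hga : s(v, a) ∈ g) (hgb : s(v, b) ∈ g) : f = g := by
  by_contra hfg
  obtain ⟨t, ht, hta, htb, -⟩ :=
    hF.exists_third (hF.adj_of_mem hf hfa) (hF.adj_of_mem hf hfb) hab
  obtain ⟨h, hh⟩ : ∃ h, h ∈ faces.filter (fun f => s(v, t) ∈ f) := by
    apply Finset.card_pos.1
    rw [hF.edge_two_faces s(v, t) ht]; norm_num
  simp only [Finset.mem_filter] at hh
  have key : ∀ h ∈ faces, s(v, t) ∈ h → ¬ (s(v, a) ∈ h ∧ s(v, b) ∈ h) := by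
    rintro h h1 h2 ⟨h3, h4⟩
    obtain ⟨r, hr, -, h5⟩ := hF.exists_other h1 h2
    rcases h5 a h3 with h | h
    · exact hta h.symm
    · rcases h5 b h4 with h' | h'
      · exact htb h'.symm
      · exact hab (h.trans h'.symm)
  obtain ⟨r, hr, hr', -⟩ := hF.exists_other hh.1 hh.2
  have hrv := hF.adj_of_mem hh.1 hr'
  obtain ⟨t', ht', hta', htb', hall⟩ :=
    hF.exists_third (hF.adj_of_mem hf hfa) (hF.adj_of_mem hf hfb) hab
  have htt : t = t' := by
    rcases hall t ht with h | h | h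
    · exact absurd h hta
    · exact absurd h htb
    · exact h
  rcases hall r hrv with rfl | rfl | rfl
  · obtain ⟨k, hk, -, -, hk'⟩ := hF.exists_otherFace hf hfa
    have h1 := hk' h hh.1 hr'
    have h2 := hk' g hg hga
    have : h = f ∨ h = g := by
      rcases h1 with h1 | h1 <;> rcases h2 with h2 | h2
      · exact Or.inl h1
      · exact Or.inl h1
      · exact absurd h2.symm hfg
      · exact Or.inr (h1.trans h2.symm)
    rcases this with rfl | rfl
    · exact key _ hf hh.2 ⟨hfa, hfb⟩
    · exact key _ hg hh.2 ⟨hga, hgb⟩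
  · obtain ⟨k, hk, -, -, hk'⟩ := hF.exists_otherFace hf hfb
    have h1 := hk' h hh.1 hr'
    have h2 := hk' g hg hgb
    have : h = f ∨ h = g := by
      rcases h1 with h1 | h1 <;> rcases h2 with h2 | h2
      · exact Or.inl h1
      · exact Or.inl h1
      · exact absurd h2.symm hfg
      · exact Or.inr (h1.trans h2.symm)
    rcases this with rfl | rfl
    · exact key _ hf hh.2 ⟨hfa, hfb⟩
    · exact key _ hg hh.2 ⟨hga, hgb⟩
  · exact hr htt.symm

theorem IsFullerene.exists_face (hF : IsFullerene G faces) {v w : V} (h : G.Adj v w) :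
    ∃ f ∈ faces, s(v, w) ∈ f := by
  obtain ⟨f, hf⟩ : ∃ f, f ∈ faces.filter (fun f => s(v, w) ∈ f) := by
    apply Finset.card_pos.1
    rw [hF.edge_two_faces s(v, w) h]; norm_num
  simp only [Finset.mem_filter] at hf
  exact ⟨f, hf⟩

/-- Any two edges at a vertex lie in a common face. -/
theorem IsFullerene.exists_common_face (hF : IsFullerene G faces) {v a b : V}
    (ha : G.Adj v a) (hb : G.Adj v b) (hab : a ≠ b) :
    ∃ f ∈ faces, s(v, a) ∈ f ∧ s(v, b) ∈ f := by
  obtain ⟨t, ht, hta, htb, hall⟩ := hF.exists_third ha hb hab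
  obtain ⟨f, hf, hfa⟩ := hF.exists_face ha
  obtain ⟨g, hg, hgf, hga, -⟩ := hF.exists_otherFace hf hfa
  obtain ⟨x, hx, hx', -⟩ := hF.exists_other hf hfa
  obtain ⟨y, hy, hy', -⟩ := hF.exists_other hg hga
  rcases hall x (hF.adj_of_mem hf hx') with rfl | rfl | rfl
  · exact absurd rfl hx
  · exact ⟨f, hf, hfa, hx'⟩
  · rcases hall y (hF.adj_of_mem hg hy') with rfl | rfl | rfl
    · exact absurd rfl hy
    · exact ⟨g, hg, hga, hy'⟩
    · exact absurd (hF.face_unique hg hf hta.symm hga hy' hfa hx') hgf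

end Fullerene

/-- A flag: a face together with a directed boundary edge. -/
@[ext] structure FaceFlag {V : Type*} (faces : Finset (Finset (Sym2 V))) where
  v : V
  w : V
  f : Finset (Sym2 V)
  mem : f ∈ faces
  edge : s(v, w) ∈ f

section FlagOps

variable {V : Type*} [Fintype V] [DecidableEq V] {G : SimpleGraph V}
  {faces : Finset (Finset (Sym2 V))}

/-- Reverse the direction of the edge. -/
def FaceFlag.mu (x : FaceFlag faces) : FaceFlag faces := ⟨x.w, x.v, x.f, x.mem, by
  rw [Sym2.eq_swap]; exact x.edge⟩

omit [Fintype V] [DecidableEq V] in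
@[simp] theorem FaceFlag.mu_mu (x : FaceFlag faces) : x.mu.mu = x := rfl

/-- Length of the face of a flag. -/
def FaceFlag.sz (x : FaceFlag faces) : ℕ := x.f.card

namespace IsFullerene

variable (hF : IsFullerene G faces)
include hF

theorem adj (x : FaceFlag faces) : G.Adj x.v x.w := hF.adj_of_mem x.mem x.edge

/-- Next directed edge along the face. -/
noncomputable def nx (x : FaceFlag faces) : FaceFlag faces :=
  ⟨x.w, (hF.exists_other x.mem x.mu.edge).choose, x.f, x.mem,
    (hF.exists_other x.mem x.mu.edge).choose_spec.2.1⟩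

/-- Previous directed edge along the face. -/
noncomputable def pv (x : FaceFlag faces) : FaceFlag faces := (hF.nx x.mu).mu

/-- The same edge, reversed, in the other face. -/
noncomputable def gl (x : FaceFlag faces) : FaceFlag faces :=
  ⟨x.w, x.v, (hF.exists_otherFace x.mem x.edge).choose,
    (hF.exists_otherFace x.mem x.edge).choose_spec.1,
    (congrArg (· ∈ (hF.exists_otherFace x.mem x.edge).choose) Sym2.eq_swap).mp
      (hF.exists_otherFace x.mem x.edge).choose_spec.2.2.1⟩

@[simp] theorem nx_v (x : FaceFlag faces) : (hF.nx x).v = x.w := rfl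
@[simp] theorem nx_f (x : FaceFlag faces) : (hF.nx x).f = x.f := rfl
@[simp] theorem pv_w (x : FaceFlag faces) : (hF.pv x).w = x.v := rfl
@[simp] theorem pv_f (x : FaceFlag faces) : (hF.pv x).f = x.f := rfl
@[simp] theorem gl_v (x : FaceFlag faces) : (hF.gl x).v = x.w := rfl
@[simp] theorem gl_w (x : FaceFlag faces) : (hF.gl x).w = x.v := rfl

theorem nx_w_ne (x : FaceFlag faces) : (hF.nx x).w ≠ x.v :=
  (hF.exists_other x.mem x.mu.edge).choose_spec.1

theorem eq_or_eq_nx (x : FaceFlag faces) {r : V} (hr : s(x.w, r) ∈ x.f) :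
    r = x.v ∨ r = (hF.nx x).w :=
  (hF.exists_other x.mem x.mu.edge).choose_spec.2.2 r hr

theorem eq_nx {x y : FaceFlag faces} (hv : y.v = x.w) (hf : y.f = x.f) (hw : y.w ≠ x.v) :
    y = hF.nx x := by
  have h := y.edge
  rw [hv, hf] at h
  exact FaceFlag.ext hv ((hF.eq_or_eq_nx x h).resolve_left hw) hf

theorem pv_v_ne (x : FaceFlag faces) : (hF.pv x).v ≠ x.w := hF.nx_w_ne x.mu

@[simp] theorem pv_nx (x : FaceFlag faces) : hF.pv (hF.nx x) = x := by
  have : x.mu = hF.nx (hF.nx x).mu :=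
    hF.eq_nx rfl rfl (hF.nx_w_ne x).symm
  rw [pv, ← this, FaceFlag.mu_mu]

theorem mu_pv (x : FaceFlag faces) : (hF.pv x).mu = hF.nx x.mu := rfl

theorem pv_mu (x : FaceFlag faces) : hF.pv x.mu = (hF.nx x).mu := rfl

@[simp] theorem nx_pv (x : FaceFlag faces) : hF.nx (hF.pv x) = x := by
  have := hF.pv_nx x.mu
  rw [← mu_pv, pv_mu] at this
  have := congrArg FaceFlag.mu this
  simpa using this

theorem gl_f_ne (x : FaceFlag faces) : (hF.gl x).f ≠ x.f :=
  (hF.exists_otherFace x.mem x.edge).choose_spec.2.1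

theorem eq_or_eq_gl (x : FaceFlag faces) {h : Finset (Sym2 V)} (hh : h ∈ faces)
    (he : s(x.v, x.w) ∈ h) : h = x.f ∨ h = (hF.gl x).f :=
  (hF.exists_otherFace x.mem x.edge).choose_spec.2.2.2 h hh he

theorem eq_gl {x y : FaceFlag faces} (hv : y.v = x.w) (hw : y.w = x.v) (hf : y.f ≠ x.f) :
    y = hF.gl x := by
  have h := y.edge
  rw [hv, hw, Sym2.eq_swap] at h
  exact FaceFlag.ext hv hw ((hF.eq_or_eq_gl x y.mem h).resolve_left hf)

@[simp] theorem gl_gl (x : FaceFlag faces) : hF.gl (hF.gl x) = x :=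
  (hF.eq_gl rfl rfl (hF.gl_f_ne x).symm).symm

theorem gl_mu (x : FaceFlag faces) : hF.gl x.mu = (hF.gl x).mu :=
  (hF.eq_gl (x := x.mu) (y := (hF.gl x).mu) rfl rfl (hF.gl_f_ne x)).symm

theorem gl_inj {x y : FaceFlag faces} (h : hF.gl x = hF.gl y) : x = y := by
  rw [← hF.gl_gl x, h, hF.gl_gl]

theorem nx_inj {x y : FaceFlag faces} (h : hF.nx x = hF.nx y) : x = y := by
  rw [← hF.pv_nx x, h, hF.pv_nx]

theorem pv_inj {x y : FaceFlag faces} (h : hF.pv x = hF.pv y) : x = y := by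
  rw [← hF.nx_pv x, h, hF.nx_pv]

/-- Rotation about the initial vertex. -/
noncomputable def rot (x : FaceFlag faces) : FaceFlag faces := hF.gl (hF.pv x)

@[simp] theorem rot_v (x : FaceFlag faces) : (hF.rot x).v = x.v := rfl

theorem rot_w (x : FaceFlag faces) : (hF.rot x).w = (hF.pv x).v := rfl

theorem f_eq_of_two {x y : FaceFlag faces} {v a b : V} (hab : a ≠ b) (hxa : s(v, a) ∈ x.f)
    (hxb : s(v, b) ∈ x.f) (hya : s(v, a) ∈ y.f) (hyb : s(v, b) ∈ y.f) : x.f = y.f :=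
  hF.face_unique x.mem y.mem hab hxa hxb hya hyb

theorem pv_edge (x : FaceFlag faces) : s(x.v, (hF.pv x).v) ∈ x.f := by
  have := (hF.pv x).edge
  rw [Sym2.eq_swap] at this
  exact this

theorem rot_f_ne (x : FaceFlag faces) : (hF.rot x).f ≠ x.f := hF.gl_f_ne _

theorem rot_edge (x : FaceFlag faces) : s(x.v, (hF.rot x).w) ∈ x.f := hF.pv_edge x

theorem rot_w_ne (x : FaceFlag faces) : (hF.rot x).w ≠ x.w := hF.pv_v_ne x

theorem rot_adj (x : FaceFlag faces) : G.Adj x.v (hF.rot x).w := hF.adj (hF.rot x)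

theorem rot_rot_w_ne (x : FaceFlag faces) : (hF.rot (hF.rot x)).w ≠ x.w := by
  intro h
  have h1 := hF.rot_edge (hF.rot x)
  have h2 := (hF.rot x).edge
  simp only [rot_v] at h1 h2
  rw [h] at h1
  exact hF.rot_f_ne x
    (hF.f_eq_of_two (hF.rot_w_ne x) h2 h1 (hF.rot_edge x) x.edge)

theorem eq_of_adj (x : FaceFlag faces) {r : V} (hr : G.Adj x.v r) :
    r = x.w ∨ r = (hF.rot x).w ∨ r = (hF.rot (hF.rot x)).w := by
  obtain ⟨t, -, -, -, h⟩ := hF.exists_third (hF.adj x) (hF.rot_adj x) (hF.rot_w_ne x).symm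
  have h1 := h _ (hF.rot_adj (hF.rot x))
  have h2 := hF.rot_rot_w_ne x
  have h3 := hF.rot_w_ne (hF.rot x)
  have h4 : (hF.rot (hF.rot x)).w = t := by tauto
  rw [h4]
  exact h r hr

@[simp] theorem rot_rot_rot (x : FaceFlag faces) : hF.rot (hF.rot (hF.rot x)) = x := by
  have hw : (hF.rot (hF.rot (hF.rot x))).w = x.w := by
    rcases hF.eq_of_adj x (hF.rot_adj (hF.rot (hF.rot x))) with h | h | h
    · exact h
    · exact absurd h (hF.rot_rot_w_ne (hF.rot x))
    · exact absurd h (hF.rot_w_ne (hF.rot (hF.rot x)))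
  refine FaceFlag.ext rfl hw ?_
  have h1 : s(x.v, x.w) ∈ (hF.rot (hF.rot (hF.rot x))).f := by
    have := (hF.rot (hF.rot (hF.rot x))).edge
    rwa [hw] at this
  have h2 : s(x.v, x.w) ∈ (hF.rot (hF.rot x)).f := by
    have := hF.rot_edge (hF.rot (hF.rot x))
    rwa [hw] at this
  have h3 : (hF.rot (hF.rot x)).f ≠ x.f := by
    intro h
    have h5 := (hF.rot (hF.rot x)).edge
    rw [h] at h5
    obtain ⟨t, -, -, ht⟩ := hF.exists_other x.mem x.edge
    have e1 := ht _ (hF.rot_edge x)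
    have e2 := ht _ h5
    have := hF.rot_w_ne x
    have := hF.rot_rot_w_ne x
    have := hF.rot_w_ne (hF.rot x)
    grind
  have h4 := hF.rot_f_ne (hF.rot (hF.rot x))
  rcases hF.eq_or_eq_gl x (hF.rot (hF.rot (hF.rot x))).mem h1 with h | h
  · exact h
  · rcases hF.eq_or_eq_gl x (hF.rot (hF.rot x)).mem h2 with h' | h'
    · exact absurd h' h3
    · exact absurd (h.trans h'.symm) h4

theorem rot_inj {x y : FaceFlag faces} (h : hF.rot x = hF.rot y) : x = y :=
  hF.pv_inj (hF.gl_inj h)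

/-- A flag sharing its directed edge with `x`. -/
theorem eq_or_eq_of_dir {x y : FaceFlag faces} (hv : y.v = x.v) (hw : y.w = x.w) :
    y = x ∨ y = (hF.gl x).mu := by
  have h := y.edge
  rw [hv, hw] at h
  rcases hF.eq_or_eq_gl x y.mem h with h | h
  · exact Or.inl (FaceFlag.ext hv hw h)
  · exact Or.inr (FaceFlag.ext hv hw h)

theorem flag_induction {S : FaceFlag faces → Prop} (hnx : ∀ x, S x → S (hF.nx x))
    (hgl : ∀ x, S x → S (hF.gl x)) (hmu : ∀ x, S x → S x.mu) {x : FaceFlag faces} (hx : S x)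
    (y : FaceFlag faces) : S y := by
  have hpv : ∀ x, S x → S (hF.pv x) := fun x h => hmu _ (hnx _ (hmu _ h))
  have hrot : ∀ x, S x → S (hF.rot x) := fun x h => hgl _ (hpv _ h)
  have hvert : ∀ x y : FaceFlag faces, S x → y.v = x.v → S y := by
    intro x y hx hv
    have key : ∀ z : FaceFlag faces, S z → y.v = z.v → y.w = z.w → S y := by
      intro z hz h1 h2
      rcases hF.eq_or_eq_of_dir h1 h2 with rfl | rfl
      · exact hz
      · exact hmu _ (hgl _ hz)
    have ha := hF.adj y
    rw [hv] at ha
    rcases hF.eq_of_adj x ha with h | h | h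
    · exact key _ hx hv h
    · exact key _ (hrot _ hx) hv h
    · exact key _ (hrot _ (hrot _ hx)) hv h
  have hconn : G.Preconnected := by
    have h := (hF.threeConnected ∅ (by simp)).preconnected
    rw [Set.compl_empty] at h
    exact (SimpleGraph.induceUnivIso G).preconnected_iff.1 h
  have hwalk : ∀ (a b : V) (p : G.Walk a b), (∃ x : FaceFlag faces, x.v = a ∧ S x) →
      ∃ x : FaceFlag faces, x.v = b ∧ S x := by
    intro a b p
    induction p with
    | nil => exact id
    | cons h p ih =>
      rintro ⟨x, rfl, hx⟩
      apply ih
      obtain ⟨f, hf, he⟩ := hF.exists_face h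
      exact ⟨FaceFlag.mu ⟨_, _, f, hf, he⟩, rfl, hmu _ (hvert x _ hx rfl)⟩
  obtain ⟨p⟩ := hconn x.v y.v
  obtain ⟨z, hz, hS⟩ := hwalk _ _ p ⟨x, rfl, hx⟩
  exact hvert z y hS hz.symm

theorem sz_eq (x : FaceFlag faces) : x.sz = 5 ∨ x.sz = 6 := hF.face_size _ x.mem

omit hF in
theorem _root_.FaceParam.w_eq {f : Finset (Sym2 V)} {u : ℕ → V} {n : ℕ}
    (hu : FaceParam G f n u) (hn : 3 ≤ n) (hf : IsFullerene G faces)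
    {x : FaceFlag faces} (hx : x.f = f) {i : ℕ} (h0 : x.v = u i) (h1 : x.w = u (i + 1)) :
    (hf.nx x).v = u (i + 1) ∧ (hf.nx x).w = u (i + 2) := by
  refine ⟨h1, ?_⟩
  have : s(x.w, u (i + 2)) ∈ x.f := by rw [hx, hu.mem, h1]; exact ⟨_, rfl⟩
  rcases hf.eq_or_eq_nx x this with h | h
  · rw [h0, hu.inj] at h
    have h2 : (i + 2) % n = (i + 2 - 2) % n := by simpa using h
    exfalso
    have h4 : i + 2 ≡ i + 0 [MOD n] := h
    have h5 := Nat.ModEq.add_left_cancel' i h4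
    have := Nat.le_of_dvd (by norm_num) ((Nat.modEq_zero_iff_dvd).1 h5)
    omega
  · exact h.symm

theorem exists_param (x : FaceFlag faces) : ∃ u, FaceParam G x.f x.sz u ∧
    ∀ k, (hF.nx^[k] x).v = u k ∧ (hF.nx^[k] x).w = u (k + 1) := by
  obtain ⟨u, hu, h0, h1⟩ := hF.exists_faceParam_at x.mem x.edge
  have h3 : 3 ≤ x.f.card := by rcases hF.sz_eq x with h | h <;> (unfold FaceFlag.sz at h; omega)
  have hfk : ∀ k, (hF.nx^[k] x).f = x.f := by
    intro k
    induction k with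
    | zero => rfl
    | succ k ih => rw [Function.iterate_succ_apply', nx_f, ih]
  refine ⟨u, hu, fun k => ?_⟩
  induction k with
  | zero => exact ⟨h0.symm, h1.symm⟩
  | succ k ih =>
    rw [Function.iterate_succ_apply']
    exact hu.w_eq h3 hF (hfk k) ih.1 ih.2

@[simp] theorem nx_iterate_f (x : FaceFlag faces) (k : ℕ) : (hF.nx^[k] x).f = x.f := by
  induction k with
  | zero => rfl
  | succ k ih => rw [Function.iterate_succ_apply', nx_f, ih]

theorem nx_iterate_eq_iff (x : FaceFlag faces) (i j : ℕ) :
    hF.nx^[i] x = hF.nx^[j] x ↔ i % x.sz = j % x.sz := by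
  obtain ⟨u, hu, h⟩ := hF.exists_param x
  rw [← hu.inj]
  constructor
  · intro e; rw [← (h i).1, e, (h j).1]
  · intro e
    refine FaceFlag.ext ?_ ?_ ?_
    · rw [(h i).1, e, (h j).1]
    · rw [(h i).2, (h j).2, hu.inj]
      rw [hu.inj] at e
      exact Nat.ModEq.add_right 1 e
    · simp

theorem exists_iterate_of_f_eq {x y : FaceFlag faces} (h : y.f = x.f) :
    ∃ k, k < x.sz ∧ (y = hF.nx^[k] x ∨ y = (hF.nx^[k] x).mu) := by
  obtain ⟨u, hu, hk⟩ := hF.exists_param x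
  have he := y.edge
  rw [h] at he
  obtain ⟨i, hi⟩ := (hu.mem _).1 he
  have hpos : 0 < x.sz := by rcases hF.sz_eq x with h | h <;> omega
  have e : hF.nx^[i % x.sz] x = hF.nx^[i] x := by
    rw [nx_iterate_eq_iff]; simp
  refine ⟨i % x.sz, Nat.mod_lt _ hpos, ?_⟩
  rw [e]
  rw [Sym2.eq_iff] at hi
  rcases hi with ⟨h1, h2⟩ | ⟨h1, h2⟩
  · left; exact FaceFlag.ext (by rw [h1, (hk i).1]) (by rw [h2, (hk i).2]) (by simp [h])
  · right
    exact FaceFlag.ext (by rw [h1]; exact (hk i).2.symm) (by rw [h2]; exact (hk i).1.symm)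
      (by rw [h]; exact (hF.nx_iterate_f x i).symm)

theorem ne_mu (x : FaceFlag faces) : x ≠ x.mu := by
  intro h
  exact (hF.adj x).ne (congrArg FaceFlag.v h)

theorem nx_ne_mu (x : FaceFlag faces) : hF.nx x ≠ x.mu := by
  intro h
  exact hF.nx_w_ne x (congrArg FaceFlag.w h)

/-- A flag is not reversed by walking around its face. -/
theorem nx_iterate_ne_mu (x : FaceFlag faces) (k : ℕ) : hF.nx^[k] x ≠ x.mu := by
  induction k using Nat.strong_induction_on generalizing x with
  | _ k ih =>
    intro h
    match k, h with
    | 0, h => exact hF.ne_mu x h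
    | 1, h => exact hF.nx_ne_mu x h
    | k + 2, h =>
      rw [Function.iterate_succ_apply'] at h
      have h2 := congrArg hF.pv h
      rw [pv_nx, pv_mu, Function.iterate_succ_apply] at h2
      exact ih k (by omega) (hF.nx x) h2

end IsFullerene

end FlagOps

section CutSpace

variable {V : Type*} [Fintype V] [DecidableEq V] {G : SimpleGraph V}
  {faces : Finset (Finset (Sym2 V))}

theorem FaceParam.sum_eq {f : Finset (Sym2 V)} {n : ℕ} {u : ℕ → V} (hu : FaceParam G f n u)
    (hn : n = 5 ∨ n = 6) {M : Type*} [AddCommMonoid M] (g : Sym2 V → M) :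
    ∑ e ∈ f, g e = ∑ i ∈ Finset.range n, g s(u i, u (i + 1)) := by
  have hf : f = (Finset.range n).image fun i => s(u i, u (i + 1)) := by
    ext e
    rw [hu.mem, Finset.mem_image]
    constructor
    · rintro ⟨i, rfl⟩
      refine ⟨i % n, by rw [Finset.mem_range]; rcases hn with rfl | rfl <;> omega, ?_⟩
      have e1 : u (i % n) = u i := by rw [hu.inj]; simp
      have e2 : u (i % n + 1) = u (i + 1) := by rw [hu.inj]; simp
      rw [e1, e2]
    · rintro ⟨i, -, rfl⟩; exact ⟨i, rfl⟩
  conv_lhs => rw [hf]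
  rw [Finset.sum_image]
  intro i hi j hj h
  rw [Finset.mem_coe, Finset.mem_range] at hi hj
  simp only [Sym2.eq_iff, hu.inj] at h
  rcases hn with rfl | rfl <;> omega

/-- The sum of a vertex function over the two ends of an edge. -/
def edgeSum (y : V → ZMod 2) (e : Sym2 V) : ZMod 2 :=
  Sym2.lift ⟨fun a b => y a + y b, fun a b => add_comm _ _⟩ e

omit [Fintype V] [DecidableEq V] in
@[simp] theorem edgeSum_mk (y : V → ZMod 2) (a b : V) : edgeSum y s(a, b) = y a + y b := rfl

theorem ZMod.two_add_self (a : ZMod 2) : a + a = 0 := CharTwo.add_self_eq_zero a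

namespace IsFullerene

variable (hF : IsFullerene G faces)
include hF

theorem sum_edgeSum (y : V → ZMod 2) {f : Finset (Sym2 V)} (hf : f ∈ faces) :
    ∑ e ∈ f, edgeSum y e = 0 := by
  obtain ⟨u, hu⟩ := hF.exists_faceParam hf
  have h56 := hF.face_size f hf
  rw [hu.sum_eq h56]
  simp only [edgeSum_mk]
  have hn : u f.card = u 0 := by rw [hu.inj]; simp
  have h := Finset.sum_range_succ' (fun i => y (u i)) f.card
  rw [Finset.sum_range_succ, hn] at h
  rw [Finset.sum_add_distrib, add_right_cancel h, ZMod.two_add_self]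

theorem preconnected : G.Preconnected := by
  have h := (hF.threeConnected ∅ (by simp)).preconnected
  rw [Set.compl_empty] at h
  exact (SimpleGraph.induceUnivIso G).preconnected_iff.1 h

theorem const_of_gl_f {α : Type*} (z : Finset (Sym2 V) → α)
    (h : ∀ x : FaceFlag faces, z (hF.gl x).f = z x.f) (x y : FaceFlag faces) :
    z x.f = z y.f := by
  refine hF.flag_induction (S := fun t => z t.f = z y.f) ?_ ?_ ?_ (x := y) rfl x
  · exact fun t ht => ht
  · exact fun t ht => (h t).trans ht
  · exact fun t ht => ht

omit hF in
theorem card_edges (G : SimpleGraph V) [Fintype G.edgeSet] :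
    G.edgeSet.ncard = Fintype.card G.edgeSet := by
  rw [← Nat.card_coe_set_eq, Nat.card_eq_fintype_card]

theorem sum_face_edges {f : Finset (Sym2 V)} (hf : f ∈ faces) [Fintype G.edgeSet]
    (g : Sym2 V → ZMod 2) :
    ∑ e : G.edgeSet, (if (e : Sym2 V) ∈ f then (1 : ZMod 2) else 0) * g e = ∑ e ∈ f, g e := by
  classical
  have h1 : ∑ e : G.edgeSet, (if (e : Sym2 V) ∈ f then (1 : ZMod 2) else 0) * g e =
      ∑ e ∈ Finset.univ.filter (fun e : G.edgeSet => (e : Sym2 V) ∈ f), g e := by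
    rw [Finset.sum_filter]
    refine Finset.sum_congr rfl fun e _ => ?_
    split_ifs <;> simp
  rw [h1]
  refine Finset.sum_bij (fun e _ => (e : Sym2 V)) ?_ ?_ ?_ ?_
  · intro e he; simpa using he
  · intro a _ b _ h; exact Subtype.ext h
  · intro e he
    have : e ∈ G.edgeSet := by
      induction e with | _ v w => exact hF.adj_of_mem hf he
    exact ⟨⟨e, this⟩, by simpa using he, rfl⟩
  · intros; rfl

/-- Every edge set meeting all faces evenly is a cut. -/
theorem exists_cut (g : Sym2 V → ZMod 2) (hg : ∀ f ∈ faces, ∑ e ∈ f, g e = 0) :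
    ∃ y : V → ZMod 2, ∀ v w, G.Adj v w → g s(v, w) = y v + y w := by
  classical
  let N : Matrix faces G.edgeSet (ZMod 2) := fun f e => if (e : Sym2 V) ∈ f.1 then 1 else 0
  let D : (V → ZMod 2) →ₗ[ZMod 2] (G.edgeSet → ZMod 2) :=
    { toFun := fun y e => edgeSum y e
      map_add' := by
        intro y z; ext ⟨e, he⟩
        induction e with | _ a b => simp [add_add_add_comm]
      map_smul' := by
        intro c y; ext ⟨e, he⟩
        induction e with | _ a b => simp [mul_add] }
  have hND : LinearMap.range D ≤ LinearMap.ker N.mulVecLin := by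
    rintro _ ⟨y, rfl⟩
    rw [LinearMap.mem_ker]
    ext ⟨f, hf⟩
    exact (hF.sum_face_edges hf (edgeSum y)).trans (hF.sum_edgeSum y hf)
  have hker1 : ∀ {W : Type _} [Fintype W] (K : Submodule (ZMod 2) (W → ZMod 2)),
      (∀ z ∈ K, ∀ a b, z a = z b) → Module.finrank (ZMod 2) K ≤ 1 := by
    intro W _ K hK
    rcases isEmpty_or_nonempty W with hW | ⟨⟨w⟩⟩
    · haveI : Subsingleton K := inferInstance
      rw [Module.finrank_zero_of_subsingleton]; norm_num
    · have : Function.Injective ((LinearMap.proj w : (W → ZMod 2) →ₗ[ZMod 2] ZMod 2) ∘ₗ K.subtype) := by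
        rintro ⟨a, ha⟩ ⟨b, hb⟩ h
        ext t
        have h' : a w = b w := h
        change a t = b t
        rw [hK a ha t w, hK b hb t w, h']
      simpa using LinearMap.finrank_le_finrank_of_injective this
  have hkerD : Module.finrank (ZMod 2) (LinearMap.ker D) ≤ 1 := by
    apply hker1
    intro z hz a b
    have hadj : ∀ v w, G.Adj v w → z v = z w := by
      intro v w h
      have := congrFun (LinearMap.mem_ker.1 hz) ⟨s(v, w), h⟩
      exact (CharTwo.add_eq_zero).1 this
    obtain ⟨p⟩ := hF.preconnected a b
    induction p with
    | nil => rfl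
    | cons h p ih => exact (hadj _ _ h).trans ih
  have hkerT : Module.finrank (ZMod 2) (LinearMap.ker N.transpose.mulVecLin) ≤ 1 := by
    apply hker1
    rintro z hz ⟨a, ha⟩ ⟨b, hb⟩
    let z' : Finset (Sym2 V) → ZMod 2 := fun f => if h : f ∈ faces then z ⟨f, h⟩ else 0
    have hz' : ∀ x : FaceFlag faces, z' (hF.gl x).f = z' x.f := by
      intro x
      have h1 := congrFun (LinearMap.mem_ker.1 hz) ⟨s(x.v, x.w), hF.adj x⟩
      have h2 : ∑ f : faces, (if s(x.v, x.w) ∈ f.1 then (1 : ZMod 2) else 0) * z f = 0 := h1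
      have h3 : ∑ f : faces, (if s(x.v, x.w) ∈ f.1 then (1 : ZMod 2) else 0) * z f =
          ∑ f ∈ faces, (if s(x.v, x.w) ∈ f then z' f else 0) := by
        rw [← Finset.sum_coe_sort faces]
        refine Finset.sum_congr rfl fun f _ => ?_
        simp only [z', f.2, dif_pos]
        split_ifs <;> simp
      have h4 : faces.filter (fun f => s(x.v, x.w) ∈ f) = {(hF.gl x).f, x.f} := by
        ext f
        simp only [Finset.mem_filter, Finset.mem_insert, Finset.mem_singleton]
        constructor
        · rintro ⟨h, h'⟩; exact (hF.eq_or_eq_gl x h h').symm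
        · rintro (rfl | rfl)
          · refine ⟨(hF.gl x).mem, ?_⟩
            have := (hF.gl x).edge
            rw [Sym2.eq_swap] at this
            exact this
          · exact ⟨x.mem, x.edge⟩
      rw [h3, ← Finset.sum_filter, h4, Finset.sum_pair (hF.gl_f_ne x)] at h2
      exact (CharTwo.add_eq_zero).1 h2
    obtain ⟨u, hu⟩ := hF.exists_faceParam ha
    obtain ⟨u', hu'⟩ := hF.exists_faceParam hb
    have := hF.const_of_gl_f z' hz' ⟨u 0, u 1, a, ha, (hu.mem _).2 ⟨0, rfl⟩⟩
      ⟨u' 0, u' 1, b, hb, (hu'.mem _).2 ⟨0, rfl⟩⟩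
    simpa [z', ha, hb] using this
  have e1 := LinearMap.finrank_range_add_finrank_ker D
  have e2 := LinearMap.finrank_range_add_finrank_ker N.transpose.mulVecLin
  have e3 := LinearMap.finrank_range_add_finrank_ker N.mulVecLin
  have e4 : N.transpose.rank = N.rank := Matrix.rank_transpose N
  rw [Matrix.rank, Matrix.rank] at e4
  rw [Module.finrank_fintype_fun_eq_card] at e1 e2 e3
  rw [Fintype.card_coe] at e2
  have e5 := hF.euler
  rw [card_edges] at e5
  have heq := Submodule.eq_of_le_of_finrank_le hND (by omega)
  have hmem : (fun e : G.edgeSet => g e) ∈ LinearMap.ker N.mulVecLin := by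
    rw [LinearMap.mem_ker]
    ext ⟨f, hf⟩
    exact (hF.sum_face_edges hf g).trans (hg f hf)
  rw [← heq] at hmem
  obtain ⟨y, hy⟩ := hmem
  exact ⟨y, fun v w h => (congrFun hy ⟨s(v, w), h⟩).symm⟩

end IsFullerene

end CutSpace

section Cuts

variable {V : Type*} [Fintype V] [DecidableEq V] {G : SimpleGraph V}
  {faces : Finset (Finset (Sym2 V))}

open Classical in
/-- The edges leaving `A`, directed outwards. -/
noncomputable def cutEdges (G : SimpleGraph V) (A : Finset V) : Finset (V × V) :=
  (A ×ˢ Aᶜ).filter fun p => G.Adj p.1 p.2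

theorem mem_cutEdges {A : Finset V} {p : V × V} :
    p ∈ cutEdges G A ↔ p.1 ∈ A ∧ p.2 ∉ A ∧ G.Adj p.1 p.2 := by
  simp [cutEdges, and_assoc]

open Classical in
theorem card_cutEdges (A : Finset V) :
    (cutEdges G A).card = ∑ a ∈ A, (Aᶜ.filter fun b => G.Adj a b).card := by
  simp only [cutEdges, Finset.card_filter, Finset.sum_product]

open Classical in
theorem card_cutEdges' (A : Finset V) :
    (cutEdges G A).card = ∑ b ∈ Aᶜ, (A.filter fun a => G.Adj a b).card := by
  simp only [cutEdges, Finset.card_filter, Finset.sum_product_right]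

theorem cutEdges_mk_inj {A : Finset V} {p q : V × V} (hp : p ∈ cutEdges G A)
    (hq : q ∈ cutEdges G A) (h : s(p.1, p.2) = s(q.1, q.2)) : p = q := by
  rw [mem_cutEdges] at hp hq
  rw [Sym2.eq_iff] at h
  rcases h with ⟨h1, h2⟩ | ⟨h1, h2⟩
  · exact Prod.ext h1 h2
  · exact absurd hp.1 (h1 ▸ hq.2.1)

theorem card_cutEdges_compl (A : Finset V) :
    (cutEdges G Aᶜ).card = (cutEdges G A).card := by
  refine Finset.card_bij (fun p _ => p.swap) ?_ ?_ ?_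
  · intro p hp
    rw [mem_cutEdges] at hp ⊢
    simp only [Finset.mem_compl, not_not] at hp
    exact ⟨hp.2.1, hp.1, hp.2.2.symm⟩
  · intro a _ b _ h; exact Prod.swap_injective h
  · intro p hp
    rw [mem_cutEdges] at hp
    refine ⟨p.swap, ?_, by simp⟩
    rw [mem_cutEdges]
    simp only [Finset.mem_compl, not_not]
    exact ⟨hp.2.1, hp.1, hp.2.2.symm⟩

/-- The cut edges on a face. -/
noncomputable def cutOn (G : SimpleGraph V) (A : Finset V) (f : Finset (Sym2 V)) :
    Finset (V × V) :=
  (cutEdges G A).filter fun p => s(p.1, p.2) ∈ f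

theorem mem_cutOn {A : Finset V} {f : Finset (Sym2 V)} {p : V × V} :
    p ∈ cutOn G A f ↔ (p.1 ∈ A ∧ p.2 ∉ A ∧ G.Adj p.1 p.2) ∧ s(p.1, p.2) ∈ f := by
  rw [cutOn, Finset.mem_filter, mem_cutEdges]

theorem card_cutOn_compl (A : Finset V) (f : Finset (Sym2 V)) :
    (cutOn G Aᶜ f).card = (cutOn G A f).card := by
  refine Finset.card_bij (fun p _ => p.swap) ?_ ?_ ?_
  · intro p hp
    rw [mem_cutOn] at hp ⊢
    simp only [Finset.mem_compl, not_not] at hp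
    exact ⟨⟨hp.1.2.1, hp.1.1, hp.1.2.2.symm⟩, by simpa [Sym2.eq_swap] using hp.2⟩
  · intro a _ b _ h; exact Prod.swap_injective h
  · intro p hp
    rw [mem_cutOn] at hp
    refine ⟨p.swap, ?_, by simp⟩
    rw [mem_cutOn]
    simp only [Finset.mem_compl, not_not]
    exact ⟨⟨hp.1.2.1, hp.1.1, hp.1.2.2.symm⟩, by simpa [Sym2.eq_swap] using hp.2⟩

namespace IsFullerene

variable (hF : IsFullerene G faces)
include hF

open Classical in
theorem card_adj (v : V) : (Finset.univ.filter fun b => G.Adj v b).card = 3 := by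
  rw [← hF.cubic v, Set.ncard_eq_toFinset_card']
  congr 1
  ext b
  simp

theorem three_le_card_cutEdges {A : Finset V} (h0 : A.Nonempty) (h1 : A ≠ Finset.univ) :
    3 ≤ (cutEdges G A).card := by
  classical
  by_contra hlt
  have hlt : (cutEdges G A).card ≤ 2 := by omega
  obtain ⟨b, hb⟩ : ∃ b, b ∉ A := by
    by_contra h; push Not at h; exact h1 (Finset.eq_univ_iff_forall.2 h)
  set s := (cutEdges G A).image Prod.fst with hs
  have hs2 : s.card ≤ 2 := Finset.card_image_le.trans hlt
  have hsA : s ⊆ A := by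
    intro a ha
    obtain ⟨p, hp, rfl⟩ := Finset.mem_image.1 ha
    exact (mem_cutEdges.1 hp).1
  by_cases hAs : A = s
  · have hA : A.card ≤ 2 := hAs ▸ hs2
    have h3 : ∀ a ∈ A, 3 ≤ (Aᶜ.filter fun b => G.Adj a b).card + (A.card - 1) := by
      intro a ha
      have e1 := hF.card_adj a
      have e2 : (Finset.univ.filter fun b => G.Adj a b) ⊆
          (Aᶜ.filter fun b => G.Adj a b) ∪ A.erase a := by
        intro t ht
        have ht := (Finset.mem_filter.1 ht).2
        by_cases htA : t ∈ A
        · exact Finset.mem_union_right _ (Finset.mem_erase.2 ⟨ht.ne', htA⟩)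
        · exact Finset.mem_union_left _ (by simp [htA, ht])
      have e3 := (Finset.card_le_card e2).trans (Finset.card_union_le _ _)
      rw [Finset.card_erase_of_mem ha] at e3
      omega
    have h4 := card_cutEdges (G := G) A
    have h5 : ∑ a ∈ A, (3 - (A.card - 1)) ≤ ∑ a ∈ A, (Aᶜ.filter fun b => G.Adj a b).card :=
      Finset.sum_le_sum fun a ha => by have := h3 a ha; omega
    rw [Finset.sum_const, smul_eq_mul] at h5
    have h6 := Finset.card_pos.2 h0
    generalize A.card = n at *
    interval_cases n <;> omega
  · obtain ⟨a, haA, has⟩ : ∃ a ∈ A, a ∉ s := by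
      by_contra h; push Not at h; exact hAs (Finset.Subset.antisymm h hsA)
    have hc := (hF.threeConnected (↑s) (by rw [Set.ncard_coe_finset]; exact hs2)).preconnected
    obtain ⟨p⟩ := hc ⟨a, by simpa using has⟩ ⟨b, by
      simp only [Set.mem_compl_iff, Finset.mem_coe]; exact fun h => hb (hsA h)⟩
    have key : ∀ (x y : ((↑s : Set V)ᶜ : Set V)) (_ : (G.induce (↑s : Set V)ᶜ).Walk x y),
        (x : V) ∈ A → (y : V) ∈ A := by
      intro x y p
      induction p with
      | nil => exact id
      | @cons x t y h p ih =>
        intro hx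
        apply ih
        by_contra ht
        have hxs : (x : V) ∉ s := fun h => x.2 (Finset.mem_coe.2 h)
        apply hxs
        exact Finset.mem_image.2 ⟨(x, t), mem_cutEdges.2 ⟨hx, ht, h⟩, rfl⟩
    exact hb (key _ _ p haA)

/-- A set of edges meeting every face evenly is the edge boundary of a vertex set. -/
theorem exists_cut_of_even (X : Finset (Sym2 V))
    (hX : ∀ f ∈ faces, Even (f.filter (· ∈ X)).card) :
    ∃ A : Finset V, ∀ v w, G.Adj v w → (s(v, w) ∈ X ↔ ¬ (v ∈ A ↔ w ∈ A)) := by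
  classical
  obtain ⟨y, hy⟩ := hF.exists_cut (fun e => if e ∈ X then 1 else 0) (by
    intro f hf
    rw [Finset.sum_boole]
    exact (ZMod.natCast_eq_zero_iff_even).2 (hX f hf))
  refine ⟨Finset.univ.filter (fun v => y v = 0), fun v w h => ?_⟩
  have := hy v w h
  simp only [Finset.mem_filter, Finset.mem_univ, true_and]
  generalize y v = a at *
  generalize y w = b at *
  by_cases hs : s(v, w) ∈ X
  · simp only [hs, if_true, true_iff] at this ⊢
    revert a b; decide
  · simp only [hs, if_false, false_iff] at this ⊢
    revert a b; decide

theorem exists_cut_card (X : Finset (Sym2 V)) (hXG : ∀ e ∈ X, e ∈ G.edgeSet)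
    (hX0 : X.Nonempty) (hX : ∀ f ∈ faces, Even (f.filter (· ∈ X)).card) :
    ∃ A : Finset V, A.Nonempty ∧ Aᶜ.Nonempty ∧ (cutEdges G A).card ≤ X.card ∧
      ∀ v w, s(v, w) ∈ X → ¬ (v ∈ A ↔ w ∈ A) := by
  obtain ⟨A, hA⟩ := hF.exists_cut_of_even X hX
  obtain ⟨e, he⟩ := hX0
  have hA' : ∀ v w, s(v, w) ∈ X → ¬ (v ∈ A ↔ w ∈ A) := fun v w h => (hA v w (hXG _ h)).1 h
  refine ⟨A, ?_, ?_, ?_, hA'⟩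
  · induction e with | _ a b =>
    have := hA' a b he
    by_cases ha : a ∈ A
    · exact ⟨a, ha⟩
    · exact ⟨b, by tauto⟩
  · induction e with | _ a b =>
    have := hA' a b he
    by_cases ha : a ∈ A
    · exact ⟨b, by rw [Finset.mem_compl]; tauto⟩
    · exact ⟨a, by rw [Finset.mem_compl]; tauto⟩
  · refine Finset.card_le_card_of_injOn (fun p => s(p.1, p.2)) ?_ ?_
    · intro p hp
      have hp := mem_cutEdges.1 hp
      exact (hA _ _ hp.2.2).2 (by tauto)
    · intro p hp q hq h
      exact cutEdges_mk_inj hp hq h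

theorem filter_pair_card {f : Finset (Sym2 V)} {a b : Sym2 V} (h : a ∈ f ↔ b ∈ f)
    (hab : a ≠ b) : Even (f.filter (· ∈ ({a, b} : Finset (Sym2 V)))).card := by
  by_cases ha : a ∈ f
  · have hb := h.1 ha
    have : f.filter (· ∈ ({a, b} : Finset (Sym2 V))) = {a, b} := by
      ext e; simp only [Finset.mem_filter, Finset.mem_insert, Finset.mem_singleton]
      constructor
      · exact fun h => h.2
      · rintro (rfl | rfl) <;> simp [*]
    rw [this, Finset.card_pair hab]; exact even_two
  · have hb := fun hb => ha (h.2 hb)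
    have : f.filter (· ∈ ({a, b} : Finset (Sym2 V))) = ∅ := by
      ext e; simp only [Finset.mem_filter, Finset.mem_insert, Finset.mem_singleton]
      constructor
      · rintro ⟨h', rfl | rfl⟩
        · exact absurd h' ha
        · exact absurd h' hb
      · simp
    rw [this]; simp

theorem mem_edgeSet {f : Finset (Sym2 V)} (hf : f ∈ faces) {e : Sym2 V} (he : e ∈ f) :
    e ∈ G.edgeSet := by
  induction e with | _ v w => exact hF.adj_of_mem hf he

theorem eq_of_mem_three {f g h : Finset (Sym2 V)} (hf : f ∈ faces) (hg : g ∈ faces)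
    (hfg : f ≠ g) {e : Sym2 V} (h1 : e ∈ f) (h2 : e ∈ g) (hh : h ∈ faces) (h3 : e ∈ h) :
    h = f ∨ h = g := by
  obtain ⟨k, -, -, -, hk⟩ := hF.exists_otherFace hf h1
  rcases hk g hg h2 with h | h
  · exact absurd h.symm hfg
  · rw [h]; exact hk _ hh h3

/-- Two distinct faces share at most one edge. -/
theorem edge_unique {f g : Finset (Sym2 V)} (hf : f ∈ faces) (hg : g ∈ faces) (hfg : f ≠ g)
    {e e' : Sym2 V} (h1 : e ∈ f) (h2 : e ∈ g) (h3 : e' ∈ f) (h4 : e' ∈ g) : e = e' := by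
  by_contra hne
  obtain ⟨A, hA, hA', hc, -⟩ := hF.exists_cut_card {e, e'} (by
      intro x hx
      simp only [Finset.mem_insert, Finset.mem_singleton] at hx
      rcases hx with rfl | rfl
      · exact hF.mem_edgeSet hf h1
      · exact hF.mem_edgeSet hf h3) ⟨e, by simp⟩ (by
      intro k hk
      refine hF.filter_pair_card ?_ hne
      constructor
      · intro h
        rcases hF.eq_of_mem_three hf hg hfg h1 h2 hk h with rfl | rfl <;> assumption
      · intro h
        rcases hF.eq_of_mem_three hf hg hfg h3 h4 hk h with rfl | rfl <;> assumption)
  have := hF.three_le_card_cutEdges hA (by rintro rfl; simp at hA')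
  rw [Finset.card_pair hne] at hc
  omega

end IsFullerene
end Cuts

section ThreeCuts

variable {V : Type*} [Fintype V] [DecidableEq V] {G : SimpleGraph V}
  {faces : Finset (Finset (Sym2 V))}

open Classical in
/-- The vertices of a face, as a finset. -/
noncomputable def faceFinset (f : Finset (Sym2 V)) : Finset V :=
  Finset.univ.filter fun v => ∃ w, s(v, w) ∈ f

theorem mem_faceFinset {f : Finset (Sym2 V)} {v : V} :
    v ∈ faceFinset f ↔ ∃ w, s(v, w) ∈ f := by
  simp [faceFinset]

namespace IsFullerene

variable (hF : IsFullerene G faces)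
include hF

theorem card_faceFinset {f : Finset (Sym2 V)} (hf : f ∈ faces) :
    (faceFinset f).card = f.card := by
  obtain ⟨u, hu⟩ := hF.exists_faceParam hf
  have h56 := hF.face_size f hf
  have h : faceFinset f = (Finset.range f.card).image u := by
    ext v
    rw [mem_faceFinset, Finset.mem_image]
    constructor
    · rintro ⟨w, hw⟩
      obtain ⟨i, hi⟩ := (hu.mem _).1 hw
      have key : ∀ j, u (j % f.card) = u j := by intro j; rw [hu.inj]; simp
      have hlt : ∀ j, j % f.card < f.card := fun j => Nat.mod_lt _ (by omega)
      rw [Sym2.eq_iff] at hi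
      rcases hi with ⟨rfl, -⟩ | ⟨rfl, -⟩
      · exact ⟨i % f.card, by simpa using hlt i, key _⟩
      · exact ⟨(i + 1) % f.card, by simpa using hlt (i + 1), key _⟩
    · rintro ⟨i, -, rfl⟩
      exact ⟨u (i + 1), (hu.mem _).2 ⟨i, rfl⟩⟩
  rw [h, Finset.card_image_of_injOn, Finset.card_range]
  intro i hi j hj hij
  rw [Finset.mem_coe, Finset.mem_range] at hi hj
  have hij : u i = u j := hij
  rwa [hu.inj, Nat.mod_eq_of_lt hi, Nat.mod_eq_of_lt hj] at hij

theorem exists_flag_at (v : V) : ∃ x : FaceFlag faces, x.v = v := by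
  have h := hF.cubic v
  obtain ⟨w, hw⟩ : (G.neighborSet v).Nonempty := by
    rw [← Set.ncard_pos (Set.toFinite _)]; omega
  obtain ⟨f, hf, he⟩ := hF.exists_face hw
  exact ⟨⟨v, w, f, hf, he⟩, rfl⟩

/-- A face at `v` contains two of the three edges at `v`. -/
theorem mem_of_mem_of_notMem {f : Finset (Sym2 V)} (hf : f ∈ faces) {v x p r : V}
    (hx : s(v, x) ∈ f) (hp : G.Adj v p) (hpf : s(v, p) ∉ f) (hr : G.Adj v r) (hrp : r ≠ p) :
    s(v, r) ∈ f := by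
  obtain ⟨t, ht, htf, -⟩ := hF.exists_other hf hx
  obtain ⟨q, hq, -, -, hall⟩ := hF.exists_third (hF.adj_of_mem hf hx) (hF.adj_of_mem hf htf) ht.symm
  rcases hall p hp with rfl | rfl | rfl
  · exact absurd hx hpf
  · exact absurd htf hpf
  · rcases hall r hr with rfl | rfl | rfl
    · exact hx
    · exact htf
    · exact absurd rfl hrp

open Classical in
theorem card_faces_at (v : V) : (faces.filter fun f => v ∈ faceFinset f).card = 3 := by
  obtain ⟨x, rfl⟩ := hF.exists_flag_at v
  have h : (faces.filter fun f => x.v ∈ faceFinset f) =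
      {x.f, (hF.rot x).f, (hF.rot (hF.rot x)).f} := by
    ext f
    simp only [Finset.mem_filter, mem_faceFinset, Finset.mem_insert, Finset.mem_singleton]
    constructor
    · rintro ⟨hf, w, hw⟩
      obtain ⟨t, ht, htf, -⟩ := hF.exists_other hf hw
      have a1 := hF.eq_of_adj x (hF.adj_of_mem hf hw)
      have a2 := hF.eq_of_adj x (hF.adj_of_mem hf htf)
      have f1 : ∀ y : FaceFlag faces, y.v = x.v → s(x.v, y.w) ∈ f → s(x.v, (hF.rot y).w) ∈ f →
          f = y.f := by
        intro y hy h1 h2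
        refine hF.face_unique hf y.mem (hF.rot_w_ne y) h2 h1 ?_ ?_
        · rw [← hy]; exact hF.rot_edge y
        · rw [← hy]; exact y.edge
      have g1 := f1 x rfl
      have g2 := f1 (hF.rot x) rfl
      have g3 := f1 (hF.rot (hF.rot x)) rfl
      rw [hF.rot_rot_rot] at g3
      rcases a1 with rfl | rfl | rfl <;> rcases a2 with rfl | rfl | rfl <;>
        first | exact absurd rfl ht | tauto
    · rintro (rfl | rfl | rfl)
      · exact ⟨x.mem, _, x.edge⟩
      · exact ⟨(hF.rot x).mem, _, (hF.rot x).edge⟩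
      · exact ⟨(hF.rot (hF.rot x)).mem, _, (hF.rot (hF.rot x)).edge⟩
  have h1 := hF.rot_f_ne x
  have h2 := hF.rot_f_ne (hF.rot x)
  have h3 := hF.rot_f_ne (hF.rot (hF.rot x))
  rw [hF.rot_rot_rot] at h3
  rw [h, Finset.card_eq_three]
  exact ⟨_, _, _, h1.symm, h3, h2.symm, rfl⟩

theorem sum_card_inter (A : Finset V) :
    ∑ f ∈ faces, (A ∩ faceFinset f).card = 3 * A.card := by
  classical
  have h : ∀ f ∈ faces, (A ∩ faceFinset f).card = ∑ v ∈ A, if v ∈ faceFinset f then 1 else 0 := by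
    intro f _
    rw [← Finset.card_filter, Finset.filter_mem_eq_inter]
  rw [Finset.sum_congr rfl h, Finset.sum_comm]
  simp only [← Finset.card_filter]
  rw [Finset.sum_congr rfl fun v _ => hF.card_faces_at v, Finset.sum_const, smul_eq_mul, mul_comm]

theorem sum_card_cutOn (A : Finset V) :
    ∑ f ∈ faces, (cutOn G A f).card = 2 * (cutEdges G A).card := by
  classical
  simp only [cutOn, Finset.card_filter]
  rw [Finset.sum_comm]
  simp only [← Finset.card_filter]
  rw [Finset.sum_congr rfl fun p hp => hF.edge_two_faces _ (mem_cutEdges.1 hp).2.2,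
    Finset.sum_const, smul_eq_mul, mul_comm]

theorem even_card_cutOn (A : Finset V) {f : Finset (Sym2 V)} (hf : f ∈ faces) :
    Even (cutOn G A f).card := by
  classical
  have h := hF.sum_edgeSum (fun v => if v ∈ A then 1 else 0) hf
  have h2 : ∀ e ∈ f, edgeSum (fun v => if v ∈ A then 1 else 0) e =
      if e ∈ (cutOn G A f).image (fun p => s(p.1, p.2)) then 1 else 0 := by
    intro e he
    have hG := hF.mem_edgeSet hf he
    induction e with | _ a b =>
    have hG : G.Adj a b := hG
    have : s(a, b) ∈ (cutOn G A f).image (fun p => s(p.1, p.2)) ↔ ¬ (a ∈ A ↔ b ∈ A) := by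
      rw [Finset.mem_image]
      constructor
      · rintro ⟨p, hp, hpe⟩
        have hp := (mem_cutOn.1 hp).1
        rw [Sym2.eq_iff] at hpe
        rcases hpe with ⟨h1, h2⟩ | ⟨h1, h2⟩ <;> rw [h1, h2] at hp <;> tauto
      · intro h
        by_cases ha : a ∈ A
        · exact ⟨(a, b), mem_cutOn.2 ⟨⟨ha, by tauto, hG⟩, he⟩, rfl⟩
        · exact ⟨(b, a), mem_cutOn.2 ⟨⟨by tauto, ha, hG.symm⟩, by rwa [Sym2.eq_swap]⟩,
            Sym2.eq_swap⟩
    simp only [this, edgeSum_mk]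
    by_cases ha : a ∈ A <;> by_cases hb : b ∈ A <;> simp [ha, hb]
    decide
  rw [Finset.sum_congr rfl h2, Finset.sum_boole] at h
  rw [ZMod.natCast_eq_zero_iff_even] at h
  have h3 : f.filter (· ∈ (cutOn G A f).image (fun p => s(p.1, p.2))) =
      (cutOn G A f).image (fun p => s(p.1, p.2)) := by
    ext e
    rw [Finset.mem_filter, and_iff_right_iff_imp, Finset.mem_image]
    rintro ⟨p, hp, rfl⟩
    exact (mem_cutOn.1 hp).2
  rw [h3, Finset.card_image_of_injOn] at h
  · exact h
  · intro p hp q hq hpq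
    exact cutEdges_mk_inj (Finset.mem_filter.1 hp).1 (Finset.mem_filter.1 hq).1 hpq

theorem subset_or_disjoint (A : Finset V) {f : Finset (Sym2 V)} (hf : f ∈ faces)
    (h : cutOn G A f = ∅) : faceFinset f ⊆ A ∨ A ∩ faceFinset f = ∅ := by
  have hstep : ∀ a b, s(a, b) ∈ f → (a ∈ A ↔ b ∈ A) := by
    have hh : ∀ a b, s(a, b) ∈ f → a ∈ A → b ∈ A := by
      intro a b he ha
      by_contra hb
      have : (a, b) ∈ cutOn G A f := mem_cutOn.2 ⟨⟨ha, hb, hF.adj_of_mem hf he⟩, he⟩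
      rw [h] at this
      simp at this
    exact fun a b he => ⟨hh a b he, hh b a (by rwa [Sym2.eq_swap])⟩
  obtain ⟨u, hu⟩ := hF.exists_faceParam hf
  have hall : ∀ i, u i ∈ A ↔ u 0 ∈ A := by
    intro i
    induction i with
    | zero => rfl
    | succ i ih => rw [← ih]; exact (hstep _ _ ((hu.mem _).2 ⟨i, rfl⟩)).symm
  have hv : ∀ v ∈ faceFinset f, v ∈ A ↔ u 0 ∈ A := by
    intro v hv
    obtain ⟨w, hw⟩ := mem_faceFinset.1 hv
    obtain ⟨i, hi⟩ := (hu.mem _).1 hw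
    rw [Sym2.eq_iff] at hi
    rcases hi with ⟨rfl, -⟩ | ⟨rfl, -⟩ <;> exact hall _
  by_cases h0 : u 0 ∈ A
  · exact Or.inl fun v h => (hv v h).2 h0
  · right
    ext v
    simp only [Finset.mem_inter, Finset.notMem_empty, iff_false, not_and]
    exact fun h1 h2 => h0 ((hv v h2).1 h1)

section Side

variable {A : Finset V} (hA : 2 ≤ A.card) (hc : (cutEdges G A).card = 3)
include hA hc

theorem cut_fst_inj {p q : V × V} (hp : p ∈ cutEdges G A) (hq : q ∈ cutEdges G A)
    (h : p.1 = q.1) : p = q := by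
  classical
  by_contra hpq
  have hp' := mem_cutEdges.1 hp
  have hq' := mem_cutEdges.1 hq
  have h2 : p.2 ≠ q.2 := fun h' => hpq (Prod.ext h h')
  have hsub : cutEdges G (A.erase p.1) ⊆ (cutEdges G A \ {p, q}) ∪
      ((Finset.univ.filter fun b => G.Adj p.1 b) \ {p.2, q.2}).image (fun y => (y, p.1)) := by
    rintro ⟨y, b⟩ hyb
    rw [mem_cutEdges] at hyb
    simp only [Finset.mem_erase, not_and_or, not_not] at hyb
    obtain ⟨⟨hy1, hy2⟩, hb, hadj⟩ := hyb
    rw [Finset.mem_union]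
    by_cases hbA : b ∈ A
    · right
      have hb : b = p.1 := hb.resolve_right (by simpa using hbA)
      subst hb
      rw [Finset.mem_image]
      refine ⟨y, ?_, rfl⟩
      simp only [Finset.mem_sdiff, Finset.mem_filter, Finset.mem_univ, true_and,
        Finset.mem_insert, Finset.mem_singleton, not_or]
      exact ⟨hadj.symm, fun e => hp'.2.1 (e ▸ hy2), fun e => hq'.2.1 (e ▸ hy2)⟩
    · left
      simp only [Finset.mem_sdiff, Finset.mem_insert, Finset.mem_singleton, not_or, mem_cutEdges]
      exact ⟨⟨hy2, hbA, hadj⟩, fun e => hy1 (by rw [← e]), fun e => hy1 (by rw [h, ← e])⟩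
  have h3 := (Finset.card_le_card hsub).trans (Finset.card_union_le _ _)
  have h4 : (cutEdges G A \ {p, q}).card = 1 := by
    rw [Finset.card_sdiff_of_subset (by intro t; simp; rintro (rfl | rfl) <;> assumption), hc,
      Finset.card_pair hpq]
  have h5 : ((Finset.univ.filter fun b => G.Adj p.1 b) \ {p.2, q.2}).card = 1 := by
    rw [Finset.card_sdiff_of_subset, hF.card_adj, Finset.card_pair h2]
    intro t
    simp only [Finset.mem_insert, Finset.mem_singleton, Finset.mem_filter, Finset.mem_univ,
      true_and]
    rintro (rfl | rfl)
    · exact hp'.2.2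
    · rw [h]; exact hq'.2.2
  have h6 := Finset.card_image_le (s := (Finset.univ.filter fun b => G.Adj p.1 b) \ {p.2, q.2})
    (f := fun y => (y, p.1))
  have h7 := hF.three_le_card_cutEdges (A := A.erase p.1)
    (by rw [← Finset.card_pos, Finset.card_erase_of_mem hp'.1]; omega)
    (by
      intro e
      have := Finset.mem_univ p.1
      rw [← e] at this
      simp at this)
  omega

omit hA in
theorem card_cutOn {f : Finset (Sym2 V)} (hf : f ∈ faces) (hr : cutOn G A f ≠ ∅) :
    (cutOn G A f).card = 2 := by
  have h1 := hF.even_card_cutOn A hf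
  have h2 : (cutOn G A f).card ≤ 3 := hc ▸ Finset.card_filter_le _ _
  have h3 := Finset.card_pos.2 (Finset.nonempty_iff_ne_empty.2 hr)
  obtain ⟨k, hk⟩ := h1
  omega

omit hA in
theorem card_ring : (faces.filter fun f => cutOn G A f ≠ ∅).card = 3 := by
  have h := hF.sum_card_cutOn A
  rw [hc, ← Finset.sum_filter_add_sum_filter_not faces (fun f => cutOn G A f ≠ ∅)] at h
  rw [Finset.sum_congr rfl (fun f hf => hF.card_cutOn hc (Finset.mem_filter.1 hf).1
      (Finset.mem_filter.1 hf).2),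
    Finset.sum_congr (s₁ := faces.filter fun f => ¬ cutOn G A f ≠ ∅) rfl (g := fun _ => 0)
      (fun f hf => by
        have := (Finset.mem_filter.1 hf).2
        rw [not_not] at this
        rw [this]; rfl)] at h
  simp only [Finset.sum_const, smul_eq_mul] at h
  omega

theorem ring_inter_lt {f : Finset (Sym2 V)} (hf : f ∈ faces) (hr : cutOn G A f ≠ ∅) :
    (A ∩ faceFinset f).card + 1 ≤ A.card := by
  classical
  have h2 := hF.card_cutOn hc hf hr
  obtain ⟨p, hp, hpf⟩ : ∃ p ∈ cutEdges G A, p ∉ cutOn G A f := by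
    by_contra h
    push Not at h
    have := Finset.card_le_card h
    omega
  have hp' := mem_cutEdges.1 hp
  have hpf' : s(p.1, p.2) ∉ f := fun h => hpf (mem_cutOn.2 ⟨hp', h⟩)
  suffices h : p.1 ∉ faceFinset f by
    apply Finset.card_lt_card
    rw [Finset.ssubset_iff_of_subset Finset.inter_subset_left]
    exact ⟨p.1, hp'.1, by simp [h]⟩
  intro hpm
  obtain ⟨x, hx⟩ := mem_faceFinset.1 hpm
  obtain ⟨g, hg, hpg⟩ := hF.exists_face hp'.2.2
  have hfg : f ≠ g := by rintro rfl; exact hpf' hpg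
  have hg2 := hF.card_cutOn hc hg (Finset.ne_empty_of_mem (mem_cutOn.2 ⟨hp', hpg⟩))
  obtain ⟨q, hq⟩ : (cutOn G A f ∩ cutOn G A g).Nonempty := by
    rw [← Finset.card_pos]
    have h1 := Finset.card_union_add_card_inter (cutOn G A f) (cutOn G A g)
    have h3 : (cutOn G A f ∪ cutOn G A g).card ≤ 3 := by
      rw [← hc]
      exact Finset.card_le_card (Finset.union_subset (Finset.filter_subset _ _)
        (Finset.filter_subset _ _))
    omega
  rw [Finset.mem_inter] at hq
  have hqf := mem_cutOn.1 hq.1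
  have hqg := mem_cutOn.1 hq.2
  obtain ⟨r, hr, hrg, -⟩ := hF.exists_other hg hpg
  have hrf := hF.mem_of_mem_of_notMem hf hx hp'.2.2 hpf' (hF.adj_of_mem hg hrg) hr
  have he := hF.edge_unique hf hg hfg hqf.2 hqg.2 hrf hrg
  rw [Sym2.eq_iff] at he
  rcases he with ⟨h1, -⟩ | ⟨-, h1⟩
  · have := hF.cut_fst_inj hA hc (mem_cutEdges.2 hqf.1) hp h1
    rw [this] at hqf
    exact hpf' hqf.2
  · exact hqf.1.2.1 (h1 ▸ hp'.1)

end Side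

end IsFullerene
end ThreeCuts

theorem card_inter_triple {α : Type*} [DecidableEq α] (k : Finset α) {a b c : α} (hab : a ≠ b)
    (hac : a ≠ c) (hbc : b ≠ c) : (k ∩ {a, b, c}).card =
      (if a ∈ k then 1 else 0) + (if b ∈ k then 1 else 0) + (if c ∈ k then 1 else 0) := by
  rw [Finset.inter_comm, ← Finset.filter_mem_eq_inter, Finset.card_filter,
    Finset.sum_insert (by simp [hab, hac]), Finset.sum_insert (by simp [hbc]),
    Finset.sum_singleton, add_assoc]

section ThreeCutsMain

variable {V : Type*} [Fintype V] [DecidableEq V] {G : SimpleGraph V}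
  {faces : Finset (Finset (Sym2 V))}

open Classical in
/-- Vertices of `A` on a face crossing the cut. -/
noncomputable def rim (G : SimpleGraph V) (faces : Finset (Finset (Sym2 V))) (A : Finset V) :
    Finset V :=
  A.filter fun v => ∃ f ∈ faces, cutOn G A f ≠ ∅ ∧ v ∈ faceFinset f

theorem mem_rim {A : Finset V} {v : V} :
    v ∈ rim G faces A ↔ v ∈ A ∧ ∃ f ∈ faces, cutOn G A f ≠ ∅ ∧ v ∈ faceFinset f := by
  simp [rim]

open Classical in
/-- Total number of vertices of `A` on the faces crossing the cut. -/
noncomputable def rimLength (G : SimpleGraph V) (faces : Finset (Finset (Sym2 V)))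
    (A : Finset V) : ℕ :=
  ∑ f ∈ faces.filter (fun f => cutOn G A f ≠ ∅), (A ∩ faceFinset f).card

namespace IsFullerene

variable (hF : IsFullerene G faces)
include hF

theorem cutEdge_mem_rim {A : Finset V} {p : V × V} (hp : p ∈ cutEdges G A) :
    p.1 ∈ rim G faces A := by
  have hp' := mem_cutEdges.1 hp
  obtain ⟨f, hf, hpf⟩ := hF.exists_face hp'.2.2
  exact mem_rim.2 ⟨hp'.1, f, hf, Finset.ne_empty_of_mem (mem_cutOn.2 ⟨hp', hpf⟩),
    mem_faceFinset.2 ⟨_, hpf⟩⟩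

/-- Faces inside `A` account for the vertex-face incidences off the rim. -/
theorem inner_sum (A : Finset V) :
    (rimLength G faces A = 3 * A.card) ∨ ∃ t, 5 ≤ t ∧ t ≤ 6 ∧ t ≤ A.card ∧
      (rimLength G faces A + t = 3 * A.card ∨ rimLength G faces A + t + 5 ≤ 3 * A.card) := by
  classical
  have h := hF.sum_card_inter A
  rw [← Finset.sum_filter_add_sum_filter_not faces (fun f => cutOn G A f ≠ ∅)] at h
  change rimLength G faces A + _ = _ at h
  have hin : ∀ f ∈ faces.filter (fun f => ¬ cutOn G A f ≠ ∅),
      (A ∩ faceFinset f).card = 0 ∨ (5 ≤ (A ∩ faceFinset f).card ∧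
        (A ∩ faceFinset f).card ≤ 6 ∧ (A ∩ faceFinset f).card ≤ A.card) := by
    intro f hf
    rw [Finset.mem_filter, not_not] at hf
    rcases hF.subset_or_disjoint A hf.1 hf.2 with h | h
    · right
      have h1 := Finset.card_le_card h
      rw [Finset.inter_eq_right.2 h]
      have h2 := hF.card_faceFinset hf.1
      have h3 := hF.face_size f hf.1
      omega
    · left; rw [h]; rfl
  generalize faces.filter (fun f => ¬ cutOn G A f ≠ ∅) = s at *
  by_cases h0 : ∀ f ∈ s, (A ∩ faceFinset f).card = 0
  · left
    rw [Finset.sum_eq_zero h0] at h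
    omega
  · right
    push Not at h0
    obtain ⟨f, hf, hf0⟩ := h0
    have h5 := (hin f hf).resolve_left hf0
    refine ⟨_, h5.1, h5.2.1, h5.2.2, ?_⟩
    rw [← Finset.add_sum_erase s _ hf] at h
    by_cases h1 : ∀ g ∈ s.erase f, (A ∩ faceFinset g).card = 0
    · left
      rw [Finset.sum_eq_zero h1] at h
      omega
    · right
      push Not at h1
      obtain ⟨g, hg, hg0⟩ := h1
      have h6 := (hin g (Finset.mem_of_mem_erase hg)).resolve_left hg0
      have h7 := Finset.single_le_sum (f := fun f => (A ∩ faceFinset f).card)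
        (fun _ _ => Nat.zero_le _) hg
      omega

section Side

variable {A : Finset V} (hA : 2 ≤ A.card) (hc : (cutEdges G A).card = 3)
include hA hc

theorem card_cut_fst : ((cutEdges G A).image Prod.fst).card = 3 := by
  rw [Finset.card_image_of_injOn, hc]
  intro p hp q hq h
  exact hF.cut_fst_inj hA hc hp hq h

theorem card_rim_le : (rim G faces A).card + 3 ≤ rimLength G faces A := by
  classical
  set K := (cutEdges G A).image Prod.fst with hK
  have h1 : rimLength G faces A =
      ∑ v ∈ A, ((faces.filter (fun f => cutOn G A f ≠ ∅)).filter (v ∈ faceFinset ·)).card := by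
    simp only [rimLength, Finset.card_filter]
    rw [Finset.sum_comm]
    refine Finset.sum_congr rfl fun f _ => ?_
    rw [← Finset.card_filter, Finset.filter_mem_eq_inter]
  have h2 : (rim G faces A).card + 3 =
      ∑ v ∈ A, ((if v ∈ rim G faces A then 1 else 0) + (if v ∈ K then 1 else 0)) := by
    rw [Finset.sum_add_distrib, ← Finset.card_filter, ← Finset.card_filter,
      Finset.filter_mem_eq_inter, Finset.filter_mem_eq_inter, Finset.inter_eq_right.2,
      Finset.inter_eq_right.2, hF.card_cut_fst hA hc]
    · intro v hv
      obtain ⟨p, hp, rfl⟩ := Finset.mem_image.1 hv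
      exact (mem_cutEdges.1 hp).1
    · intro v hv; exact (mem_rim.1 hv).1
  rw [h1, h2]
  refine Finset.sum_le_sum fun v hv => ?_
  by_cases hvK : v ∈ K
  · obtain ⟨p, hp, rfl⟩ := Finset.mem_image.1 hvK
    have hp' := mem_cutEdges.1 hp
    have : 2 ≤ ((faces.filter (fun f => cutOn G A f ≠ ∅)).filter (p.1 ∈ faceFinset ·)).card := by
      rw [← hF.edge_two_faces s(p.1, p.2) hp'.2.2]
      apply Finset.card_le_card
      intro f hf
      rw [Finset.mem_filter] at hf
      rw [Finset.mem_filter, Finset.mem_filter]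
      exact ⟨⟨hf.1, Finset.ne_empty_of_mem (mem_cutOn.2 ⟨hp', hf.2⟩)⟩,
        mem_faceFinset.2 ⟨_, hf.2⟩⟩
    split_ifs <;> omega
  · rw [if_neg hvK]
    split_ifs with h
    · obtain ⟨-, f, hf, hr, hvf⟩ := mem_rim.1 h
      refine Finset.card_pos.2 ⟨f, ?_⟩
      rw [Finset.mem_filter, Finset.mem_filter]
      exact ⟨⟨hf, hr⟩, hvf⟩
    · omega

theorem card_cut_sdiff_rim :
    (cutEdges G (A \ rim G faces A)).card + 3 ≤ (rim G faces A).card := by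
  classical
  set K := (cutEdges G A).image Prod.fst with hK
  have hKR : K ⊆ rim G faces A := by
    intro v hv
    obtain ⟨p, hp, rfl⟩ := Finset.mem_image.1 hv
    exact hF.cutEdge_mem_rim hp
  have h1 := Finset.card_sdiff_add_card_eq_card hKR
  have h2 : K.card = 3 := hF.card_cut_fst hA hc
  suffices h : (cutEdges G (A \ rim G faces A)).card ≤ (rim G faces A \ K).card by omega
  have h3 : (rim G faces A \ K).card =
      ∑ b ∈ (A \ rim G faces A)ᶜ, if b ∈ rim G faces A \ K then 1 else 0 := by
    rw [← Finset.card_filter, Finset.filter_mem_eq_inter, Finset.inter_eq_right.2]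
    intro b hb
    simp only [Finset.mem_sdiff, Finset.mem_compl] at hb ⊢
    tauto
  rw [h3, card_cutEdges']
  refine Finset.sum_le_sum fun b hb => ?_
  have hno : ∀ a ∈ (A \ rim G faces A).filter (fun a => G.Adj a b), b ∈ rim G faces A := by
    intro a ha
    rw [Finset.mem_filter, Finset.mem_sdiff] at ha
    by_contra hbR
    rw [Finset.mem_compl, Finset.mem_sdiff] at hb
    have hbA : b ∉ A := by tauto
    exact ha.1.2 (hF.cutEdge_mem_rim (p := (a, b)) (mem_cutEdges.2 ⟨ha.1.1, hbA, ha.2⟩))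
  have hface : ∀ a ∈ (A \ rim G faces A).filter (fun a => G.Adj a b), ∀ f ∈ faces,
      cutOn G A f ≠ ∅ → s(b, a) ∉ f := by
    intro a ha f hf hr h
    rw [Finset.mem_filter, Finset.mem_sdiff] at ha
    exact ha.1.2 (mem_rim.2 ⟨ha.1.1, f, hf, hr, mem_faceFinset.2 ⟨b, by rwa [Sym2.eq_swap]⟩⟩)
  split_ifs with h
  · rw [Finset.mem_sdiff] at h
    obtain ⟨-, f, hf, hr, hbf⟩ := mem_rim.1 h.1
    obtain ⟨x, hx⟩ := mem_faceFinset.1 hbf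
    rw [Finset.card_le_one]
    intro a ha a' ha'
    by_contra hne
    have e1 := (Finset.mem_filter.1 ha).2
    have e2 := (Finset.mem_filter.1 ha').2
    exact hface a' ha' f hf hr
      (hF.mem_of_mem_of_notMem hf hx e1.symm (hface a ha f hf hr) e2.symm (Ne.symm hne))
  · rw [Nat.le_zero, Finset.card_eq_zero, Finset.eq_empty_iff_forall_notMem]
    intro a ha
    have hbK : b ∈ K := by
      have := hno a ha
      rw [Finset.mem_sdiff] at h
      tauto
    obtain ⟨p, hp, rfl⟩ := Finset.mem_image.1 hbK
    have hp' := mem_cutEdges.1 hp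
    have ha' := Finset.mem_filter.1 ha
    obtain ⟨f, hf, h1, h2⟩ := hF.exists_common_face ha'.2.symm hp'.2.2 (by
      rintro rfl
      exact hp'.2.1 (Finset.mem_sdiff.1 ha'.1).1)
    exact hface a ha f hf (Finset.ne_empty_of_mem (mem_cutOn.2 ⟨hp', h2⟩)) h1

theorem rimLength_le : rimLength G faces A + 3 ≤ 3 * A.card := by
  classical
  have h := Finset.sum_le_sum (s := faces.filter fun f => cutOn G A f ≠ ∅)
    (f := fun f => (A ∩ faceFinset f).card + 1) (g := fun _ => A.card) (fun f hf => by
      rw [Finset.mem_filter] at hf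
      exact hF.ring_inter_lt hA hc hf.1 hf.2)
  rw [Finset.sum_add_distrib, Finset.sum_const, Finset.sum_const, hF.card_ring hc] at h
  simpa [rimLength] using h

theorem side_ne_empty (h9 : rimLength G faces A ≤ 9) : (A \ rim G faces A).Nonempty := by
  rw [Finset.nonempty_iff_ne_empty]
  intro h
  have hAR : A.card ≤ (rim G faces A).card :=
    Finset.card_le_card (Finset.sdiff_eq_empty_iff_subset.1 h)
  have h1 := hF.card_rim_le hA hc
  have h2 := hF.rimLength_le hA hc
  have h3 := hF.inner_sum A
  generalize rimLength G faces A = S at *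
  generalize A.card = n at *
  have : n ≤ 6 := by omega
  interval_cases n <;> omega

theorem nine_le_rimLength (hA' : A ≠ Finset.univ) : 9 ≤ rimLength G faces A := by
  by_contra hlt
  have h0 := hF.side_ne_empty hA hc (by omega)
  have h1 := hF.card_rim_le hA hc
  have h2 := hF.card_cut_sdiff_rim hA hc
  have h3 := hF.three_le_card_cutEdges h0 (by
    intro h
    exact hA' (Finset.univ_subset_iff.1 (h ▸ Finset.sdiff_subset)))
  omega

theorem side_step (hA' : A ≠ Finset.univ) (h9 : rimLength G faces A ≤ 9) :
    2 ≤ (A \ rim G faces A).card ∧ (cutEdges G (A \ rim G faces A)).card = 3 := by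
  classical
  have h0 := hF.side_ne_empty hA hc h9
  have h1 := hF.card_rim_le hA hc
  have h2 := hF.card_cut_sdiff_rim hA hc
  have h3 := hF.three_le_card_cutEdges h0 (by
    intro h
    exact hA' (Finset.univ_subset_iff.1 (h ▸ Finset.sdiff_subset)))
  refine ⟨?_, by omega⟩
  have hpos := Finset.card_pos.2 h0
  by_contra hlt
  have hone : (A \ rim G faces A).card = 1 := by omega
  have hR : rim G faces A ⊆ A := fun v hv => (mem_rim.1 hv).1
  have hcard := Finset.card_sdiff_add_card_eq_card hR
  obtain ⟨w, hw⟩ := h0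
  rw [Finset.mem_sdiff] at hw
  have hsum := hF.sum_card_inter A
  rw [← Finset.sum_filter_add_sum_filter_not faces (fun f => cutOn G A f ≠ ∅)] at hsum
  change rimLength G faces A + _ = _ at hsum
  have hsub : (faces.filter fun f => w ∈ faceFinset f) ⊆
      faces.filter (fun f => ¬ cutOn G A f ≠ ∅) := by
    intro f hf
    rw [Finset.mem_filter] at hf ⊢
    exact ⟨hf.1, fun h => hw.2 (mem_rim.2 ⟨hw.1, f, hf.1, h, hf.2⟩)⟩
  have h5 := Finset.sum_le_sum_of_subset (f := fun f => (A ∩ faceFinset f).card) hsub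
  have h6 := Finset.sum_le_sum (s := faces.filter fun f => w ∈ faceFinset f) (f := fun _ => 5)
    (g := fun f => (A ∩ faceFinset f).card) (by
      intro f hf
      have hf' := hsub hf
      rw [Finset.mem_filter] at hf hf'
      rw [not_not] at hf'
      rcases hF.subset_or_disjoint A hf.1 hf'.2 with h | h
      · rw [Finset.inter_eq_right.2 h, hF.card_faceFinset hf.1]
        have := hF.face_size f hf.1
        omega
      · have : w ∈ A ∩ faceFinset f := Finset.mem_inter.2 ⟨hw.1, hf.2⟩
        rw [h] at this
        simp at this)
  rw [Finset.sum_const, hF.card_faces_at, smul_eq_mul] at h6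
  omega

end Side

theorem rimLength_add_compl {A : Finset V} (hc : (cutEdges G A).card = 3) :
    rimLength G faces A + rimLength G faces Aᶜ ≤ 18 := by
  classical
  have hring : ∀ f, cutOn G Aᶜ f ≠ ∅ ↔ cutOn G A f ≠ ∅ := by
    intro f
    rw [← Finset.nonempty_iff_ne_empty, ← Finset.nonempty_iff_ne_empty, ← Finset.card_pos,
      ← Finset.card_pos, card_cutOn_compl]
  simp only [rimLength, hring]
  rw [← Finset.sum_add_distrib]
  have h := Finset.sum_le_sum (s := faces.filter fun f => cutOn G A f ≠ ∅)
    (f := fun f => (A ∩ faceFinset f).card + (Aᶜ ∩ faceFinset f).card) (g := fun _ => 6) (by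
      intro f hf
      rw [Finset.mem_filter] at hf
      have h1 := hF.card_faceFinset hf.1
      have h2 := hF.face_size f hf.1
      have h3 := Finset.card_sdiff_add_card_inter (faceFinset f) A
      have h4 : faceFinset f \ A = Aᶜ ∩ faceFinset f := by
        ext v; simp [and_comm]
      rw [h4, Finset.inter_comm (faceFinset f) A] at h3
      omega)
  rw [Finset.sum_const, hF.card_ring hc, smul_eq_mul] at h
  exact h

/-- Every 3-edge cut separates a single vertex. -/
theorem no_three_cut (A : Finset V) (hA : 2 ≤ A.card) (hA' : 2 ≤ Aᶜ.card)
    (hc : (cutEdges G A).card = 3) : False := by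
  induction hn : A.card using Nat.strong_induction_on generalizing A with
  | _ n ih =>
    have hu : A ≠ Finset.univ := by rintro rfl; simp at hA'
    have hu' : Aᶜ ≠ Finset.univ := by
      intro h
      have := congrArg compl h
      rw [compl_compl, Finset.compl_univ] at this
      rw [this] at hA; simp at hA
    have hc' : (cutEdges G Aᶜ).card = 3 := by rw [card_cutEdges_compl, hc]
    have h1 := hF.nine_le_rimLength hA' hc' hu'
    have h2 := hF.rimLength_add_compl hc
    obtain ⟨h3, h4⟩ := hF.side_step hA hc hu (by omega)
    have h5 := hF.card_cut_sdiff_rim hA hc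
    have hR : rim G faces A ⊆ A := fun v hv => (mem_rim.1 hv).1
    have h6 := Finset.card_sdiff_add_card_eq_card hR
    refine ih _ (by omega) (A \ rim G faces A) h3 ?_ h4 rfl
    refine hA'.trans (Finset.card_le_card ?_)
    intro v
    simp only [Finset.mem_compl, Finset.mem_sdiff]
    tauto

set_option maxHeartbeats 1000000 in
/-- Faces adjacent to a common face along non-consecutive edges are disjoint. -/
theorem disjoint_of_nonconsecutive (x : FaceFlag faces) {i : ℕ} (h2 : 2 ≤ i)
    (hi : i + 2 ≤ x.sz) :
    Disjoint (faceFinset (hF.gl x).f) (faceFinset (hF.gl (hF.nx^[i] x)).f) := by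
  classical
  obtain ⟨u, hu, hux⟩ := hF.exists_param x
  set y := hF.nx^[i] x with hy
  have hyf : y.f = x.f := hF.nx_iterate_f x i
  have h56 := hF.sz_eq x
  have hx0 := hux 0
  have hxi := hux i
  rw [← hy] at hxi
  have hvv : x.v ≠ y.v ∧ x.v ≠ y.w ∧ x.w ≠ y.v ∧ x.w ≠ y.w := by
    rw [hxi.1, hxi.2]
    rw [show x.v = u 0 from hx0.1, show x.w = u 1 from hx0.2]
    simp only [Ne, hu.inj]
    rcases h56 with h | h <;> rw [h] at hi ⊢ <;> omega
  have he12 : s(x.v, x.w) ≠ s(y.v, y.w) := by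
    rw [Ne, Sym2.eq_iff]; tauto
  have hgx : s(x.v, x.w) ∈ (hF.gl x).f := by
    have := (hF.gl x).edge; rwa [Sym2.eq_swap] at this
  have hhy : s(y.v, y.w) ∈ (hF.gl y).f := by
    have := (hF.gl y).edge; rwa [Sym2.eq_swap] at this
  have hye := y.edge
  rw [hyf] at hye
  have hgf := hF.gl_f_ne x
  have hhf := hF.gl_f_ne y
  rw [hyf] at hhf
  have hgh : (hF.gl x).f ≠ (hF.gl y).f := by
    intro h
    rw [← h] at hhy
    exact he12 (hF.edge_unique x.mem (hF.gl x).mem hgf.symm x.edge hgx hye hhy)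
  rw [Finset.disjoint_left]
  intro v hvg hvh
  obtain ⟨a, ha⟩ := mem_faceFinset.1 hvg
  obtain ⟨b, hb⟩ := mem_faceFinset.1 hvh
  obtain ⟨r, hrg, hrh⟩ : ∃ r, s(v, r) ∈ (hF.gl x).f ∧ s(v, r) ∈ (hF.gl y).f := by
    by_cases h : s(v, a) ∈ (hF.gl y).f
    · exact ⟨a, ha, h⟩
    · obtain ⟨t, ht, htg, -⟩ := hF.exists_other (hF.gl x).mem ha
      exact ⟨t, htg, hF.mem_of_mem_of_notMem (hF.gl y).mem hb (hF.adj_of_mem (hF.gl x).mem ha) h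
        (hF.adj_of_mem (hF.gl x).mem htg) ht⟩
  generalize s(v, r) = e3 at *
  have he1 : e3 ≠ s(x.v, x.w) := by
    rintro rfl
    rcases hF.eq_of_mem_three x.mem (hF.gl x).mem hgf.symm x.edge hgx (hF.gl y).mem hrh with h | h
    · exact hhf h
    · exact hgh h.symm
  have he2 : e3 ≠ s(y.v, y.w) := by
    rintro rfl
    rcases hF.eq_of_mem_three x.mem (hF.gl y).mem hhf.symm hye hhy (hF.gl x).mem hrg with h | h
    · exact hgf h
    · exact hgh h
  generalize hE1 : s(x.v, x.w) = e1 at *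
  generalize hE2 : s(y.v, y.w) = e2 at *
  have hx1 : e1 ∈ x.f := hE1 ▸ x.edge
  have hcardX : ({e1, e2, e3} : Finset (Sym2 V)).card = 3 :=
    Finset.card_eq_three.2 ⟨_, _, _, he12, he1.symm, he2.symm, rfl⟩
  obtain ⟨A, hA, hA', hc, hX⟩ := hF.exists_cut_card {e1, e2, e3} (by
      intro t ht
      simp only [Finset.mem_insert, Finset.mem_singleton] at ht
      rcases ht with rfl | rfl | rfl
      · exact hF.mem_edgeSet x.mem hx1
      · exact hF.mem_edgeSet x.mem hye
      · exact hF.mem_edgeSet (hF.gl x).mem hrg) ⟨e1, by simp⟩ (by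
      intro k hk
      have k1 : e1 ∈ k → k = x.f ∨ k = (hF.gl x).f := fun h =>
        hF.eq_of_mem_three x.mem (hF.gl x).mem hgf.symm hx1 hgx hk h
      have k2 : e2 ∈ k → k = x.f ∨ k = (hF.gl y).f := fun h =>
        hF.eq_of_mem_three x.mem (hF.gl y).mem hhf.symm hye hhy hk h
      have k3 : e3 ∈ k → k = (hF.gl x).f ∨ k = (hF.gl y).f := fun h =>
        hF.eq_of_mem_three (hF.gl x).mem (hF.gl y).mem hgh hrg hrh hk h
      rw [Finset.filter_mem_eq_inter]
      have n3 : e3 ∉ x.f := fun h => by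
        rcases hF.eq_of_mem_three (hF.gl x).mem (hF.gl y).mem hgh hrg hrh x.mem h with h | h
        · exact hgf h.symm
        · exact hhf h.symm
      have n2 : e2 ∉ (hF.gl x).f := fun h => by
        rcases hF.eq_of_mem_three x.mem (hF.gl y).mem hhf.symm hye hhy (hF.gl x).mem h with h | h
        · exact hgf h
        · exact hgh h
      have n1 : e1 ∉ (hF.gl y).f := fun h => by
        rcases hF.eq_of_mem_three x.mem (hF.gl x).mem hgf.symm hx1 hgx (hF.gl y).mem h with h | h
        · exact hhf h
        · exact hgh h.symm
      rw [card_inter_triple k he12 he1.symm he2.symm]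
      by_cases q1 : e1 ∈ k <;> by_cases q2 : e2 ∈ k <;> by_cases q3 : e3 ∈ k <;>
        simp only [q1, q2, q3, if_true, if_false]
      · exfalso
        rcases k1 q1 with rfl | rfl
        · exact n3 q3
        · exact n2 q2
      · decide
      · decide
      · exfalso
        rcases k1 q1 with rfl | rfl
        · exact q2 hye
        · exact q3 hrg
      · decide
      · exfalso
        rcases k2 q2 with rfl | rfl
        · exact q1 hx1
        · exact q3 hrh
      · exfalso
        rcases k3 q3 with rfl | rfl
        · exact q1 hgx
        · exact q2 hhy
      · decide)
  rw [hcardX] at hc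
  have h3 := hF.three_le_card_cutEdges hA (by rintro rfl; simp at hA')
  have hX1 := hX x.v x.w (by simp [hE1])
  have hX2 := hX y.v y.w (by simp [hE2])
  have two : ∀ B : Finset V, ¬ (x.v ∈ B ↔ x.w ∈ B) → ¬ (y.v ∈ B ↔ y.w ∈ B) → 2 ≤ B.card := by
    intro B h1 h2
    by_contra hlt
    have hB : ∀ a ∈ B, ∀ b ∈ B, a = b := Finset.card_le_one.1 (by omega)
    obtain ⟨v1, v2, v3, v4⟩ := hvv
    by_cases m1 : x.v ∈ B <;> by_cases m2 : y.v ∈ B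
    · exact v1 (hB _ m1 _ m2)
    · exact v2 (hB _ m1 _ (by tauto))
    · exact v3 (hB _ (by tauto) _ m2)
    · exact v4 (hB _ (by tauto) _ (by tauto))
  refine hF.no_three_cut A (two A hX1 hX2) (two Aᶜ ?_ ?_) (by omega)
  · simp only [Finset.mem_compl]; tauto
  · simp only [Finset.mem_compl]; tauto

end IsFullerene
end ThreeCutsMain

namespace FaceTable

/-- Size of face `f`: the bit set `S` records the hexagons. -/
def fsz (S f : ℕ) : ℕ := bif Nat.testBit S f then 6 else 5

/-- Walk `k` steps along the face of the dart `d`. -/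
def adv (S d k : ℕ) : ℕ := d - d % 8 + (d % 8 + k) % fsz S (d / 8)

def next (S d : ℕ) : ℕ := adv S d 1

def prev (S d : ℕ) : ℕ := adv S d (fsz S (d / 8) - 1)

/-- Entry of the gluing table: `e + 1` if `d` is glued to `e`, and `0` if `d` is free. -/
def entry (T d : ℕ) : ℕ := (T >>> (10 * d)) % 1024

def setEntry (T d e : ℕ) : ℕ := T ||| ((e + 1) <<< (10 * d))

def isDart (n S d : ℕ) : Bool := Nat.blt (d / 8) n && Nat.blt (d % 8) (fsz S (d / 8))

theorem fsz_eq (S f : ℕ) : fsz S f = 5 ∨ fsz S f = 6 := by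
  unfold fsz
  cases Nat.testBit S f <;> simp

theorem isDart_iff {n S d : ℕ} : isDart n S d = true ↔ d / 8 < n ∧ d % 8 < fsz S (d / 8) := by
  rw [isDart, Bool.and_eq_true, Nat.blt_eq, Nat.blt_eq]

theorem adv_div_mod (S d k : ℕ) :
    adv S d k / 8 = d / 8 ∧ adv S d k % 8 = (d % 8 + k) % fsz S (d / 8) := by
  have h : (d % 8 + k) % fsz S (d / 8) < 8 := by
    rcases fsz_eq S (d / 8) with h | h <;> rw [h] <;> omega
  unfold adv
  omega

theorem isDart_adv {n S d : ℕ} (h : isDart n S d = true) (k : ℕ) :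
    isDart n S (adv S d k) = true := by
  rw [isDart_iff] at h ⊢
  rw [(adv_div_mod S d k).1, (adv_div_mod S d k).2]
  exact ⟨h.1, Nat.mod_lt _ (by omega)⟩

theorem entry_setEntry {T d e : ℕ} (he : e + 1 < 1024) (h0 : entry T d = 0) (d' : ℕ) :
    entry (setEntry T d e) d' = if d' = d then e + 1 else entry T d' := by
  unfold entry setEntry at *
  have h1024 : 1024 = 2 ^ 10 := rfl
  split_ifs with h
  · subst h
    rw [h1024, Nat.shiftRight_or_distrib, Nat.or_mod_two_pow, ← h1024, h0, Nat.zero_or,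
      Nat.shiftLeft_shiftRight, Nat.mod_eq_of_lt he]
  · apply Nat.eq_of_testBit_eq
    intro i
    rw [h1024, Nat.testBit_mod_two_pow, Nat.testBit_mod_two_pow, Nat.testBit_shiftRight,
      Nat.testBit_shiftRight, Nat.testBit_or, Nat.testBit_shiftLeft]
    by_cases hi : i < 10
    · have : (decide (10 * d ≤ 10 * d' + i) && (e + 1).testBit (10 * d' + i - 10 * d)) = false := by
        rw [Bool.and_eq_false_iff]
        by_cases hle : 10 * d ≤ 10 * d' + i
        · right
          apply Nat.testBit_lt_two_pow
          have h2 : (2 : ℕ) ^ 10 ≤ 2 ^ (10 * d' + i - 10 * d) :=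
            Nat.pow_le_pow_right (by norm_num) (by omega)
          omega
        · left; simpa using hle
      rw [this, Bool.or_false]
    · simp [hi]

end FaceTable

open FaceTable

section Embedding

variable {V : Type*} [Fintype V] [DecidableEq V] {G : SimpleGraph V}
  {faces : Finset (Finset (Sym2 V))}

namespace IsFullerene

variable (hF : IsFullerene G faces)
include hF

theorem eq_or_eq_mu {x y : FaceFlag faces} (h : y.f = x.f) (hg : (hF.gl y).f = (hF.gl x).f) :
    y = x ∨ y = x.mu := by
  have e := hF.edge_unique x.mem (hF.gl x).mem (hF.gl_f_ne x).symm (e := s(x.v, x.w))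
    (e' := s(y.v, y.w)) x.edge (Sym2.eq_swap ▸ (hF.gl x).edge) (h ▸ y.edge)
    (hg ▸ (Sym2.eq_swap ▸ (hF.gl y).edge))
  rw [Sym2.eq_iff] at e
  rcases e with ⟨h1, h2⟩ | ⟨h1, h2⟩
  · exact Or.inl (FaceFlag.ext h1.symm h2.symm h)
  · exact Or.inr (FaceFlag.ext h2.symm h1.symm h)

theorem gl_f_ne_of_disjoint (x : FaceFlag faces) {f g : Finset (Sym2 V)}
    (h : Disjoint (faceFinset f) (faceFinset g)) (hf : x.f = f) (hg : (hF.gl x).f = g) :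
    False := by
  subst hf hg
  refine Finset.disjoint_left.1 h (mem_faceFinset.2 ⟨x.w, x.edge⟩)
    (mem_faceFinset.2 ⟨x.w, ?_⟩)
  rw [Sym2.eq_swap]
  exact (hF.gl x).edge

theorem nx_iterate_pred (x : FaceFlag faces) : hF.nx^[x.sz - 1] x = hF.pv x := by
  apply hF.nx_inj
  rw [hF.nx_pv, ← Function.iterate_succ_apply' hF.nx,
    show (x.sz - 1).succ = x.sz by rcases hF.sz_eq x with h | h <;> omega]
  exact (hF.nx_iterate_eq_iff x x.sz 0).2 (by simp)

/-- The flag represented by the dart `d`, where `b f` is the flag of the first dart of `f`. -/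
noncomputable def pt (b : ℕ → FaceFlag faces) (d : ℕ) : FaceFlag faces := hF.nx^[d % 8] (b (d / 8))

/-- The partial gluing table `T` is realised in the fullerene by the flags `b`. -/
structure Realises (n S T : ℕ) (b : ℕ → FaceFlag faces) : Prop where
  sz : ∀ f < n, (b f).sz = fsz S f
  glue : ∀ d e, entry T d = e + 1 →
    isDart n S d = true ∧ isDart n S e = true ∧ hF.gl (hF.pt b d) = hF.pt b e

@[simp] theorem pt_f (b : ℕ → FaceFlag faces) (d : ℕ) : (hF.pt b d).f = (b (d / 8)).f :=
  hF.nx_iterate_f _ _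

variable {hF} {n S T : ℕ} {b : ℕ → FaceFlag faces}

namespace Realises

variable (R : hF.Realises n S T b)
include R

theorem pt_sz {d : ℕ} (hd : isDart n S d = true) : (hF.pt b d).sz = fsz S (d / 8) := by
  rw [isDart_iff] at hd
  rw [← R.sz _ hd.1, FaceFlag.sz, pt_f, FaceFlag.sz]

theorem pt_adv {d : ℕ} (hd : isDart n S d = true) (k : ℕ) :
    hF.pt b (adv S d k) = hF.nx^[k] (hF.pt b d) := by
  rw [isDart_iff] at hd
  unfold pt
  rw [← Function.iterate_add_apply, (adv_div_mod S d k).1, (adv_div_mod S d k).2,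
    nx_iterate_eq_iff, R.sz _ hd.1, Nat.mod_mod, Nat.add_comm]

theorem pt_next {d : ℕ} (hd : isDart n S d = true) : hF.pt b (next S d) = hF.nx (hF.pt b d) :=
  R.pt_adv hd 1

theorem pt_prev {d : ℕ} (hd : isDart n S d = true) : hF.pt b (prev S d) = hF.pv (hF.pt b d) := by
  rw [prev, R.pt_adv hd, ← R.pt_sz hd, nx_iterate_pred]

theorem eq_of_pt_eq {d e : ℕ} (hd : isDart n S d = true) (he : isDart n S e = true)
    (hf : d / 8 = e / 8) (h : hF.pt b d = hF.pt b e) : d = e := by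
  rw [isDart_iff] at hd he
  rw [hf] at hd
  unfold pt at h
  rw [hf, nx_iterate_eq_iff, R.sz _ he.1, Nat.mod_eq_of_lt hd.2, Nat.mod_eq_of_lt he.2] at h
  omega

theorem pt_ne_mu {d e : ℕ} (hd : isDart n S d = true) (he : isDart n S e = true)
    (hf : d / 8 = e / 8) : hF.pt b d ≠ (hF.pt b e).mu := by
  intro h
  have h1 := R.pt_adv he (fsz S (e / 8) - e % 8 + d % 8)
  rw [isDart_iff] at he hd
  rw [hf] at hd
  have h2 : adv S e (fsz S (e / 8) - e % 8 + d % 8) = d := by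
    have h3 := adv_div_mod S e (fsz S (e / 8) - e % 8 + d % 8)
    rw [show e % 8 + (fsz S (e / 8) - e % 8 + d % 8) = fsz S (e / 8) + d % 8 by omega,
      Nat.add_mod_left, Nat.mod_eq_of_lt hd.2] at h3
    omega
  rw [h2, h] at h1
  exact hF.nx_iterate_ne_mu _ _ h1.symm

theorem far_disjoint {x y e e' : ℕ} (hxy : x / 8 = y / 8) (h2 : x + 2 ≤ y)
    (h3 : y + 2 ≤ x + fsz S (x / 8)) (hx : entry T x = e + 1) (hy : entry T y = e' + 1) :
    Disjoint (faceFinset (b (e / 8)).f) (faceFinset (b (e' / 8)).f) := by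
  obtain ⟨hx1, -, hx3⟩ := R.glue _ _ hx
  obtain ⟨hy1, -, hy3⟩ := R.glue _ _ hy
  have h := hF.disjoint_of_nonconsecutive (hF.pt b x) (i := y - x) (by omega)
    (by rw [R.pt_sz hx1]; omega)
  have h4 : adv S x (y - x) = y := by
    have h5 := adv_div_mod S x (y - x)
    rw [isDart_iff, ← hxy] at hy1
    rw [show x % 8 + (y - x) = y % 8 by omega, Nat.mod_eq_of_lt hy1.2] at h5
    omega
  rwa [← R.pt_adv hx1, h4, hx3, hy3, pt_f, pt_f] at h

theorem gl_f {d e : ℕ} (h : entry T d = e + 1) : (hF.gl (hF.pt b d)).f = (b (e / 8)).f := by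
  rw [(R.glue _ _ h).2.2, pt_f]

theorem div_ne_of_glue {d e : ℕ} (h : entry T d = e + 1) : (b (d / 8)).f ≠ (b (e / 8)).f := by
  have := hF.gl_f_ne (hF.pt b d)
  rw [R.gl_f h, pt_f] at this
  exact this.symm

theorem eq_of_common {d d' e e' : ℕ} (h : entry T d = e + 1) (h' : entry T d' = e' + 1)
    (he : e / 8 = e' / 8) (hd : (b (d / 8)).f = (b (d' / 8)).f) : e = e' := by
  obtain ⟨-, h2, h3⟩ := R.glue _ _ h
  obtain ⟨-, h2', h3'⟩ := R.glue _ _ h'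
  have h4 := congrArg hF.gl h3
  have h4' := congrArg hF.gl h3'
  rw [gl_gl] at h4 h4'
  have key := hF.eq_or_eq_mu (x := hF.pt b e') (y := hF.pt b e) (by rw [pt_f, pt_f, he])
    (by rw [← h4, ← h4', pt_f, pt_f, hd])
  rcases key with key | key
  · exact R.eq_of_pt_eq h2 h2' he key
  · exact absurd key (R.pt_ne_mu h2 h2' he)

/-- The three darts around a vertex. -/
theorem vertex_rule {x a c : ℕ} (hx : isDart n S x = true) (ha : entry T (prev S x) = a + 1)
    (hc : entry T (prev S a) = c + 1) :
    isDart n S (prev S c) = true ∧ hF.pt b a = hF.rot (hF.pt b x) ∧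
      hF.pt b c = hF.rot (hF.rot (hF.pt b x)) ∧ hF.gl (hF.pt b (prev S c)) = hF.pt b x := by
  obtain ⟨-, ha2, ha3⟩ := R.glue _ _ ha
  obtain ⟨-, hc2, hc3⟩ := R.glue _ _ hc
  rw [R.pt_prev hx] at ha3
  rw [R.pt_prev ha2] at hc3
  have e1 : hF.pt b a = hF.rot (hF.pt b x) := ha3.symm
  have e2 : hF.pt b c = hF.rot (hF.rot (hF.pt b x)) := by rw [← e1]; exact hc3.symm
  refine ⟨isDart_adv hc2 _, e1, e2, ?_⟩
  rw [R.pt_prev hc2, e2]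
  exact hF.rot_rot_rot _

/-- Adding a gluing known to hold. -/
theorem setEntry {x y : ℕ} (hn : n ≤ 127) (hx : isDart n S x = true) (hy : isDart n S y = true)
    (hxy : x ≠ y) (hx0 : entry T x = 0) (hy0 : entry T y = 0)
    (h : hF.gl (hF.pt b x) = hF.pt b y) :
    hF.Realises n S (setEntry (setEntry T x y) y x) b := by
  refine ⟨R.sz, fun d e hde => ?_⟩
  have hx' := isDart_iff.1 hx
  have hy' := isDart_iff.1 hy
  rw [entry_setEntry (by omega), entry_setEntry (by omega) hx0] at hde
  · split_ifs at hde with h1 h2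
    · obtain rfl : x = e := by omega
      subst h1
      exact ⟨hy, hx, by rw [← h, gl_gl]⟩
    · obtain rfl : y = e := by omega
      subst h2
      exact ⟨hx, hy, h⟩
    · exact R.glue _ _ hde
  · rw [entry_setEntry (by omega) hx0, if_neg hxy.symm, hy0]

/-- Adding a new face across the free dart `d`. -/
theorem attach {d S' : ℕ} (hn : n ≤ 126) (hd : isDart n S d = true) (hd0 : entry T d = 0)
    (hS : ∀ f < n, fsz S' f = fsz S f) (hS' : (hF.gl (hF.pt b d)).sz = fsz S' n) :
    hF.Realises (n + 1) S' (FaceTable.setEntry (FaceTable.setEntry T d (8 * n)) (8 * n) d)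
      (Function.update b n (hF.gl (hF.pt b d))) := by
  have hpt : ∀ e, e / 8 < n → hF.pt (Function.update b n (hF.gl (hF.pt b d))) e = hF.pt b e := by
    intro e he
    unfold pt
    rw [Function.update_of_ne (by omega)]
  have hdart : ∀ e, isDart n S e = true → isDart (n + 1) S' e = true := by
    intro e he
    rw [isDart_iff] at he ⊢
    rw [hS _ he.1]
    exact ⟨by omega, he.2⟩
  have R' : hF.Realises (n + 1) S' T (Function.update b n (hF.gl (hF.pt b d))) := by
    refine ⟨fun f hf => ?_, fun x e hxe => ?_⟩
    · rcases Nat.lt_succ_iff_lt_or_eq.1 hf with h | rfl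
      · rw [Function.update_of_ne (by omega), R.sz f h, hS f h]
      · rw [Function.update_self, hS']
    · obtain ⟨h1, h2, h3⟩ := R.glue _ _ hxe
      refine ⟨hdart _ h1, hdart _ h2, ?_⟩
      rw [hpt _ (isDart_iff.1 h1).1, hpt _ (isDart_iff.1 h2).1, h3]
  have hd1 := isDart_iff.1 hd
  refine R'.setEntry (by omega) (hdart _ hd) ?_ (by omega) hd0 ?_ ?_
  · rw [isDart_iff]
    rcases fsz_eq S' (8 * n / 8) with h | h <;> rw [h] <;> omega
  · by_contra hne
    obtain ⟨e, he⟩ := Nat.exists_eq_succ_of_ne_zero hne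
    have := (isDart_iff.1 (R.glue _ _ he).1).1
    omega
  · rw [hpt _ hd1.1]
    have h1 : hF.pt (Function.update b n (hF.gl (hF.pt b d))) (8 * n) = hF.gl (hF.pt b d) := by
      rw [pt, show 8 * n / 8 = n by omega, show 8 * n % 8 = 0 by omega, Function.update_self,
        Function.iterate_zero, id]
    rw [h1]

end Realises

end IsFullerene

end Embedding

namespace FaceTable

/-- The darts `x` and `y` lie on non-consecutive edges of the same face. -/
def far (S x y : ℕ) : Bool :=
  Nat.beq (x / 8) (y / 8) && Nat.ble (x + 2) y && Nat.ble (y + 2) (x + fsz S (x / 8))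

/-- `entry T d` is a dart of the face `f`. -/
def isOn (T d f : ℕ) : Bool := Nat.blt 0 (entry T d) && Nat.beq ((entry T d - 1) / 8) f

/-- The dart after `x` in the rotation around its start, as recorded in the table. -/
def turn (S T x : ℕ) : ℕ := entry T (prev S x) - 1

/-- The three darts around the start of `x` are recorded in the table. -/
def hasTurns (n S T x : ℕ) : Bool :=
  isDart n S x && Nat.blt 0 (entry T (prev S x)) && Nat.blt 0 (entry T (prev S (turn S T x)))

/-- Close up the vertices at the starts of the listed darts. -/
def closeUp (n S : ℕ) : List ℕ → ℕ → Option ℕ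
  | [], T => some T
  | x :: l, T =>
    bif hasTurns n S T x && Nat.beq (entry T x) 0 &&
      Nat.beq (entry T (prev S (turn S T (turn S T x)))) 0 &&
      !Nat.beq x (prev S (turn S T (turn S T x)))
    then closeUp n S l (setEntry (setEntry T x (prev S (turn S T (turn S T x))))
      (prev S (turn S T (turn S T x))) x)
    else none

/-- Some edge gives a contradiction to the chord-freeness of faces. -/
def isChord (S T x y z : ℕ) : Bool :=
  isOn T x (x / 8) ||
    (Nat.blt 0 (entry T x) && Nat.blt 0 (entry T y) &&
      ((Nat.beq (x / 8) (y / 8) && !Nat.beq x y &&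
          Nat.beq ((entry T x - 1) / 8) ((entry T y - 1) / 8)) ||
        (far S x y && Nat.beq (z / 8) ((entry T x - 1) / 8) && isOn T z ((entry T y - 1) / 8))))

/-- The darts `u` and `v` cannot represent the same flag, in view of the faces around them. -/
def isDistinct (S T u v p q : ℕ) : Bool :=
  (Nat.beq (u / 8) (v / 8) && !Nat.beq u v) || !Nat.beq (fsz S (u / 8)) (fsz S (v / 8)) ||
    (Nat.beq (p / 8) (u / 8) &&
      (isOn T p (v / 8) ||
        (Nat.beq (q / 8) (v / 8) && Nat.blt 0 (entry T p) && isOn T q ((entry T p - 1) / 8) &&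
          !Nat.beq (entry T p) (entry T q))))

/-- The darts `u` and `v` cannot represent the same flag, by following the path `w`. -/
def isDistinctAlong (S T p q : ℕ) : List ℕ → ℕ → ℕ → Bool
  | [], u, v => isDistinct S T u v p q
  | k :: w, u, v =>
    Nat.blt 0 (entry T (adv S u k)) && Nat.blt 0 (entry T (adv S v k)) &&
      isDistinctAlong S T p q w (entry T (adv S u k) - 1) (entry T (adv S v k) - 1)

/-- Closing up the vertex at the start of `x` gives a contradiction. -/
def isClash (n S T : ℕ) (s : Bool) (x : ℕ) (w : List ℕ) (p q : ℕ) : Bool :=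
  hasTurns n S T x &&
    (Nat.beq (prev S (turn S T (turn S T x)) / 8) (x / 8) ||
      bif s then
        Nat.blt 0 (entry T (prev S (turn S T (turn S T x)))) &&
          isDistinctAlong S T p q w (entry T (prev S (turn S T (turn S T x))) - 1) x
      else
        Nat.blt 0 (entry T x) &&
          isDistinctAlong S T p q w (entry T x - 1) (prev S (turn S T (turn S T x))))

theorem far_iff {S x y : ℕ} : far S x y = true ↔
    x / 8 = y / 8 ∧ x + 2 ≤ y ∧ y + 2 ≤ x + fsz S (x / 8) := by
  simp [far, and_assoc]

theorem isOn_iff {T d f : ℕ} : isOn T d f = true ↔ ∃ e, entry T d = e + 1 ∧ e / 8 = f := by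
  rw [isOn, Bool.and_eq_true, Nat.blt_eq, Nat.beq_eq]
  constructor
  · rintro ⟨h1, h2⟩
    exact ⟨entry T d - 1, by omega, h2⟩
  · rintro ⟨e, h1, h2⟩
    rw [h1]
    exact ⟨by omega, h2⟩

theorem exists_entry {T d : ℕ} (h : 0 < entry T d) : ∃ e, entry T d = e + 1 :=
  Nat.exists_eq_succ_of_ne_zero h.ne'

theorem hasTurns_iff {n S T x : ℕ} : hasTurns n S T x = true ↔ isDart n S x = true ∧
    ∃ a c, entry T (prev S x) = a + 1 ∧ entry T (prev S a) = c + 1 ∧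
      turn S T x = a ∧ turn S T (turn S T x) = c := by
  rw [hasTurns, Bool.and_eq_true, Bool.and_eq_true, Nat.blt_eq, Nat.blt_eq, and_assoc]
  refine and_congr_right fun _ => ⟨?_, ?_⟩
  · rintro ⟨h1, h2⟩
    obtain ⟨a, ha⟩ := exists_entry h1
    have hta : turn S T x = a := by rw [turn, ha, Nat.add_sub_cancel]
    rw [hta] at h2
    obtain ⟨c, hc⟩ := exists_entry h2
    exact ⟨a, c, ha, hc, hta, by rw [hta, turn, hc, Nat.add_sub_cancel]⟩
  · rintro ⟨a, c, ha, hc, hta, -⟩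
    rw [hta, ha, hc]
    omega

end FaceTable

open FaceTable

section Embedding

variable {V : Type*} [Fintype V] [DecidableEq V] {G : SimpleGraph V}
  {faces : Finset (Finset (Sym2 V))}

namespace IsFullerene.Realises

variable {hF : IsFullerene G faces} {n S T : ℕ} {b : ℕ → FaceFlag faces}

theorem closeUp (hn : n ≤ 127) {l : List ℕ} {T' : ℕ} (R : hF.Realises n S T b)
    (h : closeUp n S l T = some T') : hF.Realises n S T' b := by
  induction l generalizing T with
  | nil => rw [FaceTable.closeUp, Option.some_inj] at h; rwa [← h]
  | cons x l ih =>
    rw [FaceTable.closeUp, Bool.cond_eq_ite] at h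
    split at h
    · rename_i hc
      simp only [Bool.and_eq_true, hasTurns_iff, Nat.beq_eq, Bool.not_eq_true',
        Bool.eq_false_iff, Ne] at hc
      obtain ⟨⟨⟨⟨hx, a, c, ha, hc, hta, htc⟩, h1⟩, h2⟩, h3⟩ := hc
      rw [htc] at h h2 h3
      obtain ⟨k1, -, -, k2⟩ := R.vertex_rule hx ha hc
      refine ih (R.setEntry hn hx k1 h3 h1 h2 ?_) h
      rw [← k2, gl_gl]
    · exact absurd h (by simp)

theorem not_isChord {x y z : ℕ} (R : hF.Realises n S T b) : ¬ isChord S T x y z = true := by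
  intro h
  simp only [isChord, Bool.or_eq_true, Bool.and_eq_true, Nat.blt_eq, far_iff, Nat.beq_eq] at h
  rcases h with h | ⟨⟨h1, h2⟩, h⟩
  · obtain ⟨e, h1, h2⟩ := isOn_iff.1 h
    exact R.div_ne_of_glue h1 (by rw [h2])
  obtain ⟨e, h1⟩ := exists_entry h1
  obtain ⟨e', h2⟩ := exists_entry h2
  rw [h1, h2, Nat.add_sub_cancel, Nat.add_sub_cancel] at h
  rcases h with ⟨⟨h3, h4⟩, h5⟩ | ⟨⟨⟨h3, h4, h5⟩, h6⟩, h7⟩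
  · have h6 := R.eq_of_common h1 h2 h5 (by rw [h3])
    have h7 := (R.glue _ _ h1).2.2
    rw [h6, ← (R.glue _ _ h2).2.2] at h7
    have h8 := R.eq_of_pt_eq (R.glue _ _ h1).1 (R.glue _ _ h2).1 h3 (hF.gl_inj h7)
    simp [h8] at h4
  · obtain ⟨e'', h7, h8⟩ := isOn_iff.1 h7
    exact hF.gl_f_ne_of_disjoint (hF.pt b z) (R.far_disjoint h3 h4 h5 h1 h2)
      (by rw [pt_f, h6]) (by rw [R.gl_f h7, h8])

theorem not_isDistinct {u v p q : ℕ} (R : hF.Realises n S T b) (hu : isDart n S u = true)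
    (hv : isDart n S v = true) (h : hF.pt b u = hF.pt b v) : ¬ isDistinct S T u v p q = true := by
  have hf : (b (u / 8)).f = (b (v / 8)).f := by rw [← pt_f hF, h, pt_f]
  simp only [isDistinct, Bool.or_eq_true, Bool.and_eq_true, Nat.blt_eq, Nat.beq_eq,
    Bool.not_eq_true', Bool.eq_false_iff, Ne]
  rintro ((⟨h1, h2⟩ | h1) | ⟨h1, h2 | ⟨⟨⟨h2, h3⟩, h4⟩, h5⟩⟩)
  · exact h2 (R.eq_of_pt_eq hu hv h1 h)
  · rw [← R.pt_sz hu, ← R.pt_sz hv, h] at h1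
    exact h1 rfl
  · obtain ⟨e, h3, h4⟩ := isOn_iff.1 h2
    exact R.div_ne_of_glue h3 (by rw [h1, h4, hf])
  · obtain ⟨e, h3⟩ := exists_entry h3
    rw [h3, Nat.add_sub_cancel] at h4
    obtain ⟨e', h4, h6⟩ := isOn_iff.1 h4
    have := R.eq_of_common h3 h4 h6.symm (by rw [h1, h2, hf])
    omega

theorem not_isDistinctAlong {p q : ℕ} {w : List ℕ} {u v : ℕ} (R : hF.Realises n S T b)
    (hu : isDart n S u = true) (hv : isDart n S v = true) (h : hF.pt b u = hF.pt b v) :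
    ¬ isDistinctAlong S T p q w u v = true := by
  induction w generalizing u v with
  | nil => exact R.not_isDistinct hu hv h
  | cons k w ih =>
    rw [isDistinctAlong, Bool.and_eq_true, Bool.and_eq_true, Nat.blt_eq, Nat.blt_eq]
    rintro ⟨⟨h1, h2⟩, h3⟩
    obtain ⟨e, h1⟩ := exists_entry h1
    obtain ⟨e', h2⟩ := exists_entry h2
    rw [h1, h2, Nat.add_sub_cancel, Nat.add_sub_cancel] at h3
    obtain ⟨-, k2, k3⟩ := R.glue _ _ h1
    obtain ⟨-, k2', k3'⟩ := R.glue _ _ h2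
    refine ih k2 k2' ?_ h3
    rw [← k3, ← k3', R.pt_adv hu, R.pt_adv hv, h]

theorem not_isClash {s : Bool} {x : ℕ} {w : List ℕ} {p q : ℕ} (R : hF.Realises n S T b) :
    ¬ isClash n S T s x w p q = true := by
  rw [isClash, Bool.and_eq_true, Bool.or_eq_true, hasTurns_iff, Nat.beq_eq]
  rintro ⟨⟨hx, a, c, ha, hc, -, htc⟩, h⟩
  rw [htc] at h
  obtain ⟨k1, -, -, k2⟩ := R.vertex_rule hx ha hc
  rcases h with h | h
  · apply hF.gl_f_ne (hF.pt b (prev S c))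
    rw [k2, pt_f, pt_f, h]
  cases s
  · rw [cond_false, Bool.and_eq_true, Nat.blt_eq] at h
    obtain ⟨e, he⟩ := exists_entry h.1
    obtain ⟨-, k3, k4⟩ := R.glue _ _ he
    refine R.not_isDistinctAlong k3 k1 ?_ (by simpa [he] using h.2)
    rw [← k4, ← k2, gl_gl]
  · rw [cond_true, Bool.and_eq_true, Nat.blt_eq] at h
    obtain ⟨e, he⟩ := exists_entry h.1
    obtain ⟨-, k3, k4⟩ := R.glue _ _ he
    refine R.not_isDistinctAlong k3 hx ?_ (by simpa [he] using h.2)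
    rw [← k4, ← k2]

end IsFullerene.Realises

end Embedding

namespace FaceTable

/-- The dart glued to `d`, or `d` itself if it is free. -/
def glued (T d : ℕ) : ℕ := bif Nat.blt 0 (entry T d) then entry T d - 1 else d

/-- Add the edge of the dart `d` to the set `F` of excluded edges. -/
def mark (T d F : ℕ) : ℕ := F ||| (1 <<< d) ||| (1 <<< glued T d)

/-- Exclude the edges adjacent to the edge of `x`. -/
def markAround (S T x F : ℕ) : ℕ :=
  mark T (next S x) (mark T (prev S x)
    (mark T (next S (glued T x)) (mark T (prev S (glued T x)) F)))

/-- Exclude the edge at the start of `d` leaving the face of `d`. -/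
def markOut (S T d F : ℕ) : ℕ :=
  let F' := bif Nat.blt 0 (entry T d) then mark T (next S (entry T d - 1)) F else F
  bif Nat.blt 0 (entry T (prev S d)) then mark T (prev S (entry T (prev S d) - 1)) F' else F'

/-- Exclude the edges leaving the hexagon `h`. -/
def markFace (S T h F : ℕ) : ℕ :=
  [0, 1, 2, 3, 4, 5].foldr (fun i => markOut S T (8 * h + i)) F

/-- The vertices at the starts of the listed darts cannot all be matched avoiding `F`. -/
def matchFails (n S T : ℕ) : List ℕ → ℕ → Bool
  | [], _ => false
  | d :: l, F => hasTurns n S T d &&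
      (Nat.testBit F d || matchFails n S T l (markAround S T d F)) &&
      (Nat.testBit F (turn S T d) || matchFails n S T l (markAround S T (turn S T d) F)) &&
      (Nat.testBit F (turn S T (turn S T d)) ||
        matchFails n S T l (markAround S T (turn S T (turn S T d)) F))

/-- The darts `x` and `y` show that the faces `h` and `h'` are disjoint. -/
def separates (S T h h' x y : ℕ) : Bool := far S x y && isOn T x h && isOn T y h'

/-- The hexagons in `H` do not form a resonant pattern. -/
def isNonresonant (n S T : ℕ) (H : List ℕ) (D : List (ℕ × ℕ)) (l : List ℕ) : Bool :=
  Nat.ble H.length 3 &&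
    H.all (fun h => Nat.blt h n && Nat.testBit S h && H.all (fun h' => Nat.beq h h' ||
      D.any (fun p => separates S T h h' p.1 p.2 || separates S T h' h p.1 p.2))) &&
    matchFails n S T l (H.foldr (markFace S T) 0)

end FaceTable

open FaceTable

section Embedding

variable {V : Type*} [Fintype V] [DecidableEq V] {G : SimpleGraph V}
  {faces : Finset (Finset (Sym2 V))}

theorem mem_faceVerts {f : Finset (Sym2 V)} {v : V} : v ∈ faceVerts f ↔ ∃ w, s(v, w) ∈ f := by
  constructor
  · rintro ⟨e, he, hv⟩
    obtain ⟨w, rfl⟩ := hv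
    exact ⟨w, he⟩
  · rintro ⟨w, hw⟩
    exact ⟨_, hw, Sym2.mem_mk_left v w⟩

theorem disjoint_faceVerts {f g : Finset (Sym2 V)} :
    Disjoint (faceVerts f) (faceVerts g) ↔ Disjoint (faceFinset f) (faceFinset g) := by
  rw [Set.disjoint_left, Finset.disjoint_left]
  simp only [mem_faceVerts, mem_faceFinset]

namespace IsFullerene

variable (hF : IsFullerene G faces)
include hF

theorem not_adj_pv {M : G.Subgraph} (hM : M.IsPerfectMatching) {x : FaceFlag faces}
    (h : M.Adj x.v x.w) : ¬ M.Adj (hF.pv x).v (hF.pv x).w := fun h' =>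
  hF.pv_v_ne x ((Subgraph.isPerfectMatching_iff.1 hM x.v).unique h'.symm h)

theorem not_adj_nx {M : G.Subgraph} (hM : M.IsPerfectMatching) {x : FaceFlag faces}
    (h : M.Adj x.v x.w) : ¬ M.Adj (hF.nx x).v (hF.nx x).w := fun h' =>
  hF.nx_w_ne x ((Subgraph.isPerfectMatching_iff.1 hM x.w).unique h' h.symm)

theorem nx_gl (x : FaceFlag faces) : hF.nx (hF.gl x) = hF.rot (hF.rot x) := by
  apply hF.rot_inj
  rw [hF.rot_rot_rot, rot, hF.pv_nx, hF.gl_gl]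

theorem not_adj_rot_rot {M : G.Subgraph} (hM : M.IsPerfectMatching) {x : FaceFlag faces}
    (h : AltFace G M x.f) : ¬ M.Adj x.v (hF.rot (hF.rot x)).w := by
  intro h'
  obtain ⟨u, hu, hvu⟩ := h x.v (mem_faceVerts.2 ⟨_, x.edge⟩)
  rw [(Subgraph.isPerfectMatching_iff.1 hM x.v).unique hvu h'] at hu
  exact hF.rot_f_ne x (hF.f_eq_of_two (x := hF.rot x) (y := x) (v := x.v)
    (hF.rot_w_ne (hF.rot x)).symm (hF.rot x).edge (hF.rot_edge (hF.rot x)) (hF.rot_edge x) hu)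

/-- All edges in the bit set `F` are outside the matching. -/
def Excludes (M : G.Subgraph) (b : ℕ → FaceFlag faces) (F : ℕ) : Prop :=
  ∀ d, Nat.testBit F d = true → ¬ M.Adj (hF.pt b d).v (hF.pt b d).w

variable {hF} {n S T : ℕ} {b : ℕ → FaceFlag faces} {M : G.Subgraph}

namespace Realises

variable (R : hF.Realises n S T b)
include R

theorem adj_glued (d : ℕ) : M.Adj (hF.pt b (glued T d)).v (hF.pt b (glued T d)).w ↔
    M.Adj (hF.pt b d).v (hF.pt b d).w := by
  rw [glued, Bool.cond_eq_ite]
  split_ifs with h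
  · obtain ⟨e, he⟩ := exists_entry (by simpa using h)
    rw [he, Nat.add_sub_cancel, ← (R.glue _ _ he).2.2, gl_v, gl_w, M.adj_comm]
  · rfl

theorem isDart_glued {d : ℕ} (hd : isDart n S d = true) : isDart n S (glued T d) = true := by
  rw [glued, Bool.cond_eq_ite]
  split_ifs with h
  · obtain ⟨e, he⟩ := exists_entry (by simpa using h)
    rw [he, Nat.add_sub_cancel]
    exact (R.glue _ _ he).2.1
  · exact hd

theorem excludes_mark {d F : ℕ} (hE : hF.Excludes M b F)
    (h : ¬ M.Adj (hF.pt b d).v (hF.pt b d).w) : hF.Excludes M b (mark T d F) := by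
  intro e he
  rw [mark, Nat.testBit_or, Nat.testBit_or, Bool.or_eq_true, Bool.or_eq_true,
    Nat.one_shiftLeft, Nat.one_shiftLeft, Nat.testBit_two_pow, Nat.testBit_two_pow,
    decide_eq_true_eq, decide_eq_true_eq] at he
  rcases he with (he | rfl) | rfl
  · exact hE e he
  · exact h
  · rwa [R.adj_glued]

theorem excludes_markAround {x F : ℕ} (hM : M.IsPerfectMatching) (hE : hF.Excludes M b F)
    (hx : isDart n S x = true) (h : M.Adj (hF.pt b x).v (hF.pt b x).w) :
    hF.Excludes M b (markAround S T x F) := by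
  have hx' := R.isDart_glued hx
  have h' := R.adj_glued (M := M) x |>.2 h
  refine R.excludes_mark (R.excludes_mark (R.excludes_mark (R.excludes_mark hE ?_) ?_) ?_) ?_
  · rw [R.pt_prev hx']; exact hF.not_adj_pv hM h'
  · rw [R.pt_next hx']; exact hF.not_adj_nx hM h'
  · rw [R.pt_prev hx]; exact hF.not_adj_pv hM h
  · rw [R.pt_next hx]; exact hF.not_adj_nx hM h

theorem excludes_markOut {d F : ℕ} (hM : M.IsPerfectMatching) (hE : hF.Excludes M b F)
    (hd : isDart n S d = true) (h : AltFace G M (b (d / 8)).f) :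
    hF.Excludes M b (markOut S T d F) := by
  rw [← pt_f hF] at h
  have h1 := hF.not_adj_rot_rot hM h
  simp only [markOut, Bool.cond_eq_ite]
  have h2 : hF.Excludes M b (if Nat.blt 0 (entry T d) = true then
      mark T (next S (entry T d - 1)) F else F) := by
    split_ifs with hd0
    · obtain ⟨e, he⟩ := exists_entry (by simpa using hd0)
      rw [he, Nat.add_sub_cancel]
      obtain ⟨-, k2, k3⟩ := R.glue _ _ he
      refine R.excludes_mark hE ?_
      rwa [R.pt_next k2, ← k3, nx_gl]
    · exact hE
  generalize (if Nat.blt 0 (entry T d) = true then mark T (next S (entry T d - 1)) F else F) = F'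
    at h2 ⊢
  split_ifs with hd0
  · obtain ⟨e, he⟩ := exists_entry (by simpa using hd0)
    rw [he, Nat.add_sub_cancel]
    obtain ⟨-, k2, k3⟩ := R.glue _ _ he
    refine R.excludes_mark h2 ?_
    rw [R.pt_prev hd] at k3
    rw [R.pt_prev k2, ← k3, M.adj_comm]
    exact h1
  · exact h2

theorem excludes_markFace {f F : ℕ} (hM : M.IsPerfectMatching) (hE : hF.Excludes M b F)
    (hf : f < n) (hS : Nat.testBit S f = true) (h : AltFace G M (b f).f) :
    hF.Excludes M b (markFace S T f F) := by
  have step : ∀ i < 6, ∀ F, hF.Excludes M b F → hF.Excludes M b (markOut S T (8 * f + i) F) := by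
    intro i hi F hE
    have h1 : (8 * f + i) / 8 = f := by omega
    refine R.excludes_markOut hM hE ?_ (by rwa [h1])
    rw [isDart_iff, h1, fsz, hS, cond_true]
    omega
  simp only [markFace, List.foldr]
  exact step 0 (by omega) _ (step 1 (by omega) _ (step 2 (by omega) _ (step 3 (by omega) _
    (step 4 (by omega) _ (step 5 (by omega) _ hE)))))

theorem not_matchFails {l : List ℕ} {F : ℕ} (hM : M.IsPerfectMatching)
    (hE : hF.Excludes M b F) : ¬ matchFails n S T l F = true := by
  induction l generalizing F with
  | nil => simp [matchFails]
  | cons d l ih =>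
    simp only [matchFails, Bool.and_eq_true, Bool.or_eq_true, hasTurns_iff]
    rintro ⟨⟨⟨⟨hd, a, c, ha, hc, hta, htc⟩, h0⟩, h1⟩, h2⟩
    rw [htc] at h2
    rw [hta] at h1
    obtain ⟨-, e1, e2, -⟩ := R.vertex_rule hd ha hc
    have key : ∀ x, isDart n S x = true →
        (Nat.testBit F x = true ∨ matchFails n S T l (markAround S T x F) = true) →
        ¬ M.Adj (hF.pt b x).v (hF.pt b x).w := by
      rintro x hx (h | h) hadj
      · exact hE x h hadj
      · exact ih (R.excludes_markAround hM hE hx hadj) h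
    obtain ⟨u, hu, -⟩ := Subgraph.isPerfectMatching_iff.1 hM (hF.pt b d).v
    have k0 := key d hd h0
    have k1 := key a (R.glue _ _ ha).2.1 h1
    have k2 := key c (R.glue _ _ hc).2.1 h2
    rw [e1] at k1
    rw [e2] at k2
    rcases hF.eq_of_adj (hF.pt b d) hu.adj_sub with h | h | h <;> rw [h] at hu
    exacts [k0 hu, k1 hu, k2 hu]

theorem disjoint_of_separates {h h' x y : ℕ} (hs : separates S T h h' x y = true) :
    Disjoint (faceFinset (b h).f) (faceFinset (b h').f) := by
  simp only [separates, Bool.and_eq_true, far_iff, isOn_iff] at hs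
  obtain ⟨⟨⟨h1, h2, h3⟩, e, he, rfl⟩, e', he', rfl⟩ := hs
  exact R.far_disjoint h1 h2 h3 he he'

theorem not_isNonresonant {H : List ℕ} {D : List (ℕ × ℕ)} {l : List ℕ}
    (hres : KResonant G faces 3) : ¬ isNonresonant n S T H D l = true := by
  simp only [isNonresonant, Bool.and_eq_true, Bool.or_eq_true, List.all_eq_true, List.any_eq_true,
    Nat.blt_eq, Nat.ble_eq, Nat.beq_eq]
  rintro ⟨⟨h3, hH⟩, hfail⟩
  classical
  have hdisj : ∀ h ∈ H, ∀ h' ∈ H, (b h).f ≠ (b h').f →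
      Disjoint (faceVerts (b h).f) (faceVerts (b h').f) := by
    intro h hh h' hh' hne
    rw [disjoint_faceVerts]
    rcases (hH h hh).2 h' hh' with rfl | ⟨p, -, hp | hp⟩
    · exact absurd rfl hne
    · exact R.disjoint_of_separates hp
    · exact (R.disjoint_of_separates hp).symm
  obtain ⟨M, hM, halt⟩ := hres (H.map fun h => (b h).f).toFinset
    (by
      intro f hf
      simp only [List.mem_toFinset, List.mem_map] at hf
      obtain ⟨h, -, rfl⟩ := hf
      exact (b h).mem)
    (by
      intro f hf
      simp only [List.mem_toFinset, List.mem_map] at hf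
      obtain ⟨h, hh, rfl⟩ := hf
      have h1 := R.sz h (hH h hh).1.1
      rwa [fsz, (hH h hh).1.2, cond_true] at h1)
    (by
      intro f hf g hg hfg
      simp only [List.mem_toFinset, List.mem_map] at hf hg
      obtain ⟨h, hh, rfl⟩ := hf
      obtain ⟨h', hh', rfl⟩ := hg
      exact hdisj h hh h' hh' hfg)
    ((List.toFinset_card_le _).trans (by rwa [List.length_map]))
  refine R.not_matchFails hM ?_ hfail
  have halt' : ∀ h ∈ H, AltFace G M (b h).f := fun h hh =>
    halt _ (by simp only [List.mem_toFinset, List.mem_map]; exact ⟨h, hh, rfl⟩)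
  have hH' : ∀ h ∈ H, h < n ∧ Nat.testBit S h = true := fun h hh => (hH h hh).1
  clear hfail h3 hH hdisj halt
  induction H with
  | nil => intro d hd; simp at hd
  | cons h H ih =>
    rw [List.foldr_cons]
    refine R.excludes_markFace hM (ih (fun k hk => halt' k (List.mem_cons_of_mem _ hk))
      (fun k hk => hH' k (List.mem_cons_of_mem _ hk))) (hH' h (by simp)).1 (hH' h (by simp)).2
      (halt' h (by simp))

end Realises

end IsFullerene

end Embedding

namespace FaceTable

/-- The table is complete: it describes a closed surface with twelve pentagons. -/
def isClosed (n S T : ℕ) : Bool :=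
  Nat.blt 0 n && !Nat.testBit S 0 &&
    Nat.beq ((List.range n).filter (fun f => !Nat.testBit S f)).length 12 &&
    (List.range (8 * n)).all (fun d => !isDart n S d ||
      (Nat.blt 0 (entry T d) && Nat.beq (entry T (entry T d - 1)) (d + 1))) &&
    (List.range n).all (fun f => Nat.beq f 0 || Nat.ble (entry T (8 * f)) (8 * f))

def exactlyOne (p q r : Bool) : Bool := bif p then !q && !r else xor q r

/-- The set `M` of darts is a perfect matching. -/
def isMatching (n S T M : ℕ) : Bool :=
  (List.range (8 * n)).all (fun d => !isDart n S d ||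
    ((Nat.testBit M d == Nat.testBit M (entry T d - 1)) &&
      exactlyOne (Nat.testBit M d) (Nat.testBit M (turn S T d))
        (Nat.testBit M (turn S T (turn S T d)))))

/-- The hexagon `j` is alternating for the matching `M`. -/
def alternates (S M j : ℕ) : Bool :=
  [0, 1, 2, 3, 4, 5].all
    (fun i => Nat.testBit M (8 * j + i) || Nat.testBit M (prev S (8 * j + i)))

/-- The set of faces adjacent to the hexagon `j`. -/
def neighbors (T j : ℕ) : ℕ :=
  [0, 1, 2, 3, 4, 5].foldr (fun i C => C ||| 1 <<< ((entry T (8 * j + i) - 1) / 8)) 0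

/-- Every set of disjoint hexagons outside `C` is resonant for one of the listed matchings. -/
def covers (n S T : ℕ) : List ℕ → ℕ → Bool
  | [], _ => false
  | M :: l, C => (List.range n).all (fun j => !Nat.testBit S j || Nat.testBit C j ||
      alternates S M j || covers n S T l (C ||| neighbors T j))

/-- The table describes a fullerene, the listed matchings showing all patterns resonant. -/
def isSolved (n S T : ℕ) (l : List ℕ) : Bool :=
  isClosed n S T && l.all (isMatching n S T) && covers n S T l 0

/-- Properties of a complete table. -/
structure Closed (n S T : ℕ) : Prop where
  pos : 0 < n
  pentagon : Nat.testBit S 0 = false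
  count : ((Finset.range n).filter (fun f => Nat.testBit S f = false)).card = 12
  glued_entry : ∀ d, isDart n S d = true → ∃ e, entry T d = e + 1 ∧ entry T e = d + 1
  lower : ∀ f < n, f ≠ 0 → entry T (8 * f) ≤ 8 * f

theorem lt_of_isDart {n S d : ℕ} (hd : isDart n S d = true) : d < 8 * n := by
  rw [isDart_iff] at hd
  omega

theorem closed_of_isClosed {n S T : ℕ} (h : isClosed n S T = true) : Closed n S T := by
  simp only [isClosed, Bool.and_eq_true, Nat.blt_eq, Nat.beq_eq, List.all_eq_true, List.mem_range,
    Bool.or_eq_true, Bool.not_eq_true', Nat.ble_eq] at h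
  obtain ⟨⟨⟨⟨h1, h2⟩, h3⟩, h4⟩, h5⟩ := h
  refine ⟨h1, h2, ?_, ?_, fun f hf h0 => (h5 f hf).resolve_left h0⟩
  · rw [← h3, ← List.toFinset_card_of_nodup (List.nodup_range.filter _)]
    congr 1
    ext f
    simp
  · intro d hd
    rcases h4 d (lt_of_isDart hd) with h | h
    · rw [h] at hd; exact absurd hd (by simp)
    · obtain ⟨e, he⟩ := exists_entry h.1
      rw [he, Nat.add_sub_cancel] at h
      exact ⟨e, he, h.2⟩

end FaceTable

open FaceTable

section Embedding

variable {V : Type*} [Fintype V] [DecidableEq V] {G : SimpleGraph V}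
  {faces : Finset (Finset (Sym2 V))}

namespace IsFullerene

variable {hF : IsFullerene G faces} {n S T : ℕ} {b : ℕ → FaceFlag faces}

theorem nx_mu (hF : IsFullerene G faces) (x : FaceFlag faces) : hF.nx x.mu = (hF.pv x).mu := rfl

theorem nx_iterate_mu (hF : IsFullerene G faces) (x : FaceFlag faces) (k : ℕ) :
    hF.nx^[k] x.mu = (hF.pv^[k] x).mu := by
  induction k with
  | zero => rfl
  | succ k ih => rw [Function.iterate_succ_apply', Function.iterate_succ_apply', ih, nx_mu]

namespace Realises

variable (R : hF.Realises n S T b) (hC : Closed n S T)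
include R

theorem exists_pv_iterate {d : ℕ} (hd : isDart n S d = true) (k : ℕ) :
    ∃ e, isDart n S e = true ∧ hF.pt b e = hF.pv^[k] (hF.pt b d) := by
  induction k with
  | zero => exact ⟨d, hd, rfl⟩
  | succ k ih =>
    obtain ⟨e, he, h⟩ := ih
    exact ⟨prev S e, isDart_adv he _, by rw [R.pt_prev he, h, Function.iterate_succ_apply']⟩

include hC

theorem surjective (x : FaceFlag faces) :
    ∃ d, isDart n S d = true ∧ (x = hF.pt b d ∨ x = (hF.pt b d).mu) := by
  refine hF.flag_induction (S := fun x => ∃ d, isDart n S d = true ∧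
    (x = hF.pt b d ∨ x = (hF.pt b d).mu)) ?_ ?_ ?_ (x := hF.pt b 0) ⟨0, ?_, Or.inl rfl⟩ x
  · rintro x ⟨d, hd, rfl | rfl⟩
    · exact ⟨next S d, isDart_adv hd _, Or.inl (R.pt_next hd).symm⟩
    · exact ⟨prev S d, isDart_adv hd _, Or.inr (by rw [R.pt_prev hd]; rfl)⟩
  · rintro x ⟨d, hd, h⟩
    obtain ⟨e, he, -⟩ := hC.glued_entry d hd
    obtain ⟨-, h1, h2⟩ := R.glue _ _ he
    refine ⟨e, h1, ?_⟩
    rcases h with rfl | rfl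
    · exact Or.inl h2
    · exact Or.inr (by rw [gl_mu, h2])
  · rintro x ⟨d, hd, rfl | rfl⟩
    · exact ⟨d, hd, Or.inr rfl⟩
    · exact ⟨d, hd, Or.inl rfl⟩
  · rw [isDart_iff]
    have := hC.pos
    rcases fsz_eq S (0 / 8) with h | h <;> rw [h] <;> omega

theorem exists_face_eq {f : Finset (Sym2 V)} (hf : f ∈ faces) : ∃ j < n, f = (b j).f := by
  obtain ⟨u, hu⟩ := hF.exists_faceParam hf
  obtain ⟨d, hd, h⟩ := R.surjective hC ⟨_, _, f, hf, (hu.mem _).2 ⟨0, rfl⟩⟩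
  refine ⟨d / 8, (isDart_iff.1 hd).1, ?_⟩
  rcases h with h | h
  · exact (congrArg FaceFlag.f h).trans (hF.pt_f b d)
  · exact (congrArg FaceFlag.f h).trans (hF.pt_f b d)

theorem pentagon_injective {f g : ℕ} (hf : f < n) (hg : g < n) (hSf : Nat.testBit S f = false)
    (hSg : Nat.testBit S g = false) (h : (b f).f = (b g).f) : f = g := by
  classical
  refine Finset.injOn_of_surjOn_of_card_le (s := (Finset.range n).filter
    (fun f => Nat.testBit S f = false)) (t := faces.filter (fun f => f.card = 5))
    (fun f => (b f).f) ?_ ?_ ?_ (by simp [hf, hSf]) (by simp [hg, hSg]) h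
  · intro f hf
    simp only [Finset.coe_filter, Finset.mem_range, Set.mem_ofPred_eq] at hf ⊢
    refine ⟨(b f).mem, ?_⟩
    have := R.sz f hf.1
    rwa [fsz, hf.2, cond_false] at this
  · intro g hg
    simp only [Finset.coe_filter, Set.mem_ofPred_eq] at hg
    obtain ⟨j, hj, rfl⟩ := R.exists_face_eq hC hg.1
    refine ⟨j, ?_, rfl⟩
    simp only [Finset.coe_filter, Finset.mem_range, Set.mem_ofPred_eq]
    refine ⟨hj, ?_⟩
    have := R.sz j hj
    rw [FaceFlag.sz, hg.2, fsz] at this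
    cases h : Nat.testBit S j
    · rfl
    · rw [h] at this; simp at this
  · rw [hF.pentagons, hC.count]

theorem injective_aux (f : ℕ) : ∀ d e, d / 8 = f → isDart n S d = true → isDart n S e = true →
    (hF.pt b d = hF.pt b e → d = e) ∧ hF.pt b d ≠ (hF.pt b e).mu := by
  induction f using Nat.strong_induction_on with
  | _ f ih =>
    intro d e hdf hd he
    have hd' := isDart_iff.1 hd
    have he' := isDart_iff.1 he
    rcases Nat.eq_zero_or_pos f with rfl | hpos
    · have key : (hF.pt b d).f = (hF.pt b e).f → d / 8 = e / 8 := by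
        intro h
        have h1 := R.pt_sz hd
        rw [FaceFlag.sz, h, hdf, fsz, hC.pentagon, cond_false] at h1
        have h2 := R.pt_sz he
        rw [FaceFlag.sz, h1, fsz] at h2
        refine R.pentagon_injective hC hd'.1 he'.1 (by rw [hdf, hC.pentagon]) ?_ (by simpa using h)
        cases h : Nat.testBit S (e / 8)
        · rfl
        · rw [h] at h2; simp at h2
      exact ⟨fun h => R.eq_of_pt_eq hd he (key (by rw [h])) h,
        fun h => R.pt_ne_mu hd he (key (by rw [h]; rfl)) h⟩
    · obtain ⟨k, hk⟩ : ∃ k, adv S d k = 8 * f := by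
        refine ⟨fsz S (d / 8) - d % 8, ?_⟩
        have h1 := adv_div_mod S d (fsz S (d / 8) - d % 8)
        rw [show d % 8 + (fsz S (d / 8) - d % 8) = fsz S (d / 8) by omega, Nat.mod_self] at h1
        omega
      have hd1 := isDart_adv hd k
      have hpd := R.pt_adv hd k
      rw [hk] at hd1 hpd
      obtain ⟨a, ha, ha'⟩ := hC.glued_entry _ hd1
      have hlow := hC.lower f (hdf ▸ hd'.1) hpos.ne'
      obtain ⟨-, ha2, ha3⟩ := R.glue _ _ ha
      constructor
      · intro h
        have he1 := isDart_adv he k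
        obtain ⟨c, hc, hc'⟩ := hC.glued_entry _ he1
        obtain ⟨-, hc2, hc3⟩ := R.glue _ _ hc
        have h1 : a = c := by
          refine (ih (a / 8) (by omega) a c rfl ha2 hc2).1 ?_
          rw [← ha3, ← hc3, hpd, h, R.pt_adv he]
        rw [h1, hc'] at ha'
        have h2 := (adv_div_mod S e k).1
        exact R.eq_of_pt_eq hd he (by omega) h
      · intro h
        obtain ⟨e1, he1, he2⟩ := R.exists_pv_iterate he k
        obtain ⟨c, hc, -⟩ := hC.glued_entry _ he1
        obtain ⟨-, hc2, hc3⟩ := R.glue _ _ hc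
        refine (ih (a / 8) (by omega) a c rfl ha2 hc2).2 ?_
        rw [← ha3, ← hc3, hpd, h, nx_iterate_mu, he2, gl_mu]

theorem exists_dart_at (v : V) : ∃ d, isDart n S d = true ∧ (hF.pt b d).v = v := by
  obtain ⟨x, rfl⟩ := hF.exists_flag_at v
  obtain ⟨d, hd, rfl | rfl⟩ := R.surjective hC x
  · exact ⟨d, hd, rfl⟩
  · exact ⟨next S d, isDart_adv hd _, by rw [R.pt_next hd]; rfl⟩

theorem vertex_rule_turn {d : ℕ} (hd : isDart n S d = true) :
    isDart n S (turn S T d) = true ∧ hF.pt b (turn S T d) = hF.rot (hF.pt b d) := by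
  obtain ⟨a, ha, -⟩ := hC.glued_entry _ (isDart_adv hd (fsz S (d / 8) - 1))
  rw [← prev] at ha
  obtain ⟨-, h1, h2⟩ := R.glue _ _ ha
  rw [turn, ha, Nat.add_sub_cancel]
  refine ⟨h1, ?_⟩
  rw [← h2, R.pt_prev hd, rot]

theorem exists_matching {M : ℕ} (hM : isMatching n S T M = true) :
    ∃ N : G.Subgraph, N.IsPerfectMatching ∧ ∀ d, isDart n S d = true → Nat.testBit M d = true →
      N.Adj (hF.pt b d).v (hF.pt b d).w := by
  have hM' : ∀ d, isDart n S d = true → Nat.testBit M d = Nat.testBit M (entry T d - 1) ∧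
      exactlyOne (Nat.testBit M d) (Nat.testBit M (turn S T d))
        (Nat.testBit M (turn S T (turn S T d))) = true := by
    intro d hd
    simp only [isMatching, List.all_eq_true, List.mem_range, Bool.or_eq_true, Bool.and_eq_true,
      beq_iff_eq, Bool.not_eq_true'] at hM
    exact (hM d (lt_of_isDart hd)).resolve_left (by rw [hd]; simp)
  let N : G.Subgraph :=
    { verts := Set.univ
      Adj := fun v w => ∃ d, isDart n S d = true ∧ Nat.testBit M d = true ∧
        (hF.pt b d).v = v ∧ (hF.pt b d).w = w
      adj_sub := by
        rintro v w ⟨d, -, -, rfl, rfl⟩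
        exact hF.adj _
      edge_vert := fun _ => Set.mem_univ _
      symm := by
        refine ⟨?_⟩
        rintro v w ⟨d, hd, hMd, rfl, rfl⟩
        obtain ⟨e, he, -⟩ := hC.glued_entry d hd
        obtain ⟨-, h1, h2⟩ := R.glue _ _ he
        refine ⟨e, h1, ?_, by rw [← h2]; rfl, by rw [← h2]; rfl⟩
        rw [(hM' d hd).1, he, Nat.add_sub_cancel] at hMd
        exact hMd }
  refine ⟨N, Subgraph.isPerfectMatching_iff.2 fun v => ?_, fun d hd hMd => ⟨d, hd, hMd, rfl, rfl⟩⟩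
  obtain ⟨d, hd, hdM, rfl⟩ : ∃ d, isDart n S d = true ∧ Nat.testBit M d = true ∧
      (hF.pt b d).v = v := by
    obtain ⟨d, hd, rfl⟩ := R.exists_dart_at hC v
    obtain ⟨h1, h2⟩ := R.vertex_rule_turn hC hd
    obtain ⟨h3, h4⟩ := R.vertex_rule_turn hC h1
    have h5 := (hM' d hd).2
    cases k1 : Nat.testBit M d
    · rw [k1, exactlyOne, cond_false] at h5
      cases k2 : Nat.testBit M (turn S T d)
      · rw [k2, Bool.false_xor] at h5
        exact ⟨_, h3, h5, by rw [h4, h2]; rfl⟩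
      · exact ⟨_, h1, k2, by rw [h2]; rfl⟩
    · exact ⟨d, hd, k1, rfl⟩
  refine ⟨(hF.pt b d).w, ⟨d, hd, hdM, rfl, rfl⟩, ?_⟩
  rintro w ⟨d', hd', hdM', hv, rfl⟩
  obtain ⟨h1, h2⟩ := R.vertex_rule_turn hC hd
  obtain ⟨h3, h4⟩ := R.vertex_rule_turn hC h1
  have h5 := (hM' d hd).2
  rw [hdM, exactlyOne, cond_true, Bool.and_eq_true, Bool.not_eq_true', Bool.not_eq_true'] at h5
  have key : ∀ g, isDart n S g = true → (hF.pt b g).v = (hF.pt b d).v →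
      (hF.pt b d').w = (hF.pt b g).w → d' = g := by
    intro g hg hgv hgw
    rcases hF.eq_or_eq_of_dir (hv.trans hgv.symm) hgw with h | h
    · exact (R.injective_aux hC _ d' g rfl hd' hg).1 h
    · obtain ⟨e, he, -⟩ := hC.glued_entry g hg
      obtain ⟨-, he1, he2⟩ := R.glue _ _ he
      rw [he2] at h
      exact absurd h (R.injective_aux hC _ d' e rfl hd' he1).2
  have hadj := hF.adj (hF.pt b d')
  rw [hv] at hadj
  rcases hF.eq_of_adj _ hadj with h | h | h
  · exact h
  · rw [← h2] at h
    rw [key _ h1 (by rw [h2]; rfl) h, h5.1] at hdM'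
    exact absurd hdM' (by simp)
  · rw [← h2, ← h4] at h
    rw [key _ h3 (by rw [h4, h2]; rfl) h, h5.2] at hdM'
    exact absurd hdM' (by simp)

omit hC in
theorem altFace_of_alternates {M j : ℕ} {N : G.Subgraph} (hj : j < n)
    (hS : Nat.testBit S j = true) (hM : alternates S M j = true)
    (hN : ∀ d, isDart n S d = true → Nat.testBit M d = true →
      N.Adj (hF.pt b d).v (hF.pt b d).w) : AltFace G N (b j).f := by
  have hsz : fsz S j = 6 := by rw [fsz, hS, cond_true]
  have hpt : ∀ k < 6, isDart n S (8 * j + k) = true ∧ hF.pt b (8 * j + k) = hF.nx^[k] (b j) := by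
    intro k hk
    rw [isDart_iff, pt, show (8 * j + k) / 8 = j by omega, show (8 * j + k) % 8 = k by omega, hsz]
    exact ⟨⟨hj, hk⟩, rfl⟩
  intro v hv
  obtain ⟨d, hdj, hd, rfl⟩ : ∃ d, d / 8 = j ∧ isDart n S d = true ∧ (hF.pt b d).v = v := by
    obtain ⟨w, hw⟩ := mem_faceVerts.1 hv
    obtain ⟨k, hk, h⟩ := hF.exists_iterate_of_f_eq (x := b j) (y := ⟨v, w, _, (b j).mem, hw⟩) rfl
    rw [R.sz j hj, hsz] at hk
    obtain ⟨h1, h2⟩ := hpt k hk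
    rw [← h2] at h
    rcases h with h | h
    · exact ⟨8 * j + k, by omega, h1, (congrArg FaceFlag.v h).symm⟩
    · refine ⟨next S (8 * j + k), by rw [next, (adv_div_mod _ _ _).1]; omega, isDart_adv h1 _, ?_⟩
      rw [R.pt_next h1]
      exact (congrArg FaceFlag.v h).symm
  have hf : (hF.pt b d).f = (b j).f := by rw [pt_f, hdj]
  have hd' := isDart_iff.1 hd
  simp only [alternates, List.all_eq_true, Bool.or_eq_true] at hM
  have hMd : Nat.testBit M d = true ∨ Nat.testBit M (prev S d) = true := by
    rw [hdj, hsz] at hd'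
    have := hM (d % 8) (by
      have : d % 8 < 6 := hd'.2
      interval_cases d % 8 <;> simp)
    rwa [show 8 * j + d % 8 = d by omega] at this
  rcases hMd with h | h
  · exact ⟨_, hf ▸ (hF.pt b d).edge, hN d hd h⟩
  · have := hN _ (isDart_adv hd _) h
    rw [← prev, R.pt_prev hd] at this
    exact ⟨_, hf ▸ hF.pv_edge (hF.pt b d), this.symm⟩

theorem exists_of_covers {H : Finset (Finset (Sym2 V))}
    (hH : ∀ f ∈ H, ∀ g ∈ H, f ≠ g → Disjoint (faceVerts f) (faceVerts g)) {l : List ℕ} {C : ℕ}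
    (hc : covers n S T l C = true) (hHC : ∀ j, Nat.testBit C j = true → (b j).f ∉ H) :
    ∃ M ∈ l, ∀ j < n, Nat.testBit S j = true → (b j).f ∈ H → alternates S M j = true := by
  induction l generalizing C with
  | nil => simp [covers] at hc
  | cons M l ih =>
    by_cases hM : ∀ j < n, Nat.testBit S j = true → (b j).f ∈ H → alternates S M j = true
    · exact ⟨M, by simp, hM⟩
    push Not at hM
    obtain ⟨j, hj, hS, hjH, hM⟩ := hM
    simp only [covers, List.all_eq_true, List.mem_range, Bool.or_eq_true, Bool.not_eq_true'] at hc
    have hc' : covers n S T l (C ||| neighbors T j) = true := by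
      rcases hc j hj with ((h | h) | h) | h
      · rw [hS] at h; exact absurd h (by simp)
      · exact absurd hjH (hHC j h)
      · exact absurd h hM
      · exact h
    have hnb : ∀ i < 6, ∀ C, (∀ k, Nat.testBit C k = true → (b k).f ∉ H) →
        ∀ k, Nat.testBit (C ||| 1 <<< ((entry T (8 * j + i) - 1) / 8)) k = true →
          (b k).f ∉ H := by
      intro i hi C hC' k hk hkH
      rw [Nat.testBit_or, Nat.one_shiftLeft, Nat.testBit_two_pow, Bool.or_eq_true,
        decide_eq_true_eq] at hk
      rcases hk with hk | hk
      · exact hC' k hk hkH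
      have h1 : (8 * j + i) / 8 = j := by omega
      have hd : isDart n S (8 * j + i) = true := by
        rw [isDart_iff, h1, fsz, hS, cond_true]
        omega
      obtain ⟨e, he, -⟩ := hC.glued_entry _ hd
      rw [he, Nat.add_sub_cancel] at hk
      have h2 := R.div_ne_of_glue he
      rw [h1, hk] at h2
      exact hF.gl_f_ne_of_disjoint (hF.pt b (8 * j + i))
        (disjoint_faceVerts.1 (hH _ hjH _ hkH h2)) (by rw [pt_f, h1]) (by rw [R.gl_f he, hk])
    obtain ⟨M', hM', h⟩ := ih hc' (by
      intro k hk
      rw [Nat.testBit_or, Bool.or_eq_true] at hk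
      rcases hk with hk | hk
      · exact hHC k hk
      · simp only [neighbors, List.foldr] at hk
        exact hnb 0 (by omega) _ (hnb 1 (by omega) _ (hnb 2 (by omega) _ (hnb 3 (by omega) _
          (hnb 4 (by omega) _ (hnb 5 (by omega) 0 (by simp)))))) k hk)
    exact ⟨M', List.mem_cons_of_mem _ hM', h⟩

omit hC in
theorem kResonant_of_isSolved {l : List ℕ} (h : isSolved n S T l = true) (k : ℕ) :
    KResonant G faces k := by
  simp only [isSolved, Bool.and_eq_true, List.all_eq_true] at h
  obtain ⟨⟨h1, h2⟩, h3⟩ := h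
  have hC := closed_of_isClosed h1
  intro H hHf hH6 hH _
  obtain ⟨M, hM, hMH⟩ := R.exists_of_covers hC hH h3 (by simp)
  obtain ⟨N, hN, hNM⟩ := R.exists_matching hC (h2 M hM)
  refine ⟨N, hN, fun f hf => ?_⟩
  obtain ⟨j, hj, rfl⟩ := R.exists_face_eq hC (hHf hf)
  have hS : Nat.testBit S j = true := by
    have h4 := R.sz j hj
    rw [FaceFlag.sz, hH6 _ hf, fsz] at h4
    cases h : Nat.testBit S j
    · rw [h] at h4; simp at h4
    · rfl
  exact R.altFace_of_alternates hj hS (hMH j hj hS hf) hNM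

end Realises

end IsFullerene

end Embedding

namespace FaceTable

/-- A certificate for an exhaustive search through the ways of completing a table. The leaf `ring`
is for a pentagon with an excluded neighborhood, and `root` is for the wrong neighborhood of the
initial pentagon. -/
inductive Cert
  | grow (d : ℕ) (l₅ : List ℕ) (c₅ : Cert) (l₆ : List ℕ) (c₆ : Cert)
  | ring (f q : ℕ)
  | root (i : ℕ)
  | chord (x y z : ℕ)
  | clash (s : Bool) (x : ℕ) (w : List ℕ) (p q : ℕ)
  | nonres (H : List ℕ) (D : List (ℕ × ℕ)) (l : List ℕ)
  | solved (l : List ℕ)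

/-- Is the `i`-th neighbor of the face `f` recorded, with the type given by `q`? -/
def isNeighbor (S T f i q : ℕ) (s : Bool) : Bool :=
  Nat.blt 0 (entry T (8 * f + i)) &&
    (Nat.testBit S ((entry T (8 * f + i) - 1) / 8) == xor s (Nat.testBit q i))

/-- Verify a certificate, for a table whose initial pentagon has the neighborhood `p`, in a
fullerene in which the neighborhoods in the set `D` do not occur. -/
def check (p D : ℕ) : Cert → ℕ → ℕ → ℕ → Bool
  | .grow d l₅ c₅ l₆ c₆, n, S, T =>
    isDart n S d && Nat.beq (entry T d) 0 && Nat.ble n 126 && !Nat.testBit S n &&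
      (closeUp (n + 1) S l₅ (setEntry (setEntry T d (8 * n)) (8 * n) d)).elim false
        (check p D c₅ (n + 1) S) &&
      (closeUp (n + 1) (S ||| 1 <<< n) l₆ (setEntry (setEntry T d (8 * n)) (8 * n) d)).elim false
        (check p D c₆ (n + 1) (S ||| 1 <<< n))
  | .ring f q, n, S, T => Nat.blt f n && !Nat.testBit S f && Nat.testBit D q &&
      [0, 1, 2, 3, 4].all (fun i => isNeighbor S T f i q false)
  | .root i, _, S, T => Nat.blt i 5 && isNeighbor S T 0 i p true
  | .chord x y z, _, S, T => isChord S T x y z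
  | .clash s x w p q, n, S, T => isClash n S T s x w p q
  | .nonres H D l, n, S, T => isNonresonant n S T H D l
  | .solved l, n, S, T => isSolved n S T l

theorem exists_of_elim_false {α : Type*} {o : Option α} {f : α → Bool}
    (h : o.elim false f = true) : ∃ a, o = some a ∧ f a = true := by
  cases o with
  | none => simp at h
  | some a => exact ⟨a, rfl, h⟩

theorem fsz_or {S n f : ℕ} (h : f < n) : fsz (S ||| 1 <<< n) f = fsz S f := by
  rw [fsz, fsz, Nat.testBit_or, Nat.one_shiftLeft, Nat.testBit_two_pow, decide_eq_false (by omega),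
    Bool.or_false]

theorem fsz_or_self (S n : ℕ) : fsz (S ||| 1 <<< n) n = 6 := by
  rw [fsz, Nat.testBit_or, Nat.one_shiftLeft, Nat.testBit_two_pow_self, Bool.or_true, cond_true]

end FaceTable

open FaceTable

section Embedding

variable {V : Type*} [Fintype V] [DecidableEq V] {G : SimpleGraph V}
  {faces : Finset (Finset (Sym2 V))}

namespace IsFullerene

/-- The bits of `q` tell which of the faces around the flag `x` are hexagons. -/
def HasPattern (hF : IsFullerene G faces) (x : FaceFlag faces) (q : ℕ) : Prop :=
  ∀ i < 5, (hF.gl (hF.nx^[i] x)).sz = 6 ↔ Nat.testBit q i = true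

/-- No pentagon has a neighborhood in the set `D`. -/
def Excluded (hF : IsFullerene G faces) (D : ℕ) : Prop :=
  ∀ q, Nat.testBit D q = true → ∀ x : FaceFlag faces, x.sz = 5 → ¬ hF.HasPattern x q

variable {hF : IsFullerene G faces} {n S T : ℕ} {b : ℕ → FaceFlag faces}

namespace Realises

theorem isNeighbor_iff {f i q : ℕ} {s : Bool} (R : hF.Realises n S T b) (hi : i < 5)
    (h : isNeighbor S T f i q s = true) :
    (hF.gl (hF.nx^[i] (b f))).sz = 6 ↔ (xor s (Nat.testBit q i)) = true := by
  rw [isNeighbor, Bool.and_eq_true, Nat.blt_eq, beq_iff_eq] at h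
  obtain ⟨e, he⟩ := exists_entry h.1
  rw [he, Nat.add_sub_cancel] at h
  have h1 := R.gl_f he
  rw [pt, show (8 * f + i) / 8 = f by omega, show (8 * f + i) % 8 = i by omega] at h1
  rw [FaceFlag.sz, h1, ← h.2]
  have h2 := R.sz _ (isDart_iff.1 (R.glue _ _ he).2.1).1
  rw [FaceFlag.sz, fsz] at h2
  rw [h2]
  cases Nat.testBit S (e / 8) <;> simp

theorem kResonant_of_check {p D : ℕ} {c : Cert} (R : hF.Realises n S T b) (hn : 0 < n)
    (hp : hF.HasPattern (b 0) p)
    (hD : hF.Excluded D)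
    (hres : KResonant G faces 3) (h : check p D c n S T = true) (k : ℕ) : KResonant G faces k := by
  induction c generalizing n S T b with
  | grow d l₅ c₅ l₆ c₆ ih₅ ih₆ =>
    simp only [check, Bool.and_eq_true, Nat.beq_eq, Nat.ble_eq, Bool.not_eq_true'] at h
    obtain ⟨⟨⟨⟨⟨h1, h2⟩, h3⟩, h4⟩, h5⟩, h6⟩ := h
    obtain ⟨T₅, h5, h5'⟩ := exists_of_elim_false h5
    obtain ⟨T₆, h6, h6'⟩ := exists_of_elim_false h6
    have hp' : hF.HasPattern (Function.update b n (hF.gl (hF.pt b d)) 0) p := by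
      rwa [Function.update_of_ne (by omega)]
    rcases hF.sz_eq (hF.gl (hF.pt b d)) with hs | hs
    · refine ih₅ ((R.attach h3 h1 h2 (fun _ _ => rfl) ?_).closeUp (by omega) h5) (by omega) hp' h5'
      rw [hs, fsz, h4, cond_false]
    · refine ih₆ ((R.attach h3 h1 h2 (fun _ => fsz_or) ?_).closeUp (by omega) h6) (by omega) hp' h6'
      rw [hs, fsz_or_self]
  | ring f q =>
    simp only [check, Bool.and_eq_true, Nat.blt_eq, Bool.not_eq_true', List.all_eq_true] at h
    obtain ⟨⟨⟨h1, h2⟩, h3⟩, h4⟩ := h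
    refine absurd (fun i hi => ?_) (hD q h3 (b f) (by rw [R.sz f h1, fsz, h2, cond_false]))
    rw [R.isNeighbor_iff hi (h4 i (by interval_cases i <;> simp)), Bool.false_xor]
  | root i =>
    rw [check, Bool.and_eq_true, Nat.blt_eq] at h
    have h1 := R.isNeighbor_iff h.1 h.2
    rw [hp i h.1] at h1
    cases h2 : Nat.testBit p i <;> simp [h2] at h1
  | chord x y z => exact absurd h R.not_isChord
  | clash s x w p q => exact absurd h R.not_isClash
  | nonres H D l => exact absurd h (R.not_isNonresonant hres)
  | solved l => exact R.kResonant_of_isSolved h k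

end Realises

theorem realises_initial (hF : IsFullerene G faces) {x : FaceFlag faces} (hx : x.sz = 5) :
    hF.Realises 1 0 0 (fun _ => x) := by
  refine ⟨fun f _ => by rw [hx, fsz, Nat.zero_testBit, cond_false], fun d e h => ?_⟩
  rw [entry, Nat.zero_shiftRight] at h
  simp at h

/-- Rotate a pattern by one step. -/
def rotatePattern (q : ℕ) : ℕ := q / 2 + q % 2 * 16

/-- Reflect a pattern. -/
def reflectPattern (q : ℕ) : ℕ :=
  [0, 1, 2, 3, 4].foldr (fun i r => bif Nat.testBit q i then r + 2 ^ ((5 - i) % 5) else r) 0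

theorem HasPattern.rotate {x : FaceFlag faces} {q : ℕ} (hq : q < 32) (hx : x.sz = 5)
    (h : hF.HasPattern x q) : hF.HasPattern (hF.nx x) (rotatePattern q) := by
  intro i hi
  have h1 : hF.nx^[i] (hF.nx x) = hF.nx^[(i + 1) % 5] x := by
    rw [← Function.iterate_succ_apply, nx_iterate_eq_iff, hx, Nat.mod_mod]
  rw [h1, h _ (Nat.mod_lt _ (by omega))]
  have : ∀ q < 32, ∀ i < 5, Nat.testBit q ((i + 1) % 5) = Nat.testBit (rotatePattern q) i := by
    decide
  rw [this q hq i hi]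

theorem HasPattern.reflect {x : FaceFlag faces} {q : ℕ} (hq : q < 32) (hx : x.sz = 5)
    (h : hF.HasPattern x q) : hF.HasPattern x.mu (reflectPattern q) := by
  intro i hi
  have h1 : hF.pv^[i] x = hF.nx^[(5 - i) % 5] x := by
    have h2 : x = hF.nx^[i] (hF.nx^[(5 - i) % 5] x) := by
      rw [← Function.iterate_add_apply]
      refine (hF.nx_iterate_eq_iff x 0 _).2 ?_
      rw [hx]
      omega
    have h3 : ∀ y, hF.pv^[i] (hF.nx^[i] y) = y := by
      intro y
      exact Function.LeftInverse.iterate (fun z => hF.pv_nx z) i y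
    conv_lhs => rw [h2]
    exact h3 _
  rw [nx_iterate_mu, gl_mu]
  change (hF.gl (hF.pv^[i] x)).sz = 6 ↔ _
  rw [h1, h _ (Nat.mod_lt _ (by omega))]
  have : ∀ q < 32, ∀ i < 5, Nat.testBit q ((5 - i) % 5) = Nat.testBit (reflectPattern q) i := by
    decide
  rw [this q hq i hi]

theorem exists_hasPattern (hF : IsFullerene G faces) (x : FaceFlag faces) :
    ∃ q < 32, hF.HasPattern x q := by
  classical
  let c : ℕ → ℕ := fun i => if (hF.gl (hF.nx^[i] x)).sz = 6 then 1 else 0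
  have hc : ∀ i, c i ≤ 1 := fun i => by simp only [c]; split_ifs <;> simp
  have key : ∀ i < 5, (hF.gl (hF.nx^[i] x)).sz = 6 ↔ c i = 1 := fun i _ => by simp [c]
  refine ⟨c 0 + 2 * c 1 + 4 * c 2 + 8 * c 3 + 16 * c 4, ?_, fun i hi => ?_⟩
  · have := hc 0; have := hc 1; have := hc 2; have := hc 3; have := hc 4
    omega
  · rw [key i hi, Nat.testBit_eq_decide_div_mod_eq, decide_eq_true_eq]
    have := hc 0; have := hc 1; have := hc 2; have := hc 3; have := hc 4
    interval_cases i <;> norm_num <;> omega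

theorem exists_pentagon (hF : IsFullerene G faces) : ∃ x : FaceFlag faces, x.sz = 5 := by
  obtain ⟨f, hf⟩ := Finset.card_pos.1 (by rw [hF.pentagons]; norm_num :
    0 < (faces.filter (fun f => f.card = 5)).card)
  rw [Finset.mem_filter] at hf
  obtain ⟨e, he⟩ := Finset.card_pos.1 (by omega : 0 < f.card)
  induction e with
  | _ v w => exact ⟨⟨v, w, f, hf.1, he⟩, hf.2⟩

theorem HasPattern.rotate_iterate {x : FaceFlag faces} {q : ℕ} (hq : q < 32) (hx : x.sz = 5)
    (h : hF.HasPattern x q) (r : ℕ) : ∃ y : FaceFlag faces, y.sz = 5 ∧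
      hF.HasPattern y (rotatePattern^[r] q) := by
  have : ∃ y : FaceFlag faces, y.sz = 5 ∧ hF.HasPattern y (rotatePattern^[r] q) ∧
      rotatePattern^[r] q < 32 := by
    induction r with
    | zero => exact ⟨x, hx, h, hq⟩
    | succ r ih =>
      obtain ⟨y, h1, h2, h3⟩ := ih
      rw [Function.iterate_succ_apply']
      refine ⟨hF.nx y, h1, h2.rotate h3 h1, ?_⟩
      unfold rotatePattern at h3 ⊢
      omega
  obtain ⟨y, h1, h2, -⟩ := this
  exact ⟨y, h1, h2⟩

/-- The patterns in `D'` that are not in `D` are equivalent to `p`. -/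
def isExtension (p D D' : ℕ) : Bool :=
  Nat.blt D' (2 ^ 32) && (List.range 32).all (fun q => !Nat.testBit D' q || Nat.testBit D q ||
    (List.range 5).any (fun r => Nat.beq (rotatePattern^[r] q) p ||
      Nat.beq (rotatePattern^[r] (reflectPattern q)) p))

theorem Excluded.extend (hres : KResonant G faces 3) (hk : ¬ ∀ k, KResonant G faces k)
    {p D : ℕ} (hD : hF.Excluded D) (D' : ℕ) (c : Cert) (h : isExtension p D D' = true)
    (hc : check p D c 1 0 0 = true) : hF.Excluded D' := by
  have key : ∀ x : FaceFlag faces, x.sz = 5 → ¬ hF.HasPattern x p := fun x hx hp =>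
    hk ((hF.realises_initial hx).kResonant_of_check one_pos hp hD hres hc)
  intro q hq x hx hxq
  simp only [isExtension, Bool.and_eq_true, Nat.blt_eq, List.all_eq_true, List.mem_range,
    Bool.or_eq_true, List.any_eq_true, Nat.beq_eq, Bool.not_eq_true'] at h
  have hq32 : q < 32 := by
    by_contra hle
    have := Nat.testBit_lt_two_pow (h.1.trans_le (Nat.pow_le_pow_right two_pos (not_lt.1 hle)))
    rw [hq] at this
    exact absurd this (by simp)
  rcases h.2 q hq32 with (h | h) | ⟨r, -, h | h⟩
  · rw [hq] at h; exact absurd h (by simp)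
  · exact hD q h x hx hxq
  · obtain ⟨y, hy, h1⟩ := hxq.rotate_iterate hq32 hx r
    exact key y hy (h ▸ h1)
  · have h2 : ∀ q < 32, reflectPattern q < 32 := by decide
    obtain ⟨y, hy, h1⟩ := (hxq.reflect hq32 hx).rotate_iterate (x := x.mu) (h2 q hq32) hx r
    exact key y hy (h ▸ h1)

end IsFullerene

end Embedding

namespace FaceTable

/-- Search around a pentagon with neighborhood `7`. -/
def cert7 : Cert :=
  .grow 0
  [] (.root 0)
  [] (.grow 1
  [] (.root 1)
  [17] (.grow 2
  [] (.root 2)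
  [25] (.grow 3
  [33] (.grow 4
  [41, 9] (.grow 35
  [42] (.grow 28
  [34, 49] (.grow 51
  [43, 10] (.grow 58
  [50, 65] (.grow 27
  [57, 73] (.grow 82
  [74, 66, 11] (.nonres [3, 1] [(17, 21)] [4, 35, 43, 58, 66])
  [74, 66, 11] (.nonres [3, 1] [(17, 21)] [4, 35, 43, 58, 66]))
  [57, 73] (.grow 83
  [74, 66, 11] (.nonres [3, 1] [(17, 21)] [4, 35, 43, 58, 66])
  [74, 66, 11] (.nonres [3, 1] [(17, 21)] [4, 35, 43, 58, 66])))
  [50, 65] (.nonres [9, 3, 1] [(56, 58), (65, 67), (17, 21)] [4, 35]))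
  [43, 10] (.grow 58
  [50, 65] (.grow 27
  [57, 73] (.grow 82
  [74, 66] (.grow 20
  [26, 81, 89] (.grow 19
  [97, 90, 67, 11] (.chord 11 13 104)
  [97, 90, 67, 11] (.chord 11 13 104))
  [26, 81, 89] (.grow 98
  [90, 67, 11] (.grow 19
  [97, 105, 12, 18] (.clash false 113 [] 0 0)
  [97, 105, 12, 18] (.clash true 113 [] 0 0))
  [90, 67, 11] (.grow 19
  [97, 105] (.grow 114
  [106, 12, 18, 113] (.clash false 121 [] 113 0)
  [106, 12, 18, 113] (.clash true 121 [] 0 0))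
  [97, 105] (.grow 115
  [106, 12, 18, 113] (.chord 112 115 18)
  [106, 12, 18, 113] (.chord 112 115 18)))))
  [74, 66] (.nonres [11, 3, 1] [(80, 82), (66, 68), (17, 21)] [4, 35, 58]))
  [57, 73] (.nonres [10, 8, 2] [(73, 75), (25, 27), (10, 13)] [0, 36, 50]))
  [50, 65] (.nonres [9, 3, 1] [(56, 58), (65, 68), (17, 21)] [4, 35])))
  [34, 49] (.grow 51
  [43, 10] (.grow 59
  [50, 65] (.grow 74
  [66, 11] (.grow 58
  [73, 81] (.grow 90
  [82, 12, 18] (.grow 27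
  [57, 89, 97, 19] (.chord 19 21 104)
  [57, 89, 97, 19] (.chord 19 21 104))
  [82, 12, 18] (.grow 27
  [57, 89, 97] (.grow 20
  [26, 105, 98, 19] (.clash false 113 [] 0 0)
  [26, 105, 98, 19] (.clash true 113 [] 0 0))
  [57, 89, 97] (.grow 20
  [26, 105] (.grow 114
  [106, 98, 19, 113] (.clash false 121 [] 113 0)
  [106, 98, 19, 113] (.clash true 121 [] 0 0))
  [26, 105] (.grow 115
  [106, 98, 19, 113] (.chord 112 115 19)
  [106, 98, 19, 113] (.chord 112 115 19)))))
  [73, 81] (.nonres [11, 3, 1] [(56, 58), (81, 83), (17, 21)] [4, 43, 66]))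
  [66, 11] (.nonres [10, 7, 2] [(72, 74), (11, 13), (25, 28)] [3, 36, 51]))
  [50, 65] (.nonres [9, 3, 1] [(56, 59), (65, 67), (17, 21)] [4, 35]))
  [43, 10] (.nonres [8, 7, 2] [(49, 51), (10, 13), (25, 28)] [0, 3])))
  [42] (.nonres [6, 3, 1] [(33, 35), (42, 44), (17, 21)] [4]))
  [] (.root 4))
  [] (.root 3))))

/-- Search around a pentagon with neighborhood `1`. -/
def cert1 : Cert :=
  .grow 0
  [] (.root 0)
  [] (.grow 1
  [17] (.grow 2
  [25] (.grow 3
  [33] (.grow 4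
  [41, 9] (.grow 12
  [18] (.grow 51
  [19, 26] (.grow 58
  [27, 34] (.grow 50
  [57, 65] (.grow 74
  [66, 35, 42] (.grow 11
  [49, 73, 81, 43] (.clash true 10 [] 0 0)
  [49, 73, 81, 43, 10] (.clash false 89 [] 10 0))
  [66, 35, 42] (.nonres [10, 1] [(42, 44)] [4, 2, 19, 28, 58]))
  [57, 65] (.grow 75
  [66, 35, 42] (.nonres [9, 1] [(48, 50)] [19, 2, 4, 27, 35])
  [66, 35, 42] (.nonres [9, 1] [(48, 50)] [19, 2, 4, 27, 35])))
  [27, 34] (.grow 50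
  [57, 65] (.grow 11
  [49, 73] (.grow 43
  [10, 81] (.grow 67
  [35, 42, 89] (.grow 66
  [105, 106, 107, 108] (.solved [81531354836335281981580462527749])
  [105, 106, 107, 108] (.clash true 109 [] 0 0))
  [35, 42, 89] (.grow 98
  [90, 82, 74, 66] (.clash true 97 [] 0 0)
  [90, 82, 74, 66, 97] (.clash false 105 [] 97 0)))
  [10, 81] (.grow 67
  [35, 42, 89] (.grow 91
  [82, 74, 66, 97] (.clash true 90 [] 0 0)
  [82, 74, 66, 97, 90] (.clash false 105 [] 90 0))
  [35, 42, 89] (.ring 5 28)))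
  [49, 73] (.grow 83
  [74, 66] (.grow 90
  [67, 35, 42] (.grow 82
  [89, 97, 43, 10] (.clash true 81 [] 0 0)
  [89, 97, 43, 10, 81] (.clash false 105 [] 81 0))
  [67, 35, 42] (.grow 98
  [43, 10, 81] (.grow 82
  [113, 114, 115] (.clash true 116 [] 0 0)
  [113, 114, 115] (.clash true 116 [] 0 0))
  [43, 10, 81] (.ring 5 28)))
  [74, 66] (.ring 9 14)))
  [57, 65] (.grow 11
  [49, 73] (.grow 67
  [35, 42] (.grow 90
  [43, 10, 81] (.grow 75
  [66, 89, 97, 82] (.clash true 74 [] 0 0)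
  [66, 89, 97, 82, 74] (.clash false 105 [] 74 0))
  [43, 10, 81] (.grow 75
  [66, 89, 97] (.grow 74
  [113, 114, 115] (.clash true 116 [] 0 0)
  [113, 114, 115] (.clash true 116 [] 0 0))
  [66, 89, 97] (.ring 11 7)))
  [35, 42] (.nonres [11, 9, 1] [(65, 67), (42, 44), (80, 83)] [4, 2, 19]))
  [49, 73] (.ring 6 7))))
  [19, 26] (.grow 59
  [27, 34] (.grow 66
  [35, 42] (.grow 58
  [65, 73] (.grow 82
  [74, 43, 10] (.nonres [7, 1] [(48, 51)] [2, 4, 28, 43, 66])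
  [74, 43, 10] (.nonres [7, 1] [(48, 51)] [2, 4, 28, 43, 66]))
  [65, 73] (.grow 83
  [74, 43, 10] (.nonres [7, 1] [(48, 51)] [2, 4, 28, 43, 66])
  [74, 43, 10] (.nonres [7, 1] [(48, 51)] [2, 4, 28, 43, 66])))
  [35, 42] (.nonres [9, 7, 1] [(64, 66), (42, 44), (48, 51)] [2, 4]))
  [27, 34] (.grow 67
  [35, 42] (.grow 74
  [43, 10] (.grow 66
  [73, 81] (.grow 90
  [82, 11, 49] (.grow 58
  [65, 89, 97, 50] (.clash true 57 [] 0 0)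
  [65, 89, 97, 50, 57] (.clash false 105 [] 57 0))
  [82, 11, 49] (.grow 58
  [65, 89, 97] (.grow 50
  [113, 114, 115] (.clash true 116 [] 0 0)
  [113, 114, 115] (.clash true 116 [] 0 0))
  [65, 89, 97] (.ring 11 7)))
  [73, 81] (.nonres [11, 7, 1] [(64, 66), (81, 83), (48, 51)] [2, 4, 43]))
  [43, 10] (.grow 66
  [73, 81] (.grow 58
  [65, 89] (.grow 50
  [57, 97] (.grow 83
  [11, 49, 105] (.grow 82
  [121, 122, 123, 124] (.solved [6667274566979126194065650728802194693])
  [121, 122, 123, 124] (.clash true 125 [] 0 0))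
  [11, 49, 105] (.grow 114
  [106, 98, 90, 82] (.clash true 113 [] 0 0)
  [106, 98, 90, 82, 113] (.clash false 121 [] 113 0)))
  [57, 97] (.grow 107
  [98, 90, 82] (.ring 12 19)
  [98, 90, 82] (.nonres [13, 10, 8] [(112, 115), (97, 100), (88, 91)] [90])))
  [65, 89] (.grow 98
  [] (.grow 50
  [57, 97, 105] (.grow 83
  [11, 49, 113, 106] (.nonres [12, 10] [(89, 91)] [67, 36, 0, 106, 51, 2, 20, 28, 3, 27])
  [11, 49, 113, 106] (.grow 108
  [99, 90, 82, 121] (.clash true 107 [] 0 0)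
  [99, 90, 82, 121, 107] (.clash false 129 [] 0 0)))
  [57, 97, 105] (.grow 83
  [11, 49, 113] (.grow 108
  [99, 90, 82, 121] (.clash true 114 [] 0 0)
  [99, 90, 82, 121, 114] (.clash true 106 [] 0 0))
  [11, 49, 113] (.grow 122
  [114, 106] (.grow 108
  [99, 90, 82, 121] (.clash true 129 [] 106 0)
  [99, 90, 82, 121, 129] (.chord 106 108 129))
  [114, 106] (.nonres [16, 7, 1] [(114, 117), (122, 125), (48, 51)] [50]))))
  [] (.grow 109
  [99, 90, 82] (.nonres [13, 10, 8] [(112, 114), (98, 101), (88, 91)] [90])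
  [99, 90, 82] (.nonres [13, 10, 8] [(112, 115), (98, 101), (88, 91)] [90]))))
  [73, 81] (.ring 9 7)))
  [35, 42] (.nonres [9, 7, 1] [(64, 67), (42, 44), (48, 51)] [2, 4]))))
  [18] (.grow 52
  [19, 26] (.grow 58
  [27, 34] (.grow 51
  [57, 65] (.grow 74
  [66, 35, 42] (.grow 50
  [73, 81, 43, 10] (.chord 10 12 88)
  [73, 81, 43, 10] (.chord 10 12 88))
  [66, 35, 42] (.nonres [10, 1] [(42, 44)] [4, 2, 19, 28, 58]))
  [57, 65] (.grow 75
  [66, 35, 42] (.nonres [9, 1] [(48, 51)] [19, 2, 4, 27, 35])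
  [66, 35, 42] (.nonres [9, 1] [(48, 51)] [19, 2, 4, 27, 35])))
  [27, 34] (.grow 51
  [57, 65] (.grow 67
  [35, 42] (.grow 82
  [43, 10] (.grow 74
  [66, 81, 89] (.grow 50
  [73, 97, 90, 11] (.clash true 49 [] 0 0)
  [73, 97, 90, 11, 49] (.clash false 105 [] 49 0))
  [66, 81, 89] (.grow 98
  [90, 11, 49] (.grow 50
  [113, 114, 115] (.clash true 116 [] 0 0)
  [113, 114, 115] (.clash true 116 [] 0 0))
  [90, 11, 49] (.ring 11 14)))
  [43, 10] (.nonres [11, 8, 6] [(80, 82), (10, 12), (72, 75)] [20, 3, 36]))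
  [35, 42] (.grow 83
  [43, 10] (.grow 74
  [66, 81] (.grow 50
  [73, 97] (.grow 106
  [98, 82, 89] (.grow 11
  [121, 122, 123, 124] (.solved [5369017654369075736018778703252165897])
  [121, 122, 123, 124] (.clash true 125 [] 0 0))
  [98, 82, 89] (.ring 12 28))
  [73, 97] (.grow 107
  [98, 82, 89] (.grow 106
  [113, 90, 11, 49] (.clash true 105 [] 0 0)
  [113, 90, 11, 49, 105] (.clash false 121 [] 105 0))
  [98, 82, 89] (.nonres [14, 8, 6] [(98, 100), (104, 107), (72, 75)] [74])))
  [66, 81] (.grow 50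
  [73, 97] (.grow 106
  [98] (.grow 90
  [11, 49, 105, 113] (.grow 115
  [99, 82, 89] (.clash false 121 [] 115 0)
  [99, 82, 89] (.clash false 121 [] 0 0))
  [11, 49, 105, 113] (.grow 115
  [99, 82, 89, 121] (.clash true 114 [] 0 0)
  [99, 82, 89, 121, 114] (.clash false 129 [] 0 0)))
  [98] (.nonres [14, 8, 6] [(98, 101), (104, 106), (72, 75)] [74]))
  [73, 97] (.grow 107
  [98] (.grow 90
  [11, 49, 105] (.grow 115
  [99, 82, 89, 121] (.clash true 106 [] 0 0)
  [99, 82, 89, 121, 106] (.clash true 113 [] 0 0))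
  [11, 49, 105] (.grow 115
  [99, 82, 89, 121] (.nonres [13, 10, 1] [(97, 100), (123, 125), (88, 91)] [90, 99])
  [99, 82, 89, 121] (.grow 114
  [129, 122, 106, 113] (.clash false 137 [] 113 0)
  [129, 122, 106, 113] (.clash true 137 [] 0 0))))
  [98] (.nonres [14, 8, 6] [(98, 101), (104, 107), (72, 75)] [74]))))
  [43, 10] (.ring 5 28)))
  [57, 65] (.ring 7 7)))
  [19, 26] (.ring 2 14)))
  [] (.root 4))
  [] (.root 3))
  [] (.root 2))
  [] (.root 1))

/-- Search around a pentagon with neighborhood `0`. -/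
def cert0 : Cert :=
  .grow 0
  [] (.grow 1
  [17] (.grow 2
  [25] (.grow 3
  [33] (.grow 4
  [41, 9] (.grow 11
  [18] (.grow 43
  [10, 49] (.grow 35
  [42, 57] (.grow 27
  [34, 65] (.grow 51
  [19, 26, 73] (.grow 50
  [89, 90, 91, 92] (.solved [2795131091155301111725032709])
  [89, 90, 91, 92] (.clash true 93 [] 0 0))
  [19, 26, 73] (.ring 2 8))
  [34, 65] (.ring 4 4))
  [42, 57] (.ring 5 4))
  [10, 49] (.ring 1 4))
  [18] (.grow 43
  [10, 49] (.ring 1 8)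
  [10, 49] (.grow 35
  [42, 57] (.ring 5 8)
  [42, 57] (.grow 27
  [34, 65] (.ring 4 8)
  [34, 65] (.grow 52
  [19, 26, 73] (.ring 2 4)
  [19, 26, 73] (.nonres [8, 6] [(57, 60)] [10, 1, 4, 20, 28]))))))
  [] (.root 4))
  [] (.root 3))
  [] (.root 2))
  [] (.root 1))
  [] (.root 0)

/-- Search around a pentagon with neighborhood `15`. -/
def cert15 : Cert :=
  .grow 0
  [] (.root 0)
  [] (.grow 1
  [] (.root 1)
  [17] (.grow 2
  [] (.root 2)
  [25] (.grow 3
  [] (.root 3)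
  [33] (.grow 4
  [41, 9] (.grow 20
  [26] (.grow 36
  [42] (.grow 59
  [43, 10] (.grow 58
  [65] (.grow 35
  [57, 73] (.ring 7 1)
  [57, 73] (.grow 75
  [66, 11] (.ring 8 8)
  [66, 11] (.grow 83
  [74, 89] (.grow 28
  [34, 81] (.grow 51
  [27, 105] (.grow 114
  [106, 82, 97] (.ring 13 25)
  [106, 82, 97] (.grow 50
  [113, 121] (.grow 19
  [49, 129] (.grow 138
  [130, 122, 98, 90] (.ring 16 8)
  [130, 122, 98, 90] (.grow 12
  [153, 154, 155, 156] (.solved [468751578898802663322496441297626929742621184])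
  [153, 154, 155, 156] (.clash true 157 [] 0 0)))
  [49, 129] (.ring 6 19))
  [113, 121] (.nonres [16, 10, 3] [(121, 124), (113, 116), (104, 107)] [106])))
  [27, 105] (.grow 50
  [113] (.grow 19
  [49, 121] (.ring 6 25)
  [49, 121] (.grow 123
  [114] (.grow 131
  [122, 137] (.grow 146
  [138] (.grow 155
  [139, 115, 106, 82] (.clash true 97 [2] 0 0)
  [139, 115, 106, 82, 97] (.grow 130
  [145, 153] (.ring 18 1)
  [145, 153] (.grow 171
  [154] (.clash false 161 [2, 3] 13 128)
  [154] (.clash false 161 [] 0 0))))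
  [138] (.nonres [19, 16, 14] [(144, 146), (138, 140), (121, 124)] [123]))
  [122, 137] (.nonres [18, 14, 2] [(137, 140), (128, 131), (48, 51)] [50]))
  [114] (.nonres [17, 16, 3] [(121, 123), (114, 117), (49, 52)] [51])))
  [113] (.grow 115
  [106, 82, 97] (.grow 124
  [114, 129, 98, 90] (.ring 17 19)
  [114, 129, 98, 90] (.nonres [14, 11, 10] [(138, 141), (128, 131), (96, 99)] [98]))
  [106, 82, 97] (.grow 124
  [114, 129] (.grow 138
  [130, 98, 90] (.grow 123
  [137, 145, 91, 12] (.clash true 18 [] 120 20)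
  [137, 145, 91, 12, 18] (.nonres [16, 15, 11] [(136, 139), (146, 148), (152, 155)] [138]))
  [130, 98, 90] (.grow 146
  [91, 12, 18] (.grow 123
  [137, 145, 153, 19] (.clash true 49 [] 0 0)
  [137, 145, 153, 19, 49] (.clash true 121 [] 0 0))
  [91, 12, 18] (.nonres [19, 16, 3] [(146, 149), (18, 21), (115, 117)] [1, 4, 90, 74, 10, 43, 66, 11, 59])))
  [114, 129] (.nonres [17, 10, 3] [(129, 132), (114, 117), (104, 107)] [106])))))
  [34, 81] (.grow 98
  [90] (.grow 107
  [82, 97, 113] (.grow 106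
  [121, 114] (.grow 130
  [115, 91, 12, 18] (.ring 14 16)
  [115, 91, 12, 18] (.grow 51
  [27, 105, 129, 137] (.clash true 19 [] 0 0)
  [27, 105, 129, 137, 19] (.clash true 49 [] 0 0)))
  [121, 114] (.ring 15 19))
  [82, 97, 113] (.grow 115
  [91, 12, 18] (.grow 122
  [114, 129, 19, 49] (.ring 16 28)
  [114, 129, 19, 49] (.nonres [17, 11, 10] [(129, 132), (122, 125), (96, 99)] [98]))
  [91, 12, 18] (.nonres [16, 15, 3] [(113, 115), (18, 21), (104, 107)] [1, 4, 90, 74, 10, 43, 66, 11, 59])))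
  [90] (.grow 107
  [82, 97, 113] (.grow 116
  [91, 12, 18] (.nonres [14, 13, 2] [(120, 122), (128, 130), (25, 28)] [3, 0, 83, 75, 36, 43, 58, 37, 59])
  [91, 12, 18] (.nonres [14, 13, 2] [(120, 122), (128, 131), (25, 28)] [3, 0, 83, 75, 36, 43, 58, 37, 59]))
  [82, 97, 113] (.grow 116
  [91, 12, 18] (.nonres [14, 13, 2] [(120, 123), (128, 130), (25, 28)] [3, 0, 83, 75, 36, 43, 58, 37, 59])
  [91, 12, 18] (.nonres [14, 13, 2] [(120, 123), (128, 131), (25, 28)] [3, 0, 83, 75, 36, 43, 58, 37, 59])))))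
  [74, 89] (.ring 9 14))))
  [65] (.nonres [9, 4, 1] [(56, 58), (65, 67), (41, 44)] [43]))
  [43, 10] (.nonres [8, 4, 2] [(56, 59), (10, 13), (25, 29)] [0]))
  [42] (.nonres [7, 3, 1] [(33, 36), (42, 44), (17, 21)] [4]))
  [26] (.nonres [6, 4, 1] [(26, 29), (17, 20), (41, 44)] [2]))
  [] (.root 4)))))

/-- Search around a pentagon with neighborhood `5`. -/
def cert5 : Cert :=
  .grow 0
  [] (.root 0)
  [] (.grow 1
  [17] (.grow 2
  [] (.root 2)
  [25] (.grow 3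
  [33] (.grow 4
  [41, 9] (.grow 35
  [42] (.grow 28
  [34, 49] (.ring 4 2)
  [34, 49] (.grow 51
  [43, 10] (.ring 5 16)
  [43, 10] (.grow 59
  [50, 65] (.grow 12
  [18] (.grow 67
  [11, 81] (.grow 83
  [19, 26] (.grow 90
  [82, 97] (.ring 10 1)
  [82, 97] (.nonres [13, 3, 1] [(97, 99), (90, 92), (17, 20)] [19]))
  [19, 26] (.grow 90
  [82, 97] (.grow 74
  [66, 89, 105] (.grow 58
  [73, 113, 106, 98] (.ring 13 8)
  [73, 113, 106, 98] (.grow 27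
  [129, 130, 131] (.clash true 132 [] 0 0)
  [129, 130, 131] (.clash true 132 [] 0 0)))
  [66, 89, 105] (.ring 11 19))
  [82, 97] (.nonres [13, 3, 1] [(97, 100), (90, 92), (17, 20)] [19])))
  [11, 81] (.grow 83
  [19, 26] (.grow 91
  [82, 97] (.grow 106
  [98, 27, 57] (.ring 12 8)
  [98, 27, 57] (.grow 90
  [105, 113] (.grow 74
  [66, 89, 121] (.grow 58
  [137, 138, 139, 140] (.solved [438629293167507787144224326025921800841732, 1574829561705822570922640524028127531242753, 703035385196647285026794322036203989501189, 700311963044417254098539824865429272274960])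
  [137, 138, 139, 140] (.clash true 141 [] 0 0))
  [66, 89, 121] (.grow 130
  [122, 114, 58, 73] (.clash true 129 [] 0 0)
  [122, 114, 58, 73, 129] (.clash false 137 [] 129 0)))
  [105, 113] (.ring 13 7)))
  [82, 97] (.ring 10 7))
  [19, 26] (.grow 91
  [82, 97] (.grow 90
  [105] (.grow 74
  [66, 89, 113] (.grow 58
  [73, 121, 114] (.grow 99
  [27, 57, 129, 115] (.clash true 106 [] 0 0)
  [27, 57, 129, 115, 106] (.clash true 98 [] 0 0))
  [73, 121, 114] (.grow 99
  [27, 57, 129] (.nonres [16, 12, 11] [(136, 138), (121, 123), (104, 107)] [13, 2, 66, 50, 0, 10, 36, 4, 43])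
  [27, 57, 129] (.nonres [16, 12, 11] [(136, 139), (121, 123), (104, 107)] [13, 2, 66, 50, 0, 10, 36, 4, 43])))
  [66, 89, 113] (.grow 58
  [73, 121] (.grow 130
  [122, 114] (.grow 99
  [27, 57, 129, 137] (.ring 18 25)
  [27, 57, 129, 137] (.grow 98
  [153, 154, 155, 156] (.solved [28634334177906006662910918869562627284587779333, 115117846641836394476566691099292770949785714945, 23305846781566785035963629287057111987205581316])
  [153, 154, 155, 156] (.clash true 157 [] 0 0)))
  [122, 114] (.nonres [17, 8, 7] [(122, 125), (128, 130), (72, 75)] [74]))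
  [73, 121] (.ring 9 15)))
  [105] (.nonres [14, 12, 1] [(105, 107), (90, 93), (80, 83)] [82]))
  [82, 97] (.ring 10 15))))
  [18] (.grow 84
  [19, 26] (.grow 83
  [89] (.grow 99
  [90, 27, 57] (.grow 98
  [105, 58, 73] (.grow 82
  [97, 113, 74, 66] (.ring 12 1)
  [97, 113, 74, 66] (.grow 11
  [129, 130, 131] (.clash true 132 [] 0 0)
  [129, 130, 131] (.clash true 132 [] 0 0)))
  [105, 58, 73] (.ring 13 14))
  [90, 27, 57] (.grow 98
  [105] (.grow 115
  [106, 58, 73] (.grow 114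
  [121, 74, 66] (.grow 82
  [97, 113, 129, 67] (.clash true 11 [] 80 0)
  [97, 113, 129, 67, 11] (.clash true 81 [] 0 0))
  [121, 74, 66] (.grow 82
  [97, 113, 129] (.nonres [16, 13, 10] [(121, 124), (136, 138), (96, 99)] [98])
  [97, 113, 129] (.nonres [16, 13, 10] [(121, 124), (136, 139), (96, 99)] [98])))
  [106, 58, 73] (.grow 122
  [74, 66] (.grow 114
  [121, 129] (.grow 138
  [130, 67, 11, 81] (.ring 18 14)
  [130, 67, 11, 81] (.grow 82
  [153, 154, 155, 156] (.solved [51403569222263847469786826576975993084380714245, 58027939611551697278645923959150199685465647620, 46141984117316881545159832098779799113004482817])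
  [153, 154, 155, 156] (.clash true 157 [] 0 0)))
  [121, 129] (.nonres [17, 8, 7] [(129, 131), (121, 124), (72, 75)] [74]))
  [74, 66] (.ring 9 15)))
  [105] (.nonres [14, 10, 3] [(96, 98), (105, 108), (88, 91)] [90])))
  [89] (.nonres [12, 3, 1] [(89, 91), (80, 83), (17, 20)] [19]))
  [19, 26] (.ring 2 30)))
  [50, 65] (.ring 6 14))))
  [42] (.nonres [6, 3, 1] [(33, 35), (42, 44), (17, 20)] [4]))
  [] (.root 4))
  [] (.root 3)))
  [] (.root 1))

/-- Search around a pentagon with neighborhood `31`. -/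
def cert31 : Cert :=
  .grow 0
  [] (.root 0)
  [] (.grow 1
  [] (.root 1)
  [17] (.grow 2
  [] (.root 2)
  [25] (.grow 3
  [] (.root 3)
  [33] (.grow 4
  [] (.root 4)
  [41, 9] (.grow 12
  [18] (.grow 20
  [26] (.grow 28
  [34] (.grow 36
  [42] (.grow 44
  [10] (.grow 51
  [19, 57] (.grow 50
  [89] (.grow 99
  [90, 58] (.ring 11 16)
  [90, 58] (.ring 11 20))
  [89] (.grow 83
  [11, 49, 97] (.grow 82
  [105, 98] (.ring 13 20)
  [105, 98] (.grow 75
  [43, 81, 113] (.grow 74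
  [121, 114] (.ring 15 20)
  [121, 114] (.grow 67
  [35, 73, 129] (.grow 66
  [137, 130] (.ring 17 20)
  [137, 130] (.grow 59
  [27, 65, 145] (.grow 100
  [90, 58, 153, 146] (.ring 11 18)
  [90, 58, 153, 146] (.grow 99
  [169, 170, 171, 172] (.solved [30783347952895193483608627689280595729718631344640])
  [169, 170, 171, 172] (.clash true 173 [] 0 0)))
  [27, 65, 145] (.ring 8 23)))
  [35, 73, 129] (.ring 9 23)))
  [43, 81, 113] (.ring 10 23)))
  [11, 49, 97] (.ring 6 23)))
  [19, 57] (.grow 59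
  [27, 65] (.grow 91
  [58, 97] (.ring 7 19)
  [58, 97] (.ring 7 23))
  [27, 65] (.grow 91
  [58, 97] (.ring 7 27)
  [58, 97] (.grow 90
  [105] (.grow 107
  [98] (.grow 50
  [89, 113] (.grow 83
  [11, 49, 129] (.ring 6 25)
  [11, 49, 129] (.ring 6 27))
  [89, 113] (.grow 83
  [11, 49, 129] (.ring 6 29)
  [11, 49, 129] (.grow 138
  [130] (.grow 67
  [35, 73] (.grow 123
  [99, 66, 153] (.ring 8 19)
  [99, 66, 153] (.ring 8 23))
  [35, 73] (.grow 123
  [99, 66, 153] (.ring 8 27)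
  [99, 66, 153] (.grow 162
  [154] (.grow 75
  [43, 81] (.grow 171
  [155, 74, 177] (.ring 9 19)
  [155, 74, 177] (.ring 9 23))
  [43, 81] (.grow 171
  [155, 74, 177] (.ring 9 27)
  [155, 74, 177] (.grow 179
  [82, 137, 145] (.ring 10 27)
  [82, 137, 145] (.grow 186
  [178, 193] (.grow 115
  [106, 121] (.grow 147
  [131, 114, 209] (.ring 14 19)
  [131, 114, 209] (.ring 14 23))
  [106, 121] (.grow 147
  [131, 114, 209] (.ring 14 27)
  [131, 114, 209] (.grow 202
  [194, 146, 217] (.ring 18 27)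
  [194, 146, 217] (.grow 170
  [185, 201, 225] (.ring 25 29)
  [185, 201, 225] (.grow 211
  [122, 161, 169, 233] (.ring 15 27)
  [122, 161, 169, 233] (.grow 210
  [249, 250, 251, 252] (.solved [37394798465065475711463697031431282758849287872982218933978485925924710912])
  [249, 250, 251, 252] (.clash true 253 [] 0 0)))))))
  [178, 193] (.nonres [25, 17, 5] [(193, 196), (178, 181), (80, 83)] [82])))))
  [154] (.nonres [21, 12, 4] [(162, 165), (154, 157), (65, 68)] [67]))))
  [130] (.nonres [18, 11, 1] [(130, 133), (138, 141), (48, 51)] [50]))))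
  [98] (.nonres [15, 11, 3] [(104, 107), (98, 101), (57, 60)] [59]))
  [105] (.nonres [14, 12, 2] [(105, 108), (90, 93), (56, 59)] [58])))))
  [10] (.nonres [10, 4, 2] [(41, 44), (10, 13), (25, 29)] [0]))
  [42] (.nonres [9, 3, 1] [(33, 36), (42, 45), (17, 21)] [4]))
  [34] (.nonres [8, 5, 2] [(34, 37), (25, 28), (9, 13)] [3]))
  [26] (.nonres [7, 4, 1] [(26, 29), (17, 20), (41, 45)] [2]))
  [18] (.nonres [6, 5, 3] [(9, 12), (18, 21), (33, 37)] [1]))))))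

/-- Search around a pentagon with neighborhood `3`. -/
def cert3 : Cert :=
  .grow 0
  [] (.root 0)
  [] (.grow 1
  [] (.root 1)
  [17] (.grow 2
  [25] (.grow 3
  [33] (.grow 4
  [41, 9] (.grow 27
  [34] (.grow 51
  [35, 42] (.ring 4 0)
  [35, 42] (.ring 4 8))
  [34] (.grow 20
  [26, 49] (.ring 3 10)
  [26, 49] (.ring 3 14)))
  [] (.root 4))
  [] (.root 3))
  [] (.root 2)))

/-- Search around a pentagon with neighborhood `11`. -/
def cert11 : Cert :=
  .grow 0
  [] (.root 0)
  [] (.grow 1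
  [] (.root 1)
  [17] (.grow 2
  [25] (.grow 3
  [] (.root 3)
  [33] (.grow 4
  [41, 9] (.grow 20
  [26] (.grow 51
  [27, 34] (.ring 3 18)
  [27, 34] (.grow 43
  [10] (.grow 36
  [42, 65] (.ring 5 18)
  [42, 65] (.grow 50
  [57] (.grow 19
  [49, 81] (.ring 6 9)
  [49, 81] (.grow 75
  [66] (.grow 99
  [67, 11] (.ring 8 18)
  [67, 11] (.grow 91
  [82] (.grow 115
  [83, 58] (.ring 10 18)
  [83, 58] (.grow 98
  [105] (.grow 74
  [97, 129] (.ring 12 9)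
  [97, 129] (.grow 123
  [59, 35, 73, 137] (.ring 18 31)
  [59, 35, 73, 137] (.grow 114
  [121] (.grow 90
  [113, 153] (.ring 14 9)
  [113, 153] (.grow 107
  [12, 18, 89, 161] (.ring 21 31)
  [12, 18, 89, 161] (.grow 139
  [130] (.grow 155
  [122, 145, 138, 177] (.ring 23 28)
  [122, 145, 138, 177] (.grow 179
  [131, 106, 169, 162] (.ring 16 18)
  [131, 106, 169, 162] (.grow 154
  [201, 202, 203, 204] (.solved [25843858447868899969164748177736711402491224339438959363500552, 32353212189069765785699696273822227835815708485670095615689993, 131942693926851702505776804959544098953698045323271601793544, 16270665023685948721921843020262502009370327654592230506890501])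
  [201, 202, 203, 204] (.clash true 205 [] 0 0))))
  [130] (.nonres [22, 13, 9] [(130, 132), (136, 139), (96, 99)] [98]))))
  [121] (.nonres [19, 11, 7] [(112, 114), (121, 124), (81, 84)] [83]))))
  [105] (.nonres [16, 9, 1] [(96, 98), (105, 108), (65, 68)] [67])))
  [82] (.nonres [14, 7, 2] [(82, 84), (88, 91), (48, 51)] [50])))
  [66] (.nonres [12, 4, 1] [(72, 75), (66, 68), (41, 44)] [43])))
  [57] (.nonres [10, 4, 2] [(57, 60), (48, 50), (25, 28)] [27])))
  [10] (.nonres [8, 4, 2] [(41, 43), (10, 13), (25, 28)] [0])))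
  [26] (.nonres [6, 4, 1] [(26, 28), (17, 20), (41, 44)] [2]))
  [] (.root 4)))
  [] (.root 2)))

set_option maxRecDepth 100000

theorem check_cert7 : check 7 0 cert7 1 0 0 = true := by decide +kernel

theorem check_cert1 : check 1 302530688 cert1 1 0 0 = true := by decide +kernel

theorem check_cert0 : check 0 302596502 cert0 1 0 0 = true := by decide +kernel

theorem check_cert15 : check 15 302596503 cert15 1 0 0 = true := by decide +kernel

theorem check_cert5 : check 5 2055848343 cert5 1 0 0 = true := by decide +kernel

theorem check_cert31 : check 31 2057160631 cert31 1 0 0 = true := by decide +kernel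

theorem check_cert3 : check 3 4204644279 cert3 1 0 0 = true := by decide +kernel

theorem check_cert11 : check 11 4221556735 cert11 1 0 0 = true := by decide +kernel

end FaceTable

/-- a fullerene graph is 3-resonant if and only if it is `k`-resonant
for every integer `k ≥ 3`. -/
theorem threeResonant_iff_kResonant {V : Type*} [Fintype V] [DecidableEq V]
    (G : SimpleGraph V) (faces : Finset (Finset (Sym2 V)))
    (hF : IsFullerene G faces) :
    KResonant G faces 3 ↔ ∀ k : ℕ, 3 ≤ k → KResonant G faces k := by
  refine ⟨fun hres => ?_, fun h => h 3 le_rfl⟩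
  suffices ∀ k, KResonant G faces k from fun k _ => this k
  by_contra hk
  have h₀ : hF.Excluded 0 := fun q hq => absurd hq (by simp)
  have h₁ := h₀.extend hres hk 302530688 cert7 (by decide +kernel) check_cert7
  have h₂ := h₁.extend hres hk 302596502 cert1 (by decide +kernel) check_cert1
  have h₃ := h₂.extend hres hk 302596503 cert0 (by decide +kernel) check_cert0
  have h₄ := h₃.extend hres hk 2055848343 cert15 (by decide +kernel) check_cert15
  have h₅ := h₄.extend hres hk 2057160631 cert5 (by decide +kernel) check_cert5
  have h₆ := h₅.extend hres hk 4204644279 cert31 (by decide +kernel) check_cert31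
  have h₇ := h₆.extend hres hk 4221556735 cert3 (by decide +kernel) check_cert3
  have h₈ := h₇.extend hres hk 4294967295 cert11 (by decide +kernel) check_cert11
  obtain ⟨x, hx⟩ := hF.exists_pentagon
  obtain ⟨q, hq, hxq⟩ := hF.exists_hasPattern x
  have hall : ∀ q < 32, Nat.testBit 4294967295 q = true := by decide
  exact h₈ q (hall q hq) x hx hxq
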